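/- arXiv:2001.10917 — 3 statements merged into one kernel-verified Lean document; each statement's English description precedes it below -/
import Mathlib

section
/- Let d ≥ 3 and let W be a random vector in ℝ^d with E W = 0 which has a Stein kernel τ^W = (τ^W_{jk})_{1≤j,k≤d}. Let Σ be a d×d positive definite matrix with σ̄² = max_j Σ_{jj}, σ̲² = min_j Σ_{jj}, smallest eigenvalue σ_*² > 0, and let Z ~ N(0,Σ). Set Δ_W := E[max_{1≤j,k≤d} |Σ_{jk} − τ^W_{jk}(W)|]. Then there is an absolute constant C > 0 such that sup_{A∈𝓡} |P(W ∈ A) − P(Z ∈ A)| ≤ C (Δ_W/σ_*²)(log d)(|log(σ̲ Δ_W/(σ̄ σ_*²))| ∨ 1). -/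
open MeasureTheory ProbabilityTheory Real Matrix

noncomputable section

/-- Density of the centered Gaussian distribution `N(0, S)` on `ℝ^d`. -/
def gaussianPdf (d : ℕ) (S : Matrix (Fin d) (Fin d) ℝ) (x : Fin d → ℝ) : ℝ :=
  (2 * π) ^ (-(d : ℝ) / 2) * S.det ^ (-(1 : ℝ) / 2) *
    Real.exp (-(1 / 2) * (x ⬝ᵥ S⁻¹.mulVec x))

/-- The centered Gaussian distribution `N(0, S)` on `ℝ^d` (for positive definite `S`). -/
def gaussianMeasure (d : ℕ) (S : Matrix (Fin d) (Fin d) ℝ) : Measure (Fin d → ℝ) :=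
  volume.withDensity fun x => ENNReal.ofReal (gaussianPdf d S x)

/-- `A` is a hyperrectangle `∏ (a_j, b_j)` with `-∞ ≤ a_j ≤ b_j ≤ ∞`. -/
def IsHyperrectangle {d : ℕ} (A : Set (Fin d → ℝ)) : Prop :=
  ∃ a b : Fin d → EReal, A = {x | ∀ j, a j < (x j : EReal) ∧ (x j : EReal) < b j}

/-- `s ^ 2` is the smallest eigenvalue of `S`. -/
def IsSmallestEigenvalueSq {d : ℕ} (S : Matrix (Fin d) (Fin d) ℝ) (s : ℝ) : Prop :=
  IsLeast {r : ℝ | ∃ x : Fin d → ℝ, x ≠ 0 ∧ S.mulVec x = r • x} (s ^ 2)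

/-- Partial derivative `∂_j f` of a function on `ℝ^d`. -/
def pd {d : ℕ} (f : (Fin d → ℝ) → ℝ) (j : Fin d) (x : Fin d → ℝ) : ℝ :=
  fderiv ℝ f x (Pi.single j 1)

/-- `τ` is a Stein kernel for the law of `W` (under the probability measure `P`):
`τ` is measurable, its entries are integrable along `W`, and
`∑_j E[∂_j f(W) W_j] = ∑_{i,j} E[∂_{ij} f(W) τ_{ij}(W)]` for every `C^∞` function `f`
with bounded partial derivatives of all orders. -/
def IsSteinKernel {d : ℕ} {Ω : Type} [MeasurableSpace Ω] (P : Measure Ω)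
    (W : Ω → Fin d → ℝ) (τ : (Fin d → ℝ) → Matrix (Fin d) (Fin d) ℝ) : Prop :=
  (∀ i j, Measurable fun x => τ x i j) ∧
  (∀ i j, Integrable (fun ω => τ (W ω) i j) P) ∧
  ∀ f : (Fin d → ℝ) → ℝ, ContDiff ℝ (⊤ : ℕ∞) f →
    (∀ n : ℕ, ∃ M : ℝ, ∀ x, ‖iteratedFDeriv ℝ n f x‖ ≤ M) →
    ∑ j, ∫ ω, pd f j (W ω) * W ω j ∂P
      = ∑ i, ∑ j, ∫ ω, pd (pd f j) i (W ω) * τ (W ω) i j ∂P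

/-! ### One-dimensional Gaussian facts -/

namespace SKB

/-- standard normal density -/
def gs (x : ℝ) : ℝ := (√(2 * π))⁻¹ * Real.exp (-(x ^ 2 / 2))

/-- standard normal distribution function -/
def Phi (x : ℝ) : ℝ := 1 / 2 + ∫ y in (0 : ℝ)..x, gs y

lemma gs_cont : Continuous gs := by unfold gs; fun_prop

lemma gs_pos (x : ℝ) : 0 < gs x := by unfold gs; positivity

lemma gs_neg (x : ℝ) : gs (-x) = gs x := by simp [gs]

lemma inv_sqrt_two_pi_le : (√(2 * π))⁻¹ ≤ 1 := by
  apply inv_le_one_of_one_le₀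
  rw [Real.one_le_sqrt]
  nlinarith [Real.pi_gt_three]

lemma gs_le_exp (x : ℝ) : gs x ≤ Real.exp (-(x ^ 2 / 2)) := by
  unfold gs
  have := inv_sqrt_two_pi_le
  have h := Real.exp_pos (-(x ^ 2 / 2))
  nlinarith

lemma gs_le_one (x : ℝ) : gs x ≤ 1 := by
  refine (gs_le_exp x).trans ?_
  rw [Real.exp_le_one_iff]
  nlinarith [sq_nonneg x]

lemma gs_eq : gs = fun x => (√(2 * π))⁻¹ * Real.exp (-(1 / 2) * x ^ 2) := by
  funext x
  unfold gs
  congr 2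
  ring

lemma gs_integrable : Integrable gs := by
  rw [gs_eq]
  exact (integrable_exp_neg_mul_sq (by norm_num)).const_mul _

lemma gs_integral_Ioi : ∫ x in Set.Ioi (0 : ℝ), gs x = 1 / 2 := by
  rw [gs_eq]
  rw [integral_const_mul, integral_gaussian_Ioi]
  have : π / (1 / 2) = 2 * π := by ring
  rw [this]
  have h : √(2 * π) ≠ 0 := by positivity
  field_simp

lemma gs_integral : ∫ x, gs x = 1 := by
  rw [gs_eq]
  rw [integral_const_mul, integral_gaussian]
  have : π / (1 / 2) = 2 * π := by ring
  rw [this]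
  have h : √(2 * π) ≠ 0 := by positivity
  field_simp

lemma one_sub_Phi (x : ℝ) : 1 - Phi x = ∫ y in Set.Ioi x, gs y := by
  have h := intervalIntegral.integral_Ioi_sub_Ioi' (f := gs) (a := 0) (b := x)
    (μ := volume) gs_integrable.integrableOn gs_integrable.integrableOn
  rw [gs_integral_Ioi] at h
  unfold Phi
  linarith

lemma hasDerivAt_Phi (x : ℝ) : HasDerivAt Phi (gs x) x := by
  unfold Phi
  have := intervalIntegral.integral_hasDerivAt_right (f := gs) (a := 0) (b := x)
    (gs_cont.intervalIntegrable _ _) (gs_cont.stronglyMeasurableAtFilter _ _) gs_cont.continuousAt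
  simpa using this.const_add (1 / 2)

lemma hasDerivAt_gs (x : ℝ) : HasDerivAt gs (-x * gs x) x := by
  unfold gs
  have h : HasDerivAt (fun x : ℝ => -(x ^ 2 / 2)) (-x) x := by
    have := ((hasDerivAt_pow 2 x).div_const 2).neg
    exact this.congr_deriv (by push_cast; ring)
  have := (h.exp).const_mul (√(2 * π))⁻¹
  exact this.congr_deriv (by ring)

lemma Phi_neg (x : ℝ) : Phi (-x) = 1 - Phi x := by
  unfold Phi
  have h := intervalIntegral.integral_comp_neg (f := gs) (a := 0) (b := x)
  simp only [gs_neg, neg_zero] at h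
  rw [h, intervalIntegral.integral_symm (-x) 0]
  ring

lemma Phi_mono : Monotone Phi := by
  apply monotone_of_deriv_nonneg
  · exact fun x => (hasDerivAt_Phi x).differentiableAt
  · intro x; rw [(hasDerivAt_Phi x).deriv]; exact (gs_pos x).le

/-- Gaussian upper tail -/
def Q (x : ℝ) : ℝ := 1 - Phi x

lemma Q_nonneg (x : ℝ) : 0 ≤ Q x := by
  unfold Q; rw [one_sub_Phi]
  exact setIntegral_nonneg measurableSet_Ioi fun y _ => (gs_pos y).le

lemma Phi_le_one (x : ℝ) : Phi x ≤ 1 := by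
  have := Q_nonneg x; unfold Q at this; linarith

lemma Phi_nonneg (x : ℝ) : 0 ≤ Phi x := by
  have := Phi_le_one (-x); rw [Phi_neg] at this; linarith

lemma Q_anti {x y : ℝ} (h : x ≤ y) : Q y ≤ Q x := by
  have := Phi_mono h; unfold Q; linarith

lemma Q_tail {r : ℝ} (hr : 0 ≤ r) : Q r ≤ Real.exp (-(r ^ 2 / 2)) := by
  have h1 : Q r = ∫ y in Set.Ioi (0 : ℝ), gs (r + y) := by
    unfold Q; rw [one_sub_Phi]
    have := (measurePreserving_add_left volume r).setIntegral_preimage_emb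
      (measurableEmbedding_addLeft r) gs (Set.Ioi r)
    rw [← this]
    simp
  have h2 : ∫ y in Set.Ioi (0 : ℝ), gs (r + y) ≤
      ∫ y in Set.Ioi (0 : ℝ), Real.exp (-(r ^ 2 / 2)) * gs y := by
    apply setIntegral_mono_on
    · exact (gs_integrable.comp_add_left r).integrableOn
    · exact (gs_integrable.const_mul _).integrableOn
    · exact measurableSet_Ioi
    · intro y hy
      have hy : 0 < y := hy
      unfold gs
      rw [mul_left_comm, ← Real.exp_add]
      gcongr
      nlinarith [mul_nonneg hr hy.le]
  rw [integral_const_mul, gs_integral_Ioi] at h2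
  have := Real.exp_pos (-(r ^ 2 / 2))
  linarith

lemma mills {x : ℝ} (hx : 0 ≤ x) : gs x ≤ Real.exp (3 / 2) * (1 + x) * Q x := by
  set h : ℝ := 1 / (1 + x) with hh
  have hpos : 0 < 1 + x := by linarith
  have hh0 : 0 < h := by positivity
  have hh1 : h ≤ 1 := by rw [hh, div_le_one hpos]; linarith
  have hx1 : x * h ≤ 1 := by rw [hh, mul_one_div, div_le_one hpos]; linarith
  have key : h * (Real.exp (-(3 / 2)) * gs x) ≤ Q x := by
    have h1 : h * (Real.exp (-(3 / 2)) * gs x) ≤ Phi (x + h) - Phi x := by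
      obtain ⟨c, hc, hc2⟩ := exists_hasDerivAt_eq_slope Phi gs (show x < x + h by linarith)
        (fun y _ => (hasDerivAt_Phi y).continuousAt.continuousWithinAt)
        (fun y _ => hasDerivAt_Phi y)
      rw [eq_div_iff (by linarith)] at hc2
      rw [← hc2]
      have : Real.exp (-(3 / 2)) * gs x ≤ gs c := by
        unfold gs
        rw [mul_left_comm, ← Real.exp_add]
        gcongr
        have : c ≤ x + h := hc.2.le
        have hx' : x < c := hc.1
        nlinarith [mul_nonneg hx hh0.le]
      have e : x + h - x = h := by ring
      rw [e, mul_comm]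
      gcongr
    have := Phi_le_one (x + h)
    unfold Q; linarith
  have e : h * (1 + x) = 1 := by rw [hh]; field_simp
  have e2 : Real.exp (3 / 2) * Real.exp (-(3 / 2)) = 1 := by rw [← Real.exp_add]; simp
  calc gs x = Real.exp (3 / 2) * (1 + x) * (h * (Real.exp (-(3 / 2)) * gs x)) := by
        linear_combination (-(gs x) * (h * (1 + x))) * e2 - gs x * e
    _ ≤ _ := by gcongr

/-- tail-weighted bounds -/
lemma gs_bound {L x : ℝ} (hL : 1 ≤ L) :
    gs x ≤ 3 * Real.exp (3 / 2) * (√L * Q |x| + Real.exp (-L)) ∧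
    |x| * gs x ≤ 6 * Real.exp (3 / 2) * (L * Q |x| + Real.exp (-L)) := by
  have hs : 1 ≤ √L := by rw [Real.one_le_sqrt]; exact hL
  have hss : √L * √L = L := Real.mul_self_sqrt (by linarith)
  have hE : 1 ≤ Real.exp (3 / 2) := Real.one_le_exp (by norm_num)
  have hQ := Q_nonneg |x|
  have he := Real.exp_pos (-L)
  have hg : gs |x| = gs x := by
    unfold gs; rw [sq_abs]
  have hm := mills (abs_nonneg x)
  rw [hg] at hm
  have ha := abs_nonneg x
  by_cases hx : |x| ≤ 2 * √L
  · have h1 : gs x ≤ 3 * Real.exp (3 / 2) * (√L * Q |x|) := by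
      refine hm.trans ?_
      have : 1 + |x| ≤ 3 * √L := by linarith
      calc Real.exp (3 / 2) * (1 + |x|) * Q |x| ≤ Real.exp (3 / 2) * (3 * √L) * Q |x| := by gcongr
        _ = _ := by ring
    constructor
    · refine h1.trans ?_
      gcongr
      linarith
    · calc |x| * gs x ≤ (2 * √L) * (3 * Real.exp (3 / 2) * (√L * Q |x|)) := by
            gcongr
            exact (gs_pos x).le
        _ = 6 * Real.exp (3 / 2) * (L * Q |x|) := by linear_combination (6 * Real.exp (3 / 2) * Q |x|) * hss
        _ ≤ _ := by gcongr; linarith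
  · push Not at hx
    have hx2 : 4 * L ≤ x ^ 2 := by
      rw [← sq_abs, ← hss]; nlinarith
    have h4 : Real.exp (-(x ^ 2 / 4)) ≤ Real.exp (-L) := by
      gcongr; linarith
    have hsplit : Real.exp (-(x ^ 2 / 2)) = Real.exp (-(x ^ 2 / 4)) * Real.exp (-(x ^ 2 / 4)) := by
      rw [← Real.exp_add]; ring_nf
    have h41 : Real.exp (-(x ^ 2 / 4)) ≤ 1 := by
      rw [Real.exp_le_one_iff]; nlinarith [sq_nonneg x]
    have h4p := Real.exp_pos (-(x ^ 2 / 4))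
    have hgx := gs_le_exp x
    rw [hsplit] at hgx
    have hxx : |x| * Real.exp (-(x ^ 2 / 4)) ≤ 1 := by
      have h5 : |x| ≤ Real.exp (x ^ 2 / 4) := by
        have := Real.add_one_le_exp (x ^ 2 / 4)
        rw [← sq_abs] at this ⊢
        nlinarith [sq_nonneg (|x| - 2)]
      calc |x| * Real.exp (-(x ^ 2 / 4)) ≤ Real.exp (x ^ 2 / 4) * Real.exp (-(x ^ 2 / 4)) := by
            gcongr
        _ = 1 := by rw [← Real.exp_add]; simp
    have hLQ : 0 ≤ L * Q |x| := by positivity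
    have hLQ2 : 0 ≤ √L * Q |x| := by positivity
    constructor
    · nlinarith
    · have : |x| * gs x ≤ Real.exp (-L) := by
        calc |x| * gs x ≤ |x| * (Real.exp (-(x ^ 2 / 4)) * Real.exp (-(x ^ 2 / 4))) := by gcongr
          _ = (|x| * Real.exp (-(x ^ 2 / 4))) * Real.exp (-(x ^ 2 / 4)) := by ring
          _ ≤ 1 * Real.exp (-L) := by gcongr
          _ = _ := one_mul _
      nlinarith

lemma poly_gauss_bdd (p : Polynomial ℤ) : ∃ M : ℝ, ∀ x : ℝ,
    |Polynomial.aeval x p * Real.exp (-(x ^ 2 / 2))| ≤ M := by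
  induction p using Polynomial.induction_on' with
  | add p q hp hq =>
    obtain ⟨M, hM⟩ := hp
    obtain ⟨N, hN⟩ := hq
    refine ⟨M + N, fun x => ?_⟩
    rw [map_add, add_mul]
    exact (abs_add_le _ _).trans (add_le_add (hM x) (hN x))
  | monomial n a =>
    refine ⟨|(a : ℝ)| * (n.factorial * Real.exp (1 / 2)), fun x => ?_⟩
    rw [Polynomial.aeval_monomial, abs_mul, abs_mul, abs_pow, Real.abs_exp]
    simp only [algebraMap_int_eq, eq_intCast]
    rw [mul_assoc]
    apply mul_le_mul_of_nonneg_left _ (abs_nonneg _)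
    have h := Real.pow_div_factorial_le_exp |x| (abs_nonneg x) n
    rw [div_le_iff₀ (by positivity)] at h
    calc |x| ^ n * Real.exp (-(x ^ 2 / 2)) ≤
        (Real.exp |x| * n.factorial) * Real.exp (-(x ^ 2 / 2)) := by gcongr
      _ = n.factorial * Real.exp (|x| + -(x ^ 2 / 2)) := by rw [Real.exp_add]; ring
      _ ≤ _ := by
        gcongr
        rw [← sq_abs]; nlinarith [sq_nonneg (|x| - 1)]

lemma gs_contDiff : ContDiff ℝ (⊤ : ℕ∞) gs := by
  unfold gs; fun_prop

lemma deriv_Phi : deriv Phi = gs := funext fun x => (hasDerivAt_Phi x).deriv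

lemma Phi_contDiff : ContDiff ℝ (⊤ : ℕ∞) Phi := by
  rw [contDiff_infty_iff_deriv]
  refine ⟨fun x => (hasDerivAt_Phi x).differentiableAt, ?_⟩
  rw [deriv_Phi]; exact gs_contDiff

lemma gs_iter_bdd (n : ℕ) : ∃ M : ℝ, ∀ x, |iteratedDeriv n gs x| ≤ M := by
  obtain ⟨M, hM⟩ := poly_gauss_bdd (Polynomial.hermite n)
  refine ⟨|(√(2 * π))⁻¹| * M, fun x => ?_⟩
  have : iteratedDeriv n gs x = (√(2 * π))⁻¹ *
      iteratedDeriv n (fun y => Real.exp (-(y ^ 2 / 2))) x := by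
    unfold gs
    rw [iteratedDeriv_const_mul_field]
  rw [this, iteratedDeriv_eq_iterate, Polynomial.deriv_gaussian_eq_hermite_mul_gaussian, abs_mul]
  gcongr
  rw [mul_assoc, abs_mul, abs_pow]
  simpa using hM x

lemma Phi_iter_bdd (n : ℕ) : ∃ M : ℝ, ∀ x, |iteratedDeriv n Phi x| ≤ M := by
  cases n with
  | zero =>
    refine ⟨1, fun x => ?_⟩
    rw [iteratedDeriv_zero, abs_of_nonneg (Phi_nonneg x)]
    exact Phi_le_one x
  | succ n =>
    rw [iteratedDeriv_succ', deriv_Phi]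
    exact gs_iter_bdd n

end SKB
/-! ### Smooth functions with bounded derivatives -/

namespace SKB

/-- smooth with all derivatives bounded -/
def BddSmooth {E : Type*} [NormedAddCommGroup E] [NormedSpace ℝ E] (f : E → ℝ) : Prop :=
  ContDiff ℝ (⊤ : ℕ∞) f ∧ ∀ n : ℕ, ∃ M : ℝ, ∀ x, ‖iteratedFDeriv ℝ n f x‖ ≤ M

section
variable {E : Type*} [NormedAddCommGroup E] [NormedSpace ℝ E]

lemma BddSmooth.of_deriv {f : ℝ → ℝ} (hf : ContDiff ℝ (⊤ : ℕ∞) f)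
    (h : ∀ n : ℕ, ∃ M : ℝ, ∀ x, |iteratedDeriv n f x| ≤ M) : BddSmooth f := by
  refine ⟨hf, fun n => ?_⟩
  obtain ⟨M, hM⟩ := h n
  refine ⟨M, fun x => ?_⟩
  rw [norm_iteratedFDeriv_eq_norm_iteratedDeriv]
  exact hM x

lemma BddSmooth.deriv_bdd {f : ℝ → ℝ} (hf : BddSmooth f) (n : ℕ) :
    ∃ M : ℝ, ∀ x, |iteratedDeriv n f x| ≤ M := by
  obtain ⟨M, hM⟩ := hf.2 n
  refine ⟨M, fun x => ?_⟩
  have := hM x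
  rw [norm_iteratedFDeriv_eq_norm_iteratedDeriv] at this
  exact this

lemma BddSmooth.comp_affine {f : ℝ → ℝ} (hf : BddSmooth f) (c : ℝ) (A : E →L[ℝ] ℝ) :
    BddSmooth (fun x => f (c + A x)) := by
  have hc : ContDiff ℝ (⊤ : ℕ∞) (fun y => f (c + y)) := hf.1.comp (by fun_prop)
  refine ⟨hc.comp A.contDiff, fun n => ?_⟩
  obtain ⟨M, hM⟩ := hf.2 n
  refine ⟨M * ‖A‖ ^ n, fun x => ?_⟩
  have h := A.iteratedFDeriv_comp_right (f := fun y => f (c + y)) hc x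
    (i := n) (by exact_mod_cast le_top)
  have e : (fun x => f (c + A x)) = (fun y => f (c + y)) ∘ A := rfl
  rw [e, h]
  refine (ContinuousMultilinearMap.norm_compContinuousLinearMap_le _ _).trans ?_
  rw [iteratedFDeriv_comp_add_left]
  simp only [Finset.prod_const, Finset.card_univ, Fintype.card_fin]
  gcongr
  exact hM _

lemma BddSmooth.sub {f g : E → ℝ} (hf : BddSmooth f) (hg : BddSmooth g) :
    BddSmooth (fun x => f x - g x) := by
  refine ⟨hf.1.sub hg.1, fun n => ?_⟩
  obtain ⟨M, hM⟩ := hf.2 n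
  obtain ⟨N, hN⟩ := hg.2 n
  refine ⟨M + N, fun x => ?_⟩
  have := iteratedFDeriv_sub_apply (𝕜 := ℝ) (i := n) (x := x) (f := f) (g := g)
    (hf.1.contDiffAt.of_le (by exact_mod_cast le_top))
    (hg.1.contDiffAt.of_le (by exact_mod_cast le_top))
  have e : (fun x => f x - g x) = f - g := rfl
  rw [e, this]
  exact (norm_sub_le _ _).trans (add_le_add (hM x) (hN x))

lemma BddSmooth.mul {f g : E → ℝ} (hf : BddSmooth f) (hg : BddSmooth g) :
    BddSmooth (fun x => f x * g x) := by
  refine ⟨hf.1.mul hg.1, fun n => ?_⟩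
  choose M hM using hf.2
  choose N hN using hg.2
  refine ⟨∑ i ∈ Finset.range (n + 1), (n.choose i : ℝ) * M i * N (n - i), fun x => ?_⟩
  refine (norm_iteratedFDeriv_mul_le hf.1 hg.1 x (n := n) (by exact_mod_cast le_top)).trans ?_
  gcongr with i hi
  · exact mul_nonneg (by positivity) ((norm_nonneg _).trans (hM i x))
  · exact hM i x
  · exact hN _ x

lemma BddSmooth.const (c : ℝ) : BddSmooth (fun _ : E => c) := by
  refine ⟨contDiff_const, fun n => ?_⟩
  refine ⟨‖c‖, fun x => ?_⟩
  rcases Nat.eq_zero_or_pos n with h | h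
  · subst h; simp
  · have := iteratedFDeriv_const_of_ne (𝕜 := ℝ) (E := E) (Nat.pos_iff_ne_zero.1 h) c
    rw [this]; simp

lemma BddSmooth.prod {ι : Type*} (u : Finset ι) (f : ι → E → ℝ) (hf : ∀ i, BddSmooth (f i)) :
    BddSmooth (fun x => ∏ i ∈ u, f i x) := by
  classical
  induction u using Finset.induction_on with
  | empty => simpa using BddSmooth.const (E := E) 1
  | insert a s ha ih =>
    simp only [Finset.prod_insert ha]
    exact (hf a).mul ih

end

lemma Phi_bddSmooth : BddSmooth Phi := BddSmooth.of_deriv Phi_contDiff Phi_iter_bdd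

/-- probability that `x + σ G` lies in `(a, b)` -/
def pj (σ a b x : ℝ) : ℝ := Phi ((b - x) / σ) - Phi ((a - x) / σ)

lemma pj_bddSmooth_comp {E : Type*} [NormedAddCommGroup E] [NormedSpace ℝ E]
    (σ a b : ℝ) (y : ℝ) (A : E →L[ℝ] ℝ) : BddSmooth (fun w => pj σ a b (A w + y)) := by
  have h1 := Phi_bddSmooth.comp_affine ((b - y) / σ) (-(1 / σ) • A)
  have h2 := Phi_bddSmooth.comp_affine ((a - y) / σ) (-(1 / σ) • A)
  convert h1.sub h2 using 2 with w
  unfold pj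
  congr 2
  · simp; ring
  · simp; ring

lemma pj_bddSmooth (σ a b : ℝ) : BddSmooth (pj σ a b) := by
  simpa using pj_bddSmooth_comp σ a b 0 (ContinuousLinearMap.id ℝ ℝ)

lemma hasDerivAt_pj (σ a b x : ℝ) :
    HasDerivAt (pj σ a b) (-(gs ((b - x) / σ) - gs ((a - x) / σ)) / σ) x := by
  unfold pj
  have hb : HasDerivAt (fun x => (b - x) / σ) (-1 / σ) x :=
    ((hasDerivAt_id x).const_sub b).div_const σ
  have ha : HasDerivAt (fun x => (a - x) / σ) (-1 / σ) x :=
    ((hasDerivAt_id x).const_sub a).div_const σ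
  have := ((hasDerivAt_Phi _).comp x hb).sub ((hasDerivAt_Phi _).comp x ha)
  exact this.congr_deriv (by ring)

lemma iter_one_pj (σ a b x : ℝ) :
    iteratedDeriv 1 (pj σ a b) x = -(gs ((b - x) / σ) - gs ((a - x) / σ)) / σ := by
  rw [iteratedDeriv_one]; exact (hasDerivAt_pj σ a b x).deriv

lemma iter_two_pj (σ a b x : ℝ) :
    iteratedDeriv 2 (pj σ a b) x =
      -((b - x) / σ * gs ((b - x) / σ) - (a - x) / σ * gs ((a - x) / σ)) / σ ^ 2 := by
  rw [iteratedDeriv_succ]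
  have e : iteratedDeriv 1 (pj σ a b) =
      fun x => -(gs ((b - x) / σ) - gs ((a - x) / σ)) / σ := funext (iter_one_pj σ a b)
  rw [e]
  apply HasDerivAt.deriv
  have hb : HasDerivAt (fun x => (b - x) / σ) (-1 / σ) x :=
    ((hasDerivAt_id x).const_sub b).div_const σ
  have ha : HasDerivAt (fun x => (a - x) / σ) (-1 / σ) x :=
    ((hasDerivAt_id x).const_sub a).div_const σ
  have := ((((hasDerivAt_gs _).comp x hb).sub ((hasDerivAt_gs _).comp x ha)).neg).div_const σ
  exact this.congr_deriv (by ring)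

/-- mixed partial derivatives (with multi-index `m`) of the smoothed indicator of a rectangle -/
def PI {d : ℕ} (σ : ℝ) (a b : Fin d → ℝ) (m : Fin d → ℕ) (x : Fin d → ℝ) : ℝ :=
  ∏ k, iteratedDeriv (m k) (pj σ (a k) (b k)) (x k)

lemma PI_succ {d : ℕ} (σ : ℝ) (a b : Fin d → ℝ) (m : Fin d → ℕ) (j : Fin d) (x : Fin d → ℝ) :
    PI σ a b (m + Pi.single j 1) x =
      (∏ k ∈ Finset.univ.erase j, iteratedDeriv (m k) (pj σ (a k) (b k)) (x k)) *
        iteratedDeriv (m j + 1) (pj σ (a j) (b j)) (x j) := by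
  unfold PI
  rw [← Finset.prod_erase_mul _ _ (Finset.mem_univ j)]
  congr 1
  · apply Finset.prod_congr rfl
    intro k hk
    have : k ≠ j := Finset.ne_of_mem_erase hk
    simp [this]
  · simp

lemma PI_zero {d : ℕ} (σ : ℝ) (a b : Fin d → ℝ) (x : Fin d → ℝ) :
    PI σ a b 0 x = ∏ k, pj σ (a k) (b k) (x k) := by
  simp [PI]

lemma iter_hasDerivAt (σ a b : ℝ) (n : ℕ) (x : ℝ) :
    HasDerivAt (iteratedDeriv n (pj σ a b)) (iteratedDeriv (n + 1) (pj σ a b) x) x := by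
  rw [iteratedDeriv_succ]
  apply DifferentiableAt.hasDerivAt
  exact ((pj_bddSmooth σ a b).1.differentiable_iteratedDeriv n
    (by exact_mod_cast WithTop.coe_lt_top n)) x

lemma PI_curve {d : ℕ} (σ : ℝ) (a b : Fin d → ℝ) (m : Fin d → ℕ) (X : ℝ → Fin d → ℝ)
    (X' : Fin d → ℝ) (r : ℝ) (hX : ∀ k, HasDerivAt (fun r => X r k) (X' k) r) :
    HasDerivAt (fun r => PI σ a b m (X r)) (∑ j, PI σ a b (m + Pi.single j 1) (X r) * X' j) r := by
  unfold PI
  have := HasDerivAt.fun_finsetProd (u := Finset.univ)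
    (f := fun k r => iteratedDeriv (m k) (pj σ (a k) (b k)) (X r k)) (x := r)
    (f' := fun k => iteratedDeriv (m k + 1) (pj σ (a k) (b k)) (X r k) * X' k)
    (fun k _ => by
      have := (iter_hasDerivAt σ (a k) (b k) (m k) (X r k)).comp r (hX k)
      exact this)
  refine this.congr_deriv ?_
  apply Finset.sum_congr rfl
  intro j _
  have h := PI_succ σ a b m j (X r)
  unfold PI at h
  rw [h, smul_eq_mul, mul_assoc]

lemma PI_differentiable {d : ℕ} (σ : ℝ) (a b : Fin d → ℝ) (m : Fin d → ℕ) :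
    Differentiable ℝ (PI σ a b m) := by
  intro x
  unfold PI
  have : ∀ k ∈ (Finset.univ : Finset (Fin d)), HasFDerivAt
      (fun x : Fin d → ℝ => iteratedDeriv (m k) (pj σ (a k) (b k)) (x k))
      (iteratedDeriv (m k + 1) (pj σ (a k) (b k)) (x k) •
        (ContinuousLinearMap.proj k : (Fin d → ℝ) →L[ℝ] ℝ)) x := by
    intro k _
    have hp : HasFDerivAt (fun x : Fin d → ℝ => x k)
      (ContinuousLinearMap.proj k : (Fin d → ℝ) →L[ℝ] ℝ) x :=
      (ContinuousLinearMap.proj k : (Fin d → ℝ) →L[ℝ] ℝ).hasFDerivAt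
    exact HasDerivAt.comp_hasFDerivAt (h₂ := iteratedDeriv (m k) (pj σ (a k) (b k)))
      (f := fun x : Fin d → ℝ => x k) x (iter_hasDerivAt σ (a k) (b k) (m k) (x k)) hp
  exact (HasFDerivAt.finsetProd this).differentiableAt

lemma PI_cont {d : ℕ} (σ : ℝ) (a b : Fin d → ℝ) (m : Fin d → ℕ) :
    Continuous (PI σ a b m) := (PI_differentiable σ a b m).continuous

lemma PI_bdd {d : ℕ} (σ : ℝ) (a b : Fin d → ℝ) (m : Fin d → ℕ) :
    ∃ M : ℝ, ∀ x, |PI σ a b m x| ≤ M := by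
  choose M hM using fun k => (pj_bddSmooth σ (a k) (b k)).deriv_bdd (m k)
  refine ⟨∏ k, M k, fun x => ?_⟩
  unfold PI
  rw [Finset.abs_prod]
  exact Finset.prod_le_prod (fun k _ => abs_nonneg _) (fun k _ => hM k _)

lemma pd_PI {d : ℕ} (σ : ℝ) (a b : Fin d → ℝ) (m : Fin d → ℕ) (s : ℝ) (y : Fin d → ℝ)
    (j : Fin d) :
    pd (fun w => PI σ a b m (s • w + y)) j =
      fun w => s * PI σ a b (m + Pi.single j 1) (s • w + y) := by
  funext w
  unfold pd
  have hd : DifferentiableAt ℝ (fun w => PI σ a b m (s • w + y)) w := by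
    have := PI_differentiable σ a b m
    fun_prop
  rw [← hd.lineDeriv_eq_fderiv]
  unfold lineDeriv
  apply HasDerivAt.deriv
  have := PI_curve σ a b m (fun r => s • (w + r • Pi.single j (1 : ℝ)) + y)
    (s • Pi.single j (1 : ℝ)) 0 (fun k => by
      simp only [Pi.add_apply, Pi.smul_apply, smul_eq_mul]
      have h := ((((hasDerivAt_id (0 : ℝ)).mul_const
        ((Pi.single j (1 : ℝ) : Fin d → ℝ) k)).const_add (w k)).const_mul s).add_const (y k)
      exact h.congr_deriv (by ring))
  refine this.congr_deriv ?_
  rw [Finset.sum_eq_single j]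
  · simp; ring
  · intro k _ hk; simp [hk]
  · simp

lemma pd_const_mul {d : ℕ} (s : ℝ) (f : (Fin d → ℝ) → ℝ) (i : Fin d) (hf : Differentiable ℝ f) :
    pd (fun w => s * f w) i = fun w => s * pd f i w := by
  funext w
  unfold pd
  rw [fderiv_const_mul (hf w)]
  simp

lemma PI_test {d : ℕ} (σ : ℝ) (a b : Fin d → ℝ) (s : ℝ) (y : Fin d → ℝ) :
    BddSmooth (fun w => PI σ a b 0 (s • w + y)) := by
  simp only [PI_zero]
  apply BddSmooth.prod
  intro k
  have := pj_bddSmooth_comp σ (a k) (b k) (y k)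
    (s • (ContinuousLinearMap.proj k : (Fin d → ℝ) →L[ℝ] ℝ))
  simpa using this

/-- The Stein identity applied to smoothed rectangles. -/
lemma stein_PI {d : ℕ} {Ω : Type} [MeasurableSpace Ω] {P : Measure Ω}
    {W : Ω → Fin d → ℝ} {τ : (Fin d → ℝ) → Matrix (Fin d) (Fin d) ℝ} (h : IsSteinKernel P W τ)
    (σ : ℝ) (a b : Fin d → ℝ) {s : ℝ} (hs : s ≠ 0) (y : Fin d → ℝ) :
    ∑ j, ∫ ω, PI σ a b (Pi.single j 1) (s • W ω + y) * W ω j ∂P =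
      s * ∑ i, ∑ j, ∫ ω, PI σ a b (Pi.single j 1 + Pi.single i 1) (s • W ω + y) *
        τ (W ω) i j ∂P := by
  obtain ⟨h1, h2⟩ := PI_test σ a b s y
  have := h.2.2 _ h1 h2
  have e1 : ∀ j, pd (fun w => PI σ a b 0 (s • w + y)) j =
      fun w => s * PI σ a b (Pi.single j 1) (s • w + y) := by
    intro j; rw [pd_PI]; simp
  have e2 : ∀ i j, pd (pd (fun w => PI σ a b 0 (s • w + y)) j) i =
      fun w => s * (s * PI σ a b (Pi.single j 1 + Pi.single i 1) (s • w + y)) := by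
    intro i j
    rw [e1, pd_const_mul, pd_PI]
    have := PI_differentiable σ a b (Pi.single j 1)
    fun_prop
  simp only [e2] at this
  simp only [e1] at this
  simp only [mul_assoc, integral_const_mul, ← Finset.mul_sum] at this
  have := mul_left_cancel₀ hs this
  exact this

end SKB
/-! ### Key derivative bounds -/

namespace SKB

/-- a numerical constant -/
def C0 : ℝ := 6 * Real.exp (3 / 2)

/-- a numerical constant -/
def C2 : ℝ := 4 * Real.exp 2 * C0 ^ 2 + 2 * Real.exp 1 * C0

lemma C0_pos : 0 < C0 := by unfold C0; positivity

lemma C2_pos : 0 < C2 := by have := C0_pos; unfold C2; positivity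

lemma pj_nonneg {σ a b : ℝ} (hσ : 0 < σ) (hab : a ≤ b) (x : ℝ) : 0 ≤ pj σ a b x := by
  unfold pj
  rw [sub_nonneg]
  apply Phi_mono
  gcongr

lemma pj_le_one (σ a b x : ℝ) : pj σ a b x ≤ 1 := by
  unfold pj
  linarith [Phi_le_one ((b - x) / σ), Phi_nonneg ((a - x) / σ)]

lemma gs_add_bound {L : ℝ} (hL : 1 ≤ L) (σ a b x : ℝ) :
    gs ((b - x) / σ) + gs ((a - x) / σ) ≤ C0 * (√L * (1 - pj σ a b x) + Real.exp (-L)) ∧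
    |(b - x) / σ| * gs ((b - x) / σ) + |(a - x) / σ| * gs ((a - x) / σ) ≤
      2 * C0 * (L * (1 - pj σ a b x) + Real.exp (-L)) := by
  set β := (b - x) / σ with hβ
  set α := (a - x) / σ with hα
  have hq : pj σ a b x = Phi β - Phi α := rfl
  have h1 : Q |β| ≤ 1 - pj σ a b x := by
    have := Q_anti (le_abs_self β)
    rw [hq]; unfold Q at this ⊢; linarith [Phi_nonneg α]
  have h2 : Q |α| ≤ 1 - pj σ a b x := by
    have := Q_anti (neg_le_abs α)
    rw [hq]; unfold Q at this ⊢
    rw [Phi_neg] at this; linarith [Phi_le_one β]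
  obtain ⟨b1, b2⟩ := gs_bound (x := β) hL
  obtain ⟨a1, a2⟩ := gs_bound (x := α) hL
  have hE := Real.exp_pos (3 / 2)
  have e1 : √L * Q |β| ≤ √L * (1 - pj σ a b x) := by gcongr
  have e2 : √L * Q |α| ≤ √L * (1 - pj σ a b x) := by gcongr
  have e3 : L * Q |β| ≤ L * (1 - pj σ a b x) := by gcongr
  have e4 : L * Q |α| ≤ L * (1 - pj σ a b x) := by gcongr
  unfold C0
  constructor <;> nlinarith

lemma prod_le_exp {d : ℕ} (u : Finset (Fin d)) (p : Fin d → ℝ) (hp : ∀ k, 0 ≤ p k) :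
    ∏ k ∈ u, p k ≤ Real.exp (-∑ k ∈ u, (1 - p k)) := by
  rw [← Finset.sum_neg_distrib, Real.exp_sum]
  apply Finset.prod_le_prod
  · intro k _; exact hp k
  · intro k _
    have := Real.add_one_le_exp (-(1 - p k))
    linarith

lemma prod_erase_le {d : ℕ} (p : Fin d → ℝ) (hp : ∀ k, 0 ≤ p k) (j : Fin d) :
    ∏ k ∈ Finset.univ.erase j, p k ≤ Real.exp 1 * Real.exp (-∑ k, (1 - p k)) := by
  refine (prod_le_exp _ p hp).trans ?_
  rw [← Real.exp_add]
  gcongr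
  rw [← Finset.sum_erase_add _ _ (Finset.mem_univ j)]
  linarith [hp j]

lemma prod_erase2_le {d : ℕ} (p : Fin d → ℝ) (hp : ∀ k, 0 ≤ p k) {i j : Fin d} (hij : j ≠ i) :
    ∏ k ∈ (Finset.univ.erase i).erase j, p k ≤ Real.exp 2 * Real.exp (-∑ k, (1 - p k)) := by
  refine (prod_le_exp _ p hp).trans ?_
  rw [← Real.exp_add]
  gcongr
  rw [← Finset.sum_erase_add _ _ (Finset.mem_univ i),
    ← Finset.sum_erase_add _ _ (Finset.mem_erase.2 ⟨hij, Finset.mem_univ j⟩)]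
  linarith [hp j, hp i]

lemma PI_one {d : ℕ} (σ : ℝ) (a b : Fin d → ℝ) (j : Fin d) (x : Fin d → ℝ) :
    PI σ a b (Pi.single j 1) x = (∏ k ∈ Finset.univ.erase j, pj σ (a k) (b k) (x k)) *
      iteratedDeriv 1 (pj σ (a j) (b j)) (x j) := by
  have := PI_succ σ a b 0 j x
  simpa using this

lemma PI_diag {d : ℕ} (σ : ℝ) (a b : Fin d → ℝ) (j : Fin d) (x : Fin d → ℝ) :
    PI σ a b (Pi.single j 1 + Pi.single j 1) x =
      (∏ k ∈ Finset.univ.erase j, pj σ (a k) (b k) (x k)) *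
      iteratedDeriv 2 (pj σ (a j) (b j)) (x j) := by
  rw [PI_succ]
  congr 1
  · apply Finset.prod_congr rfl
    intro k hk
    have : k ≠ j := Finset.ne_of_mem_erase hk
    simp [this]
  · simp

lemma PI_off {d : ℕ} (σ : ℝ) (a b : Fin d → ℝ) {i j : Fin d} (hij : j ≠ i) (x : Fin d → ℝ) :
    PI σ a b (Pi.single j 1 + Pi.single i 1) x =
      (∏ k ∈ (Finset.univ.erase i).erase j, pj σ (a k) (b k) (x k)) *
      iteratedDeriv 1 (pj σ (a j) (b j)) (x j) *
      iteratedDeriv 1 (pj σ (a i) (b i)) (x i) := by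
  rw [PI_succ, ← Finset.prod_erase_mul _ _ (Finset.mem_erase.2 ⟨hij, Finset.mem_univ j⟩)]
  congr 1
  · congr 1
    · apply Finset.prod_congr rfl
      intro k hk
      have : k ≠ j := Finset.ne_of_mem_erase hk
      simp [this]
    · simp
  · simp [hij.symm]

lemma sum_u_le {d : ℕ} (hd : 3 ≤ d) (q : Fin d → ℝ) (M : ℝ) :
    ∑ k, (M * q k + Real.exp (-Real.log d)) = M * ∑ k, q k + 1 := by
  rw [Finset.sum_add_distrib, ← Finset.mul_sum]
  simp only [Finset.sum_const, Finset.card_univ, Fintype.card_fin, nsmul_eq_mul]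
  have : (0 : ℝ) < d := by positivity
  rw [Real.exp_neg, Real.exp_log this, mul_inv_cancel₀ this.ne']

lemma one_le_log {d : ℕ} (hd : 3 ≤ d) : 1 ≤ Real.log d := by
  rw [Real.le_log_iff_exp_le (by positivity)]
  have : (3 : ℝ) ≤ d := by exact_mod_cast hd
  linarith [Real.exp_one_lt_d9]

lemma abs_iter_one {L : ℝ} (hL : 1 ≤ L) {σ : ℝ} (hσ : 0 < σ) (a b x : ℝ) :
    |iteratedDeriv 1 (pj σ a b) x| ≤
      C0 * (√L * (1 - pj σ a b x) + Real.exp (-L)) / σ := by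
  rw [iter_one_pj, abs_div, abs_neg, abs_of_pos hσ]
  gcongr
  refine le_trans ?_ (gs_add_bound hL σ a b x).1
  have h1 := (gs_pos ((b - x) / σ)).le
  have h2 := (gs_pos ((a - x) / σ)).le
  rw [abs_le]; constructor <;> linarith

lemma abs_iter_one' {σ : ℝ} (hσ : 0 < σ) (a b x : ℝ) :
    |iteratedDeriv 1 (pj σ a b) x| ≤ 1 / σ := by
  rw [iter_one_pj, abs_div, abs_neg, abs_of_pos hσ]
  gcongr
  have h1 := (gs_pos ((b - x) / σ)).le
  have h2 := (gs_pos ((a - x) / σ)).le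
  have h3 := (gs_le_one ((b - x) / σ))
  have h4 := (gs_le_one ((a - x) / σ))
  rw [abs_le]; constructor <;> linarith

lemma abs_iter_two {L : ℝ} (hL : 1 ≤ L) {σ : ℝ} (hσ : 0 < σ) (a b x : ℝ) :
    |iteratedDeriv 2 (pj σ a b) x| ≤
      2 * C0 * (L * (1 - pj σ a b x) + Real.exp (-L)) / σ ^ 2 := by
  rw [iter_two_pj, abs_div, abs_neg, abs_of_pos (pow_pos hσ 2)]
  gcongr
  refine le_trans ?_ (gs_add_bound hL σ a b x).2
  refine (abs_sub _ _).trans ?_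
  rw [abs_mul, abs_mul, abs_of_pos (gs_pos _), abs_of_pos (gs_pos _)]

/-- first-order bound -/
lemma key_one {d : ℕ} (hd : 3 ≤ d) {σ : ℝ} (hσ : 0 < σ) {a b : Fin d → ℝ} (hab : ∀ k, a k ≤ b k)
    (x : Fin d → ℝ) :
    ∑ j, (gs ((b j - x j) / σ) + gs ((a j - x j) / σ)) *
      ∏ k ∈ Finset.univ.erase j, pj σ (a k) (b k) (x k) ≤ Real.exp 1 * C0 * Real.log d := by
  have hL := one_le_log hd
  set L := Real.log d
  have hC := C0_pos
  set p : Fin d → ℝ := fun k => pj σ (a k) (b k) (x k) with hp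
  have hp0 : ∀ k, 0 ≤ p k := fun k => pj_nonneg hσ (hab k) _
  have hp1 : ∀ k, 0 ≤ 1 - p k := fun k => sub_nonneg.2 (pj_le_one _ _ _ _)
  set S := ∑ k, (1 - p k) with hS
  have hS0 : 0 ≤ S := Finset.sum_nonneg fun k _ => hp1 k
  calc _ ≤ ∑ j, C0 * (√L * (1 - p j) + Real.exp (-L)) * (Real.exp 1 * Real.exp (-S)) := by
        apply Finset.sum_le_sum
        intro j _
        apply mul_le_mul (gs_add_bound hL σ _ _ _).1 (prod_erase_le p hp0 j)
          (Finset.prod_nonneg fun k _ => hp0 k)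
        have := hp1 j
        positivity
    _ = C0 * (√L * S + 1) * (Real.exp 1 * Real.exp (-S)) := by
        rw [← Finset.sum_mul, ← Finset.mul_sum, sum_u_le hd (fun k => 1 - p k)]
    _ ≤ C0 * (L * Real.exp S) * (Real.exp 1 * Real.exp (-S)) := by
        gcongr
        have h1 : √L ≤ L := by
          rw [Real.sqrt_le_left (by linarith)]; nlinarith
        have := Real.add_one_le_exp S
        nlinarith
    _ = _ := by
        have : Real.exp S * Real.exp (-S) = 1 := by rw [← Real.exp_add]; simp
        linear_combination (C0 * L * Real.exp 1) * this

/-- second-order bound -/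
lemma key_two {d : ℕ} (hd : 3 ≤ d) {σ : ℝ} (hσ : 0 < σ) {a b : Fin d → ℝ} (hab : ∀ k, a k ≤ b k)
    (x : Fin d → ℝ) :
    ∑ i, ∑ j, |PI σ a b (Pi.single j 1 + Pi.single i 1) x| ≤ C2 * Real.log d / σ ^ 2 := by
  have hL := one_le_log hd
  set L := Real.log d
  have hC := C0_pos
  set p : Fin d → ℝ := fun k => pj σ (a k) (b k) (x k) with hp
  have hp0 : ∀ k, 0 ≤ p k := fun k => pj_nonneg hσ (hab k) _
  have hp1 : ∀ k, 0 ≤ 1 - p k := fun k => sub_nonneg.2 (pj_le_one _ _ _ _)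
  set S := ∑ k, (1 - p k) with hS
  have hS0 : 0 ≤ S := Finset.sum_nonneg fun k _ => hp1 k
  set u : Fin d → ℝ := fun k => √L * (1 - p k) + Real.exp (-L) with hu
  set w : Fin d → ℝ := fun k => L * (1 - p k) + Real.exp (-L) with hw
  have hu0 : ∀ k, 0 ≤ u k := fun k => by have := hp1 k; simp only [hu]; positivity
  have hw0 : ∀ k, 0 ≤ w k := fun k => by have := hp1 k; simp only [hw]; positivity
  have hpt : ∀ i j, |PI σ a b (Pi.single j 1 + Pi.single i 1) x| ≤
      Real.exp (-S) * (Real.exp 2 * (C0 * u j / σ) * (C0 * u i / σ) +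
        if j = i then Real.exp 1 * (2 * C0 * w i / σ ^ 2) else 0) := by
    intro i j
    by_cases h : j = i
    · subst h
      rw [if_pos rfl, PI_diag, abs_mul, abs_of_nonneg (Finset.prod_nonneg fun k _ => hp0 k)]
      have h1 := prod_erase_le p hp0 j
      have h2 := abs_iter_two hL hσ (a j) (b j) (x j)
      have h3 := mul_le_mul h1 h2 (abs_nonneg _) (by positivity)
      refine h3.trans ?_
      have h4 : 0 ≤ Real.exp (-S) * (Real.exp 2 * (C0 * u j / σ) * (C0 * u j / σ)) := by
        have := hu0 j
        positivity
      rw [mul_add (Real.exp (-S))]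
      refine le_trans (le_of_eq ?_) (le_add_of_nonneg_left h4)
      ring
    · rw [if_neg h, PI_off σ a b h, abs_mul, abs_mul,
        abs_of_nonneg (Finset.prod_nonneg fun k _ => hp0 k), add_zero]
      have h1 := prod_erase2_le p hp0 h
      have h2 := abs_iter_one hL hσ (a j) (b j) (x j)
      have h2' := abs_iter_one hL hσ (a i) (b i) (x i)
      have h3 := mul_le_mul (mul_le_mul h1 h2 (abs_nonneg _) (by positivity)) h2'
        (abs_nonneg _) (by have := hu0 j; positivity)
      refine h3.trans (le_of_eq ?_)
      ring
  have hsu : ∑ k, u k = √L * S + 1 := sum_u_le hd (fun k => 1 - p k) _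
  have hsw : ∑ k, w k = L * S + 1 := sum_u_le hd (fun k => 1 - p k) _
  have hss : √L * √L = L := Real.mul_self_sqrt (by linarith)
  have hs : 1 ≤ √L := by rw [Real.one_le_sqrt]; exact hL
  have hE : Real.exp (-S) * Real.exp S = 1 := by rw [← Real.exp_add]; simp
  calc _ ≤ ∑ i, ∑ j, Real.exp (-S) * (Real.exp 2 * (C0 * u j / σ) * (C0 * u i / σ) +
        if j = i then Real.exp 1 * (2 * C0 * w i / σ ^ 2) else 0) :=
        Finset.sum_le_sum fun i _ => Finset.sum_le_sum fun j _ => hpt i j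
    _ = Real.exp (-S) * (Real.exp 2 * C0 ^ 2 * (√L * S + 1) ^ 2 +
        2 * Real.exp 1 * C0 * (L * S + 1)) / σ ^ 2 := by
        simp only [← Finset.mul_sum, Finset.sum_add_distrib, Finset.sum_ite_eq', Finset.mem_univ,
          if_true]
        rw [← hsu, ← hsw]
        simp only [← Finset.sum_mul, ← Finset.mul_sum, ← Finset.sum_div]
        field_simp
    _ ≤ Real.exp (-S) * (Real.exp 2 * C0 ^ 2 * (4 * L * Real.exp S) +
        2 * Real.exp 1 * C0 * (L * Real.exp S)) / σ ^ 2 := by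
        have h1 : (√L * S + 1) ^ 2 ≤ 4 * L * Real.exp S := by
          have e1 := Real.add_one_le_exp (S / 2)
          have e2 : Real.exp S = Real.exp (S / 2) * Real.exp (S / 2) := by
            rw [← Real.exp_add]; ring_nf
          have e3 : √L * S + 1 ≤ √L * (2 * Real.exp (S / 2)) := by nlinarith
          calc (√L * S + 1) ^ 2 ≤ (√L * (2 * Real.exp (S / 2))) ^ 2 := by gcongr
            _ = _ := by rw [e2]; linear_combination (4 * Real.exp (S / 2) ^ 2) * hss
        have h2 : L * S + 1 ≤ L * Real.exp S := by
          have := Real.add_one_le_exp S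
          nlinarith
        gcongr
    _ = _ := by
        congr 1
        unfold C2
        linear_combination (Real.exp 2 * C0 ^ 2 * (4 * L) + 2 * Real.exp 1 * C0 * L) * hE

lemma PI_one_bdd {d : ℕ} {σ : ℝ} (hσ : 0 < σ) {a b : Fin d → ℝ} (hab : ∀ k, a k ≤ b k)
    (j : Fin d) (x : Fin d → ℝ) : |PI σ a b (Pi.single j 1) x| ≤ 1 / σ := by
  rw [PI_one, abs_mul, abs_of_nonneg (Finset.prod_nonneg fun k _ => pj_nonneg hσ (hab k) _)]
  calc _ ≤ 1 * (1 / σ) := by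
        apply mul_le_mul _ (abs_iter_one' hσ _ _ _) (abs_nonneg _) zero_le_one
        exact Finset.prod_le_one (fun k _ => pj_nonneg hσ (hab k) _) (fun k _ => pj_le_one _ _ _ _)
    _ = _ := one_mul _

lemma PI_zero_nonneg {d : ℕ} {σ : ℝ} (hσ : 0 < σ) {a b : Fin d → ℝ} (hab : ∀ k, a k ≤ b k)
    (x : Fin d → ℝ) : 0 ≤ PI σ a b 0 x := by
  rw [PI_zero]; exact Finset.prod_nonneg fun k _ => pj_nonneg hσ (hab k) _

lemma PI_zero_le_one {d : ℕ} {σ : ℝ} (hσ : 0 < σ) {a b : Fin d → ℝ} (hab : ∀ k, a k ≤ b k)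
    (x : Fin d → ℝ) : PI σ a b 0 x ≤ 1 := by
  rw [PI_zero]
  exact Finset.prod_le_one (fun k _ => pj_nonneg hσ (hab k) _) (fun k _ => pj_le_one _ _ _ _)

/-- anti-concentration -/
lemma anti_conc {d : ℕ} (hd : 3 ≤ d) {σ : ℝ} (hσ : 0 < σ) {a b a' b' : Fin d → ℝ}
    (hab : ∀ k, a' k ≤ b' k) (ha : ∀ k, a k ≤ a' k) (hb : ∀ k, b' k ≤ b k) {η : ℝ}
    (ha2 : ∀ k, a' k - a k ≤ η) (hb2 : ∀ k, b k - b' k ≤ η) (x : Fin d → ℝ) :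
    PI σ a b 0 x - PI σ a' b' 0 x ≤ Real.exp 1 * C0 * Real.log d * (η / σ) := by
  set A : ℝ → Fin d → ℝ := fun s k => a' k + s * (a k - a' k) with hA
  set B : ℝ → Fin d → ℝ := fun s k => b' k + s * (b k - b' k) with hB
  set F : ℝ → ℝ := fun s => ∏ k, pj σ (A s k) (B s k) (x k) with hF
  have hder : ∀ s, HasDerivAt F (∑ j, (∏ k ∈ Finset.univ.erase j, pj σ (A s k) (B s k) (x k)) •
      (gs ((B s j - x j) / σ) * ((b j - b' j) / σ) -
        gs ((A s j - x j) / σ) * ((a j - a' j) / σ))) s := by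
    intro s
    apply HasDerivAt.fun_finsetProd
    intro k _
    unfold pj
    have h1 : HasDerivAt (fun s => (B s k - x k) / σ) ((b k - b' k) / σ) s := by
      have := (((((hasDerivAt_id s).mul_const (b k - b' k))).const_add (b' k)).sub_const
        (x k)).div_const σ
      exact this.congr_deriv (by ring)
    have h2 : HasDerivAt (fun s => (A s k - x k) / σ) ((a k - a' k) / σ) s := by
      have := (((((hasDerivAt_id s).mul_const (a k - a' k))).const_add (a' k)).sub_const
        (x k)).div_const σ
      exact this.congr_deriv (by ring)
    exact ((hasDerivAt_Phi _).comp s h1).sub ((hasDerivAt_Phi _).comp s h2)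
  have hbound : ∀ s ∈ interior (Set.Icc (0 : ℝ) 1),
      deriv F s ≤ Real.exp 1 * C0 * Real.log d * (η / σ) := by
    intro s hs
    have hs := interior_subset hs
    rw [(hder s).deriv]
    have hAB : ∀ k, A s k ≤ B s k := by
      intro k
      simp only [hA, hB]
      nlinarith [mul_nonneg hs.1 (sub_nonneg.2 (ha k)), mul_nonneg hs.1 (sub_nonneg.2 (hb k)),
        hab k]
    have hη : 0 ≤ η := by
      have := ha2 ⟨0, by omega⟩
      have := ha ⟨0, by omega⟩
      linarith
    have h := key_one hd hσ hAB x
    calc _ ≤ ∑ j, ((gs ((B s j - x j) / σ) + gs ((A s j - x j) / σ)) *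
          ∏ k ∈ Finset.univ.erase j, pj σ (A s k) (B s k) (x k)) * (η / σ) := by
          apply Finset.sum_le_sum
          intro j _
          have hP : 0 ≤ ∏ k ∈ Finset.univ.erase j, pj σ (A s k) (B s k) (x k) :=
            Finset.prod_nonneg fun k _ => pj_nonneg hσ (hAB k) _
          have g1 := (gs_pos ((B s j - x j) / σ)).le
          have g2 := (gs_pos ((A s j - x j) / σ)).le
          rw [smul_eq_mul, mul_comm (gs _ + gs _), mul_assoc]
          apply mul_le_mul_of_nonneg_left _ hP
          have e1 : (b j - b' j) / σ ≤ η / σ := by gcongr; exact hb2 j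
          have e2 : -((a j - a' j) / σ) ≤ η / σ := by
            rw [← neg_div]; gcongr; linarith [ha2 j]
          nlinarith
      _ ≤ _ := by
          rw [← Finset.sum_mul]
          gcongr
  have := (convex_Icc (0 : ℝ) 1).image_sub_le_mul_sub_of_deriv_le
    (fun s _ => (hder s).continuousAt.continuousWithinAt)
    (fun s _ => (hder s).differentiableAt.differentiableWithinAt) hbound
    0 (by simp) 1 (by simp) zero_le_one
  have e1 : F 1 = PI σ a b 0 x := by
    rw [PI_zero]; simp [hF, hA, hB]
  have e0 : F 0 = PI σ a' b' 0 x := by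
    rw [PI_zero]; simp [hF, hA, hB]
  rw [e1, e0] at this
  linarith

end SKB
/-! ### The Gaussian measure -/

namespace SKB

section
open scoped MatrixOrder Matrix.Norms.L2Operator

lemma exists_factor {d : ℕ} {T : Matrix (Fin d) (Fin d) ℝ} (hT : T.PosSemidef) :
    ∃ B : Matrix (Fin d) (Fin d) ℝ, T = B * Bᵀ := by
  have h0 : 0 ≤ T := Matrix.nonneg_iff_posSemidef.2 hT
  obtain ⟨B, hB⟩ := CStarAlgebra.nonneg_iff_eq_star_mul_self.1 h0
  refine ⟨Bᵀ, ?_⟩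
  rw [hB, Matrix.transpose_transpose, Matrix.star_eq_conjTranspose,
    Matrix.conjTranspose_eq_transpose_of_trivial]

end

lemma sub_posSemidef {d : ℕ} {S : Matrix (Fin d) (Fin d) ℝ} (hS : S.PosDef) {s : ℝ}
    (hs : IsSmallestEigenvalueSq S s) : (S - (s ^ 2) • (1 : Matrix (Fin d) (Fin d) ℝ)).PosSemidef := by
  have hH : (S - (s ^ 2) • (1 : Matrix (Fin d) (Fin d) ℝ)).IsHermitian := by
    apply hS.isHermitian.sub
    simp [Matrix.IsHermitian]
  rw [hH.posSemidef_iff_eigenvalues_nonneg]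
  intro i
  have h := hH.mulVec_eigenvectorBasis i
  rw [Matrix.sub_mulVec, Matrix.smul_mulVec, Matrix.one_mulVec] at h
  have hne : (hH.eigenvectorBasis i).ofLp ≠ 0 := by
    intro h0
    have := hH.eigenvectorBasis.orthonormal.ne_zero i
    apply this
    ext k
    simpa using congrFun h0 k
  have hmem : hH.eigenvalues i + s ^ 2 ∈
      {r : ℝ | ∃ x : Fin d → ℝ, x ≠ 0 ∧ S.mulVec x = r • x} := ⟨_, hne, by
    rw [add_smul, ← h]; simp⟩
  have h2 := (show IsLeast {r : ℝ | ∃ x : Fin d → ℝ, x ≠ 0 ∧ S.mulVec x = r • x} (s ^ 2)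
    from hs).2 hmem
  simpa using h2

/-- standard Gaussian density on `ℝ^d` -/
def rho {d : ℕ} (x : Fin d → ℝ) : ℝ := ∏ k, gs (x k)

lemma rho_pos {d : ℕ} (x : Fin d → ℝ) : 0 < rho x := Finset.prod_pos fun _ _ => gs_pos _

lemma rho_cont {d : ℕ} : Continuous (rho (d := d)) := by
  unfold rho
  exact continuous_finsetProd _ fun k _ => gs_cont.comp (continuous_apply k)

lemma rho_eq {d : ℕ} (x : Fin d → ℝ) : gaussianPdf d 1 x = rho x := by
  unfold gaussianPdf rho gs
  rw [Finset.prod_mul_distrib, ← Real.exp_sum]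
  simp only [Matrix.det_one, Real.one_rpow, mul_one, inv_one, Matrix.one_mulVec, Finset.prod_const,
    Finset.card_univ, Fintype.card_fin]
  congr 1
  · rw [neg_div, Real.rpow_neg (by positivity), inv_pow, Real.sqrt_eq_rpow, ← Real.rpow_natCast,
      ← Real.rpow_mul (by positivity)]
    congr 2
    ring
  · congr 1
    simp only [dotProduct, Finset.mul_sum]
    apply Finset.sum_congr rfl
    intro k _
    ring

lemma rho_integrable {d : ℕ} : Integrable (rho (d := d)) := by
  unfold rho
  exact Integrable.fintype_prod (f := fun _ => gs) fun _ => gs_integrable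

lemma rho_integral {d : ℕ} : ∫ x : Fin d → ℝ, rho x = 1 := by
  unfold rho
  rw [integral_fintype_prod_volume_eq_prod (fun _ => gs)]
  simp [gs_integral]

/-- standard Gaussian measure -/
abbrev gam (d : ℕ) : Measure (Fin d → ℝ) := gaussianMeasure d 1

lemma gam_eq (d : ℕ) : gam d = volume.withDensity fun x => ENNReal.ofReal (rho x) := by
  unfold gam gaussianMeasure
  simp only [rho_eq]

lemma rho_meas {d : ℕ} : Measurable fun x : Fin d → ℝ => ENNReal.ofReal (rho x) :=
  rho_cont.measurable.ennreal_ofReal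

instance gam_prob (d : ℕ) : IsProbabilityMeasure (gam d) := by
  constructor
  rw [gam_eq, withDensity_apply _ MeasurableSet.univ, Measure.restrict_univ,
    ← ofReal_integral_eq_lintegral_ofReal rho_integrable (ae_of_all _ fun x => (rho_pos x).le),
    rho_integral]
  simp

lemma gam_integral {d : ℕ} (f : (Fin d → ℝ) → ℝ) : ∫ x, f x ∂(gam d) = ∫ x, rho x * f x := by
  rw [gam_eq, integral_withDensity_eq_integral_toReal_smul rho_meas (by simp)]
  simp [ENNReal.toReal_ofReal (rho_pos _).le]

lemma gam_integrable {d : ℕ} (f : (Fin d → ℝ) → ℝ) :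
    Integrable f (gam d) ↔ Integrable fun x => rho x * f x := by
  rw [gam_eq, integrable_withDensity_iff_integrable_smul' rho_meas (by simp)]
  simp [ENNReal.toReal_ofReal (rho_pos _).le]

lemma gs_mul_integrable : Integrable fun x : ℝ => x * gs x := by
  rw [gs_eq]
  have := (integrable_mul_exp_neg_mul_sq (b := 1 / 2) (by norm_num)).const_mul (√(2 * π))⁻¹
  refine this.congr (ae_of_all _ fun x => ?_)
  simp only
  ring

lemma gam_coord_integrable {d : ℕ} (k : Fin d) : Integrable (fun x : Fin d → ℝ => x k) (gam d) := by
  rw [gam_integrable]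
  have := Integrable.fintype_prod (μ := fun _ : Fin d => (volume : Measure ℝ))
    (f := fun i => if i = k then (fun x => x * gs x) else gs) (fun i => by
      by_cases h : i = k
      · simp only [h, if_true]; exact gs_mul_integrable
      · simp only [h, if_false]; exact gs_integrable)
  refine Integrable.congr this (ae_of_all _ fun x => ?_)
  simp only
  unfold rho
  rw [← Finset.prod_erase_mul _ _ (Finset.mem_univ k),
    ← Finset.prod_erase_mul _ (fun k => gs (x k)) (Finset.mem_univ k)]
  have : ∏ i ∈ Finset.univ.erase k, (if i = k then (fun x => x * gs x) else gs) (x i) =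
      ∏ i ∈ Finset.univ.erase k, gs (x i) := by
    apply Finset.prod_congr rfl
    intro i hi
    rw [if_neg (Finset.ne_of_mem_erase hi)]
  rw [this]
  simp only [if_true]
  ring

lemma rho_differentiable {d : ℕ} : Differentiable ℝ (rho (d := d)) := by
  intro x
  have : rho (d := d) = fun x => (√(2 * π))⁻¹ ^ d * Real.exp (-∑ k, (x k) ^ 2 / 2) := by
    funext x
    unfold rho gs
    rw [Finset.prod_mul_distrib, ← Real.exp_sum]
    simp
  rw [this]
  fun_prop

lemma pd_rho {d : ℕ} (j : Fin d) (x : Fin d → ℝ) :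
    fderiv ℝ (rho (d := d)) x (Pi.single j 1) = -(x j) * rho x := by
  rw [← (rho_differentiable x).lineDeriv_eq_fderiv]
  unfold lineDeriv
  apply HasDerivAt.deriv
  unfold rho
  have := HasDerivAt.fun_finsetProd (u := Finset.univ) (x := (0 : ℝ))
    (f := fun k (r : ℝ) => gs ((x + r • (Pi.single j (1 : ℝ) : Fin d → ℝ)) k))
    (f' := fun k => -(x k) * gs (x k) * (Pi.single j (1 : ℝ) : Fin d → ℝ) k)
    (fun k _ => by
      have h : HasDerivAt (fun r : ℝ => (x + r • (Pi.single j (1 : ℝ) : Fin d → ℝ)) k)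
          ((Pi.single j (1 : ℝ) : Fin d → ℝ) k) 0 := by
        have := ((hasDerivAt_id (0 : ℝ)).mul_const
          ((Pi.single j (1 : ℝ) : Fin d → ℝ) k)).const_add (x k)
        exact this.congr_deriv (by ring)
      have h2 := (hasDerivAt_gs ((x + (0 : ℝ) • (Pi.single j (1 : ℝ) : Fin d → ℝ)) k)).comp (0 : ℝ) h
      refine h2.congr_deriv ?_
      simp)
  refine this.congr_deriv ?_
  rw [Finset.sum_eq_single j]
  · rw [← Finset.prod_erase_mul _ _ (Finset.mem_univ j)]
    simp
    ring
  · intro k _ hk; simp [hk]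
  · simp

/-- Gaussian integration by parts -/
lemma gam_ibp {d : ℕ} (F : (Fin d → ℝ) → ℝ) (k : Fin d) (hF : ContDiff ℝ 1 F) {M : ℝ}
    (hM : ∀ x, |F x| ≤ M) {M' : ℝ} (hM' : ∀ x, |pd F k x| ≤ M') :
    ∫ x, F x * x k ∂(gam d) = ∫ x, pd F k x ∂(gam d) := by
  have hpc : Continuous (pd F k) := by
    unfold pd
    exact (hF.continuous_fderiv (by norm_num)).clm_apply continuous_const
  have i1 : Integrable (fun x => F x * x k) (gam d) :=
    (gam_coord_integrable k).bdd_mul hF.continuous.aestronglyMeasurable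
      (ae_of_all _ fun x => hM x)
  have i2 : Integrable (pd F k) (gam d) :=
    Integrable.of_bound hpc.aestronglyMeasurable M' (ae_of_all _ fun x => hM' x)
  have i3 : Integrable F (gam d) :=
    Integrable.of_bound hF.continuous.aestronglyMeasurable M (ae_of_all _ fun x => hM x)
  rw [gam_integrable] at i1 i2 i3
  rw [gam_integral, gam_integral]
  have := integral_mul_fderiv_eq_neg_fderiv_mul_of_integrable (μ := (volume : Measure (Fin d → ℝ)))
    (f := rho) (g := F) (v := Pi.single k 1) (by
      refine i1.neg.congr (ae_of_all _ fun x => ?_)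
      simp only [pd_rho, Pi.neg_apply]
      ring) i2 i3 (fun x _ => rho_differentiable x)
    (fun x _ => (hF.differentiable (by norm_num)) x)
  unfold pd
  rw [this, ← integral_neg]
  congr 1
  funext x
  rw [pd_rho]
  ring

lemma pd_comp_mulVec {d : ℕ} (g : (Fin d → ℝ) → ℝ) (hg : Differentiable ℝ g)
    (B : Matrix (Fin d) (Fin d) ℝ) (k : Fin d) (n : Fin d → ℝ) :
    pd (fun n => g (B *ᵥ n)) k n = ∑ i, B i k * pd g i (B *ᵥ n) := by
  unfold pd
  set A : (Fin d → ℝ) →L[ℝ] (Fin d → ℝ) := (Matrix.toLin' B).toContinuousLinearMap with hA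
  have hAx : ∀ n, B *ᵥ n = A n := fun n => rfl
  have h1 : HasFDerivAt (fun n => g (B *ᵥ n)) ((fderiv ℝ g (A n)).comp A) n := by
    have := (hg (A n)).hasFDerivAt.comp n A.hasFDerivAt
    exact this
  rw [h1.fderiv]
  have h2 : A (Pi.single k 1) = ∑ i, B i k • (Pi.single i (1 : ℝ) : Fin d → ℝ) := by
    rw [← hAx]
    ext i
    simp [Finset.sum_apply, Pi.single_apply]
  simp only [ContinuousLinearMap.comp_apply, h2, map_sum, map_smul, smul_eq_mul, hAx]

lemma mulVec_coord_integrable {d : ℕ} (B : Matrix (Fin d) (Fin d) ℝ) (j : Fin d) :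
    Integrable (fun n => (B *ᵥ n) j) (gam d) := by
  simp only [Matrix.mulVec, dotProduct]
  exact integrable_finsetSum _ fun k _ => (gam_coord_integrable k).const_mul _

/-- linear images of the standard Gaussian have a constant Stein kernel -/
lemma gam_stein {d : ℕ} (B : Matrix (Fin d) (Fin d) ℝ) :
    IsSteinKernel (gam d) (fun n => B *ᵥ n) (fun _ => B * Bᵀ) := by
  refine ⟨fun i j => measurable_const, fun i j => integrable_const _, fun f hf hb => ?_⟩
  obtain ⟨M1, hM1⟩ := hb 1
  obtain ⟨M2, hM2⟩ := hb 2
  have hf1 : ContDiff ℝ (⊤ : ℕ∞) (fderiv ℝ f) := by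
    apply hf.fderiv_right
    exact_mod_cast le_refl _
  have hpd : ∀ j, ContDiff ℝ (⊤ : ℕ∞) (pd f j) := fun j => by
    unfold pd
    exact hf1.clm_apply contDiff_const
  have hpd2 : ∀ i j, Continuous (pd (pd f j) i) := fun i j => by
    have : Continuous (fderiv ℝ (pd f j)) := (hpd j).continuous_fderiv (by simp)
    exact this.clm_apply continuous_const
  have hsingle : ∀ j : Fin d, ‖(Pi.single j (1 : ℝ) : Fin d → ℝ)‖ ≤ 1 := fun j => by
    simp [Pi.norm_single]
  have hM1' : ∀ j x, |pd f j x| ≤ M1 := fun j x => by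
    have h := hM1 x
    rw [norm_iteratedFDeriv_one] at h
    have h2 := (fderiv ℝ f x).le_opNorm (Pi.single j 1)
    have h3 := hsingle j
    have h4 := norm_nonneg (fderiv ℝ f x)
    rw [Real.norm_eq_abs] at h2
    unfold pd
    nlinarith
  have hM2' : ∀ i j x, |pd (pd f j) i x| ≤ M2 := fun i j x => by
    have h := hM2 x
    have e : (2 : ℕ) = 1 + 1 := rfl
    rw [e, ← norm_iteratedFDeriv_fderiv, norm_iteratedFDeriv_one] at h
    have hd : HasFDerivAt (pd f j) ((ContinuousLinearMap.apply ℝ ℝ (Pi.single j (1 : ℝ))).comp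
        (fderiv ℝ (fderiv ℝ f) x)) x := by
      have := (ContinuousLinearMap.apply ℝ ℝ
        (Pi.single j (1 : ℝ) : Fin d → ℝ)).hasFDerivAt.comp x
        ((hf1.differentiable (by simp)) x).hasFDerivAt
      exact this
    have h1 : pd (pd f j) i x = fderiv ℝ (fderiv ℝ f) x (Pi.single i 1) (Pi.single j 1) := by
      rw [pd, hd.fderiv]; rfl
    rw [h1]
    have h2 := (fderiv ℝ (fderiv ℝ f) x).le_opNorm₂ (Pi.single i 1) (Pi.single j 1)
    rw [Real.norm_eq_abs] at h2
    refine h2.trans ?_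
    have h3 := hsingle j
    have h4 := hsingle i
    calc _ ≤ M2 * 1 * 1 := by
          have := (norm_nonneg _).trans h
          gcongr
      _ = M2 := by ring
  have hcB : Continuous fun n : Fin d → ℝ => B *ᵥ n := by fun_prop
  have hsmB : ContDiff ℝ 1 fun n : Fin d → ℝ => B *ᵥ n :=
    ((Matrix.toLin' B).toContinuousLinearMap).contDiff
  have i2 : ∀ i j, Integrable (fun n => pd (pd f j) i (B *ᵥ n)) (gam d) := fun i j =>
    Integrable.of_bound ((hpd2 i j).comp hcB).aestronglyMeasurable M2
      (ae_of_all _ fun x => hM2' i j _)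
  have i1 : ∀ j k, Integrable (fun n => pd f j (B *ᵥ n) * n k) (gam d) := fun j k =>
    (gam_coord_integrable k).bdd_mul ((hpd j).continuous.comp hcB).aestronglyMeasurable
      (ae_of_all _ fun x => hM1' j _)
  have key : ∀ j k, ∫ n, pd f j (B *ᵥ n) * n k ∂(gam d) =
      ∑ i, B i k * ∫ n, pd (pd f j) i (B *ᵥ n) ∂(gam d) := by
    intro j k
    have e : ∀ n, pd (fun n => pd f j (B *ᵥ n)) k n =
        ∑ i, B i k * pd (pd f j) i (B *ᵥ n) :=
      pd_comp_mulVec _ ((hpd j).differentiable (by simp)) B k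
    rw [gam_ibp (fun n => pd f j (B *ᵥ n)) k
      (((hpd j).of_le (by exact_mod_cast le_top)).comp hsmB) (fun x => hM1' j _)
      (M' := ∑ i, |B i k| * M2) (fun x => by
        rw [e]
        refine (Finset.abs_sum_le_sum_abs _ _).trans ?_
        gcongr with i _
        rw [abs_mul]
        gcongr
        exact hM2' _ _ _)]
    simp only [e]
    rw [integral_finsetSum _ fun i _ => (i2 i j).const_mul _]
    simp only [integral_const_mul]
  have lhs : ∀ j, ∫ n, pd f j (B *ᵥ n) * (B *ᵥ n) j ∂(gam d) =
      ∑ k, B j k * ∑ i, B i k * ∫ n, pd (pd f j) i (B *ᵥ n) ∂(gam d) := by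
    intro j
    have e : ∀ n : Fin d → ℝ, pd f j (B *ᵥ n) * (B *ᵥ n) j =
        ∑ k, B j k * (pd f j (B *ᵥ n) * n k) := fun n => by
      conv_lhs => rw [Matrix.mulVec.eq_1 B n]
      simp only [dotProduct, Finset.mul_sum]
      apply Finset.sum_congr rfl
      intro k _
      ring
    simp only [e]
    rw [integral_finsetSum _ fun k _ => (i1 j k).const_mul _]
    simp only [integral_const_mul, key]
  simp only [lhs, integral_mul_const]
  simp only [Matrix.mul_apply, Matrix.transpose_apply, Finset.mul_sum]
  rw [Finset.sum_comm (s := Finset.univ) (t := Finset.univ)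
    (f := fun i j => ∑ k, (∫ n, pd (pd f j) i (B *ᵥ n) ∂(gam d)) * (B i k * B j k))]
  apply Finset.sum_congr rfl
  intro j _
  rw [Finset.sum_comm]
  apply Finset.sum_congr rfl
  intro i _
  apply Finset.sum_congr rfl
  intro k _
  ring

/-- change of variables -/
lemma gaussianMeasure_eq_map {d : ℕ} (M : Matrix (Fin d) (Fin d) ℝ) (hM : M.det ≠ 0) :
    gaussianMeasure d (M * Mᵀ) = (gam d).map (fun n => M *ᵥ n) := by
  have hmeas : Measurable fun n : Fin d → ℝ => M *ᵥ n := by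
    have : Continuous fun n : Fin d → ℝ => M *ᵥ n := by fun_prop
    exact this.measurable
  have hu : IsUnit M.det := isUnit_iff_ne_zero.2 hM
  have hut : IsUnit Mᵀ.det := by rwa [Matrix.det_transpose]
  have hpdf : ∀ n, gaussianPdf d (M * Mᵀ) (M *ᵥ n) = |M.det|⁻¹ * rho n := by
    intro n
    rw [← rho_eq]
    unfold gaussianPdf
    have h1 : (M * Mᵀ).det ^ (-(1 : ℝ) / 2) = |M.det|⁻¹ := by
      rw [Matrix.det_mul, Matrix.det_transpose, neg_div, Real.rpow_neg (mul_self_nonneg _),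
        ← Real.sqrt_eq_rpow, Real.sqrt_mul_self_eq_abs]
    have h2 : (M *ᵥ n) ⬝ᵥ (M * Mᵀ)⁻¹ *ᵥ (M *ᵥ n) = n ⬝ᵥ (1 : Matrix (Fin d) (Fin d) ℝ)⁻¹ *ᵥ n := by
      rw [Matrix.mul_inv_rev, Matrix.mulVec_mulVec, Matrix.mul_assoc, Matrix.nonsing_inv_mul _ hu,
        Matrix.mul_one, inv_one, Matrix.one_mulVec, ← Matrix.vecMul_transpose,
        ← Matrix.dotProduct_mulVec, Matrix.mulVec_mulVec, Matrix.mul_nonsing_inv _ hut,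
        Matrix.one_mulVec]
    rw [h1, h2]
    simp
    ring
  have hpm : Measurable fun x => ENNReal.ofReal (gaussianPdf d (M * Mᵀ) x) := by
    have : Continuous (gaussianPdf d (M * Mᵀ)) := by
      unfold gaussianPdf
      fun_prop
    exact this.measurable.ennreal_ofReal
  ext A hA
  rw [Measure.map_apply hmeas hA, gam_eq, withDensity_apply _ (hmeas hA)]
  unfold gaussianMeasure
  rw [withDensity_apply _ hA]
  have hvol := Real.map_matrix_volume_pi_eq_smul_volume_pi hM
  have hdet : 0 < |M.det| := abs_pos.2 hM
  have hvol2 : (volume : Measure (Fin d → ℝ)) =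
      ENNReal.ofReal |M.det| • Measure.map (fun n => M *ᵥ n) volume := by
    have e : (fun n => M *ᵥ n) = ⇑(Matrix.toLin' M) := rfl
    rw [e, hvol, smul_smul, ← ENNReal.ofReal_mul hdet.le, abs_inv, mul_inv_cancel₀ hdet.ne']
    simp
  have hcm : Measurable fun n => ENNReal.ofReal (gaussianPdf d (M * Mᵀ) (M *ᵥ n)) :=
    hpm.comp hmeas
  conv_lhs => rw [hvol2]
  rw [Measure.restrict_smul, lintegral_smul_measure, setLIntegral_map hA hpm hmeas, smul_eq_mul,
    ← lintegral_const_mul _ hcm]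
  congr 1
  funext n
  rw [hpdf, ← ENNReal.ofReal_mul hdet.le, ← mul_assoc, mul_inv_cancel₀ hdet.ne', one_mul]

end SKB
/-! ### The interpolation argument -/

namespace SKB

lemma pj_curve (a b : ℝ) (σ X : ℝ → ℝ) (σ' X' r : ℝ) (hσ : HasDerivAt σ σ' r) (hσ0 : 0 < σ r)
    (hX : HasDerivAt X X' r) :
    HasDerivAt (fun r => pj (σ r) a b (X r))
      (iteratedDeriv 1 (pj (σ r) a b) (X r) * X' +
        iteratedDeriv 2 (pj (σ r) a b) (X r) * (σ r * σ')) r := by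
  rw [iter_one_pj, iter_two_pj]
  unfold pj
  have hb := (hX.const_sub b).div hσ hσ0.ne'
  have ha := (hX.const_sub a).div hσ hσ0.ne'
  have := ((hasDerivAt_Phi _).comp r hb).sub ((hasDerivAt_Phi _).comp r ha)
  refine this.congr_deriv ?_
  have h0 := hσ0.ne'
  simp only [Pi.div_apply]
  field_simp
  ring

lemma PI_curve2 {d : ℕ} (a b : Fin d → ℝ) (σ : ℝ → ℝ) (X : ℝ → Fin d → ℝ) (σ' : ℝ)
    (X' : Fin d → ℝ) (r : ℝ) (hσ : HasDerivAt σ σ' r) (hσ0 : 0 < σ r)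
    (hX : ∀ k, HasDerivAt (fun r => X r k) (X' k) r) :
    HasDerivAt (fun r => PI (σ r) a b 0 (X r))
      (∑ j, PI (σ r) a b (Pi.single j 1) (X r) * X' j +
        ∑ j, PI (σ r) a b (Pi.single j 1 + Pi.single j 1) (X r) * (σ r * σ')) r := by
  simp only [PI_zero]
  have := HasDerivAt.fun_finsetProd (u := Finset.univ)
    (f := fun k r => pj (σ r) (a k) (b k) (X r k)) (x := r)
    (fun k _ => pj_curve (a k) (b k) σ (fun r => X r k) σ' (X' k) r hσ hσ0 (hX k))
  refine this.congr_deriv ?_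
  rw [← Finset.sum_add_distrib]
  apply Finset.sum_congr rfl
  intro j _
  rw [PI_one, PI_diag, smul_eq_mul]
  ring

section
variable {d : ℕ} {Ω Ω' : Type} [MeasurableSpace Ω] [MeasurableSpace Ω']

lemma PI_mul_integrable {μ : Measure Ω} (σ : ℝ) (a b : Fin d → ℝ)
    (m : Fin d → ℕ) {X : Ω → Fin d → ℝ} (hX : Measurable X) {f : Ω → ℝ} (hf : Integrable f μ) :
    Integrable (fun ω => PI σ a b m (X ω) * f ω) μ := by
  obtain ⟨M, hM⟩ := PI_bdd σ a b m
  exact hf.bdd_mul ((PI_cont σ a b m).measurable.comp hX).aestronglyMeasurable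
    (ae_of_all _ fun x => hM _)

lemma stein_prod {P : Measure Ω} {Q : Measure Ω'} [IsProbabilityMeasure P] [IsProbabilityMeasure Q]
    {W : Ω → Fin d → ℝ} (hW : Measurable W) (hWi : ∀ j, Integrable (fun ω => W ω j) P)
    {τ : (Fin d → ℝ) → Matrix (Fin d) (Fin d) ℝ} (h : IsSteinKernel P W τ)
    {Y : Ω' → Fin d → ℝ} (hY : Measurable Y)
    (σ : ℝ) (a b : Fin d → ℝ) {s : ℝ} (hs : s ≠ 0) :
    ∑ j, ∫ p, PI σ a b (Pi.single j 1) (s • W p.1 + Y p.2) * W p.1 j ∂(P.prod Q) =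
      s * ∑ i, ∑ j, ∫ p, PI σ a b (Pi.single j 1 + Pi.single i 1) (s • W p.1 + Y p.2) *
        τ (W p.1) i j ∂(P.prod Q) := by
  have hX : Measurable fun p : Ω × Ω' => s • W p.1 + Y p.2 :=
    ((hW.comp measurable_fst).const_smul s).add (hY.comp measurable_snd)
  have i1 : ∀ j, Integrable (fun p : Ω × Ω' => PI σ a b (Pi.single j 1) (s • W p.1 + Y p.2) *
      W p.1 j) (P.prod Q) := fun j => PI_mul_integrable σ a b _ hX ((hWi j).comp_fst Q)
  have i2 : ∀ i j, Integrable (fun p : Ω × Ω' => PI σ a b (Pi.single j 1 + Pi.single i 1)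
      (s • W p.1 + Y p.2) * τ (W p.1) i j) (P.prod Q) :=
    fun i j => PI_mul_integrable σ a b _ hX ((h.2.1 i j).comp_fst Q)
  have e1 : ∀ j, ∫ p, PI σ a b (Pi.single j 1) (s • W p.1 + Y p.2) * W p.1 j ∂(P.prod Q) =
      ∫ y, ∫ ω, PI σ a b (Pi.single j 1) (s • W ω + Y y) * W ω j ∂P ∂Q := fun j =>
    integral_prod_symm _ (i1 j)
  have e2 : ∀ i j, ∫ p, PI σ a b (Pi.single j 1 + Pi.single i 1) (s • W p.1 + Y p.2) *
        τ (W p.1) i j ∂(P.prod Q) =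
      ∫ y, ∫ ω, PI σ a b (Pi.single j 1 + Pi.single i 1) (s • W ω + Y y) * τ (W ω) i j ∂P ∂Q :=
    fun i j => integral_prod_symm _ (i2 i j)
  simp only [e1, e2]
  rw [← integral_finsetSum _ fun j _ => (i1 j).integral_prod_right]
  simp only [← integral_finsetSum _ fun j _ => (i2 _ j).integral_prod_right]
  rw [← integral_finsetSum _ fun i _ => integrable_finsetSum _ fun j _ =>
    (i2 i j).integral_prod_right, ← integral_const_mul]
  congr 1
  funext y
  exact stein_PI h σ a b hs (Y y)

/-- derivative of the interpolation, after Stein's identities -/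
lemma deriv_identity {P : Measure Ω} [IsProbabilityMeasure P]
    {W : Ω → Fin d → ℝ} (hW : Measurable W) (hWi : ∀ j, Integrable (fun ω => W ω j) P)
    {τ : (Fin d → ℝ) → Matrix (Fin d) (Fin d) ℝ} (h : IsSteinKernel P W τ)
    (B : Matrix (Fin d) (Fin d) ℝ) (c : ℝ) (σ : ℝ) (a b : Fin d → ℝ) {s u : ℝ} (hs : s ≠ 0)
    (hu : u ≠ 0) :
    ∫ p, (∑ j, PI σ a b (Pi.single j 1) (s • W p.1 + u • (B *ᵥ p.2)) *
          (u * W p.1 j - s * (B *ᵥ p.2) j) +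
        ∑ j, PI σ a b (Pi.single j 1 + Pi.single j 1) (s • W p.1 + u • (B *ᵥ p.2)) *
          (-(c * (s * u)))) ∂(P.prod (gam d)) =
    s * u * ∫ p, ∑ i, ∑ j, PI σ a b (Pi.single j 1 + Pi.single i 1)
      (s • W p.1 + u • (B *ᵥ p.2)) *
        (τ (W p.1) i j - (B * Bᵀ + c • (1 : Matrix (Fin d) (Fin d) ℝ)) i j) ∂(P.prod (gam d)) := by
  have hcB : Measurable fun n : Fin d → ℝ => B *ᵥ n := by
    have : Continuous fun n : Fin d → ℝ => B *ᵥ n := by fun_prop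
    exact this.measurable
  have hX : Measurable fun p : Ω × (Fin d → ℝ) => s • W p.1 + u • (B *ᵥ p.2) :=
    ((hW.comp measurable_fst).const_smul s).add ((hcB.comp measurable_snd).const_smul u)
  have hBi := mulVec_coord_integrable B
  have S1 := stein_prod (Q := gam d) hW hWi h (hcB.const_smul u) σ a b hs
  have S2 := stein_prod (Q := P) hcB hBi (gam_stein B) (hW.const_smul s) σ a b hu
  have sw : ∀ (m : Fin d → ℕ) (f : (Fin d → ℝ) → ℝ),
      ∫ p, PI σ a b m (u • (B *ᵥ p.1) + s • W p.2) * f p.1 ∂((gam d).prod P) =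
      ∫ p, PI σ a b m (s • W p.1 + u • (B *ᵥ p.2)) * f p.2 ∂(P.prod (gam d)) := by
    intro m f
    rw [← integral_prod_swap]
    simp only [Prod.fst_swap, Prod.snd_swap, add_comm]
  have S2' := S2
  simp only [Pi.smul_apply] at S1 S2'
  rw [Finset.sum_congr rfl fun j _ => sw (Pi.single j 1) (fun n => (B *ᵥ n) j)] at S2'
  have S3 : ∑ i, ∑ j, ∫ p, PI σ a b (Pi.single j 1 + Pi.single i 1)
        (u • (B *ᵥ p.1) + s • W p.2) * (B * Bᵀ) i j ∂((gam d).prod P) =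
      ∑ i, ∑ j, ∫ p, PI σ a b (Pi.single j 1 + Pi.single i 1)
        (s • W p.1 + u • (B *ᵥ p.2)) * (B * Bᵀ) i j ∂(P.prod (gam d)) :=
    Finset.sum_congr rfl fun i _ => Finset.sum_congr rfl fun j _ =>
      sw (Pi.single j 1 + Pi.single i 1) (fun _ => (B * Bᵀ) i j)
  have S4 := S2'.trans (congrArg (fun r => u * r) S3)
  have i1 : ∀ j, Integrable (fun p : Ω × (Fin d → ℝ) => PI σ a b (Pi.single j 1)
      (s • W p.1 + u • (B *ᵥ p.2)) * W p.1 j) (P.prod (gam d)) :=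
    fun j => PI_mul_integrable σ a b _ hX ((hWi j).comp_fst _)
  have i2 : ∀ j, Integrable (fun p : Ω × (Fin d → ℝ) => PI σ a b (Pi.single j 1)
      (s • W p.1 + u • (B *ᵥ p.2)) * (B *ᵥ p.2) j) (P.prod (gam d)) :=
    fun j => PI_mul_integrable σ a b _ hX ((hBi j).comp_snd _)
  have i3 : ∀ i j, Integrable (fun p : Ω × (Fin d → ℝ) => PI σ a b (Pi.single j 1 + Pi.single i 1)
      (s • W p.1 + u • (B *ᵥ p.2)) * τ (W p.1) i j) (P.prod (gam d)) :=
    fun i j => PI_mul_integrable σ a b _ hX ((h.2.1 i j).comp_fst _)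
  have i4 : ∀ i j (r : ℝ), Integrable (fun p : Ω × (Fin d → ℝ) =>
      PI σ a b (Pi.single j 1 + Pi.single i 1)
      (s • W p.1 + u • (B *ᵥ p.2)) * r) (P.prod (gam d)) :=
    fun i j r => PI_mul_integrable σ a b _ hX (integrable_const r)
  have L1 : ∫ p, (∑ j, PI σ a b (Pi.single j 1) (s • W p.1 + u • (B *ᵥ p.2)) *
          (u * W p.1 j - s * (B *ᵥ p.2) j) +
        ∑ j, PI σ a b (Pi.single j 1 + Pi.single j 1) (s • W p.1 + u • (B *ᵥ p.2)) *
          (-(c * (s * u)))) ∂(P.prod (gam d)) =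
      u * (∑ j, ∫ p, PI σ a b (Pi.single j 1) (s • W p.1 + u • (B *ᵥ p.2)) * W p.1 j
        ∂(P.prod (gam d))) -
      s * (∑ j, ∫ p, PI σ a b (Pi.single j 1) (s • W p.1 + u • (B *ᵥ p.2)) * (B *ᵥ p.2) j
        ∂(P.prod (gam d))) + ∑ j, ∫ p, PI σ a b (Pi.single j 1 + Pi.single j 1)
          (s • W p.1 + u • (B *ᵥ p.2)) * (-(c * (s * u))) ∂(P.prod (gam d)) := by
    rw [← integral_finsetSum _ fun j _ => i1 j, ← integral_finsetSum _ fun j _ => i2 j,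
      ← integral_finsetSum _ fun j _ => i4 j j _, ← integral_const_mul, ← integral_const_mul,
      ← integral_sub, ← integral_add]
    · congr 1
      funext p
      congr 1
      rw [Finset.mul_sum, Finset.mul_sum, ← Finset.sum_sub_distrib]
      apply Finset.sum_congr rfl
      intro j _
      ring
    · exact ((integrable_finsetSum _ fun j _ => i1 j).const_mul _).sub
        ((integrable_finsetSum _ fun j _ => i2 j).const_mul _)
    · exact integrable_finsetSum _ fun j _ => i4 j j _
    · exact (integrable_finsetSum _ fun j _ => i1 j).const_mul _
    · exact (integrable_finsetSum _ fun j _ => i2 j).const_mul _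
  have R1 : ∫ p, ∑ i, ∑ j, PI σ a b (Pi.single j 1 + Pi.single i 1)
      (s • W p.1 + u • (B *ᵥ p.2)) *
        (τ (W p.1) i j - (B * Bᵀ + c • (1 : Matrix (Fin d) (Fin d) ℝ)) i j) ∂(P.prod (gam d)) =
      ∑ i, ∑ j, ∫ p, PI σ a b (Pi.single j 1 + Pi.single i 1)
        (s • W p.1 + u • (B *ᵥ p.2)) * τ (W p.1) i j ∂(P.prod (gam d)) -
      ∑ i, ∑ j, ∫ p, PI σ a b (Pi.single j 1 + Pi.single i 1)
        (s • W p.1 + u • (B *ᵥ p.2)) * (B * Bᵀ) i j ∂(P.prod (gam d)) -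
      c * ∑ j, ∫ p, PI σ a b (Pi.single j 1 + Pi.single j 1)
        (s • W p.1 + u • (B *ᵥ p.2)) ∂(P.prod (gam d)) := by
    have ex : ∀ i j (p : Ω × (Fin d → ℝ)), PI σ a b (Pi.single j 1 + Pi.single i 1)
      (s • W p.1 + u • (B *ᵥ p.2)) *
        (τ (W p.1) i j - (B * Bᵀ + c • (1 : Matrix (Fin d) (Fin d) ℝ)) i j) =
        PI σ a b (Pi.single j 1 + Pi.single i 1)
        (s • W p.1 + u • (B *ᵥ p.2)) * τ (W p.1) i j -
        PI σ a b (Pi.single j 1 + Pi.single i 1)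
        (s • W p.1 + u • (B *ᵥ p.2)) * (B * Bᵀ) i j -
        PI σ a b (Pi.single j 1 + Pi.single i 1)
        (s • W p.1 + u • (B *ᵥ p.2)) * (c * (1 : Matrix (Fin d) (Fin d) ℝ) i j) := by
      intro i j p
      simp only [Matrix.add_apply, Matrix.smul_apply, smul_eq_mul]
      ring
    have i5 : ∀ i j, Integrable (fun p : Ω × (Fin d → ℝ) =>
        PI σ a b (Pi.single j 1 + Pi.single i 1)
        (s • W p.1 + u • (B *ᵥ p.2)) * τ (W p.1) i j -
        PI σ a b (Pi.single j 1 + Pi.single i 1)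
        (s • W p.1 + u • (B *ᵥ p.2)) * (B * Bᵀ) i j -
        PI σ a b (Pi.single j 1 + Pi.single i 1)
        (s • W p.1 + u • (B *ᵥ p.2)) * (c * (1 : Matrix (Fin d) (Fin d) ℝ) i j))
        (P.prod (gam d)) := fun i j => ((i3 i j).sub (i4 i j _)).sub (i4 i j _)
    simp only [ex]
    rw [integral_finsetSum _ fun i _ => integrable_finsetSum _ fun j _ => i5 i j,
      Finset.mul_sum, ← Finset.sum_sub_distrib, ← Finset.sum_sub_distrib]
    apply Finset.sum_congr rfl
    intro i _
    rw [integral_finsetSum _ fun j _ => i5 i j, ← Finset.sum_sub_distrib]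
    have e : ∀ j, ∫ p, (PI σ a b (Pi.single j 1 + Pi.single i 1)
        (s • W p.1 + u • (B *ᵥ p.2)) * τ (W p.1) i j -
        PI σ a b (Pi.single j 1 + Pi.single i 1)
        (s • W p.1 + u • (B *ᵥ p.2)) * (B * Bᵀ) i j -
        PI σ a b (Pi.single j 1 + Pi.single i 1)
        (s • W p.1 + u • (B *ᵥ p.2)) * (c * (1 : Matrix (Fin d) (Fin d) ℝ) i j))
        ∂(P.prod (gam d)) = ∫ p, PI σ a b (Pi.single j 1 + Pi.single i 1)
        (s • W p.1 + u • (B *ᵥ p.2)) * τ (W p.1) i j ∂(P.prod (gam d)) -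
        ∫ p, PI σ a b (Pi.single j 1 + Pi.single i 1)
        (s • W p.1 + u • (B *ᵥ p.2)) * (B * Bᵀ) i j ∂(P.prod (gam d)) -
        ∫ p, PI σ a b (Pi.single j 1 + Pi.single i 1)
        (s • W p.1 + u • (B *ᵥ p.2)) * (c * (1 : Matrix (Fin d) (Fin d) ℝ) i j)
        ∂(P.prod (gam d)) := by
      intro j
      have q1 := integral_sub (i3 i j) (i4 i j ((B * Bᵀ) i j))
      have q2 := integral_sub ((i3 i j).sub (i4 i j ((B * Bᵀ) i j)))
        (i4 i j (c * (1 : Matrix (Fin d) (Fin d) ℝ) i j))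
      rw [← q1]
      exact q2
    simp only [e]
    rw [Finset.sum_sub_distrib]
    congr 1
    rw [Finset.sum_eq_single i]
    · rw [integral_mul_const]; simp; ring
    · intro j _ hj
      simp [Matrix.one_apply_ne' hj]
    · simp
  rw [L1, R1, S1, S4]
  simp only [integral_mul_const, ← Finset.sum_mul]
  ring

set_option maxHeartbeats 1000000 in
/-- Main comparison. -/
lemma compare (hd : 3 ≤ d) {P : Measure Ω} [IsProbabilityMeasure P]
    {W : Ω → Fin d → ℝ} (hW : Measurable W) (hWi : ∀ j, Integrable (fun ω => W ω j) P)
    {τ : (Fin d → ℝ) → Matrix (Fin d) (Fin d) ℝ} (h : IsSteinKernel P W τ)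
    (B : Matrix (Fin d) (Fin d) ℝ) {c : ℝ} (hc : 0 < c) {g : Ω → ℝ} (hg : Integrable g P)
    (hgb : ∀ ω i j, |(B * Bᵀ + c • (1 : Matrix (Fin d) (Fin d) ℝ)) i j - τ (W ω) i j| ≤ g ω)
    {t : ℝ} (ht : 0 < t) {a b : Fin d → ℝ} (hab : ∀ k, a k ≤ b k) :
    |∫ ω, PI (√t) a b 0 (W ω) ∂P - ∫ n, PI (√(c + t)) a b 0 (B *ᵥ n) ∂(gam d)| ≤
      (∫ ω, g ω ∂P) * C2 * Real.log d / (2 * c) * (Real.log (c + t) - Real.log t) := by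
  have hL := one_le_log hd
  have hC2 := C2_pos
  have hd0 : 0 < d := by omega
  have hg0 : ∀ ω, 0 ≤ g ω := fun ω => (abs_nonneg _).trans (hgb ω ⟨0, hd0⟩ ⟨0, hd0⟩)
  have hcB : Measurable fun n : Fin d → ℝ => B *ᵥ n := by
    have : Continuous fun n : Fin d → ℝ => B *ᵥ n := by fun_prop
    exact this.measurable
  have hBi := mulVec_coord_integrable B
  set μ := P.prod (gam d) with hμ
  set v : ℝ → ℝ := fun θ => c * Real.cos θ ^ 2 + t with hv
  have hv0 : ∀ θ, 0 < v θ := fun θ => by simp only [hv]; positivity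
  have hvt : ∀ θ, t ≤ v θ := fun θ => by
    have : 0 ≤ c * Real.cos θ ^ 2 := by positivity
    simp only [hv]; linarith
  have hvd : ∀ θ, HasDerivAt v (-(2 * c * (Real.sin θ * Real.cos θ))) θ := fun θ => by
    have := (((Real.hasDerivAt_cos θ).pow 2).const_mul c).add_const t
    exact this.congr_deriv (by simp; ring)
  set σ : ℝ → ℝ := fun θ => √(v θ) with hσ
  have hσ0 : ∀ θ, 0 < σ θ := fun θ => Real.sqrt_pos.2 (hv0 θ)
  have hσsq : ∀ θ, σ θ ^ 2 = v θ := fun θ => Real.sq_sqrt (hv0 θ).le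
  have hσd : ∀ θ, HasDerivAt σ (-(2 * c * (Real.sin θ * Real.cos θ)) / (2 * σ θ)) θ := fun θ =>
    (hvd θ).sqrt (hv0 θ).ne'
  set X : ℝ → Ω × (Fin d → ℝ) → Fin d → ℝ :=
    fun θ p => Real.sin θ • W p.1 + Real.cos θ • (B *ᵥ p.2) with hX
  have hXm : ∀ θ, Measurable (X θ) := fun θ =>
    ((hW.comp measurable_fst).const_smul (Real.sin θ)).add
      ((hcB.comp measurable_snd).const_smul (Real.cos θ))
  set K : ℝ → Ω × (Fin d → ℝ) → ℝ := fun θ p => PI (σ θ) a b 0 (X θ p) with hK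
  set K' : ℝ → Ω × (Fin d → ℝ) → ℝ := fun θ p =>
    ∑ j, PI (σ θ) a b (Pi.single j 1) (X θ p) *
        (Real.cos θ * W p.1 j - Real.sin θ * (B *ᵥ p.2) j) +
      ∑ j, PI (σ θ) a b (Pi.single j 1 + Pi.single j 1) (X θ p) *
        (-(c * (Real.sin θ * Real.cos θ))) with hK'
  have hKd : ∀ θ p, HasDerivAt (fun θ => K θ p) (K' θ p) θ := by
    intro θ p
    have := PI_curve2 a b σ (fun θ => X θ p) _
      (fun j => Real.cos θ * W p.1 j - Real.sin θ * (B *ᵥ p.2) j) θ (hσd θ) (hσ0 θ) (fun k => by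
        have := ((Real.hasDerivAt_sin θ).mul_const (W p.1 k)).add
          ((Real.hasDerivAt_cos θ).mul_const ((B *ᵥ p.2) k))
        exact this.congr_deriv (by ring))
    refine this.congr_deriv ?_
    simp only [hK']
    congr 1
    apply Finset.sum_congr rfl
    intro j _
    have := (hσ0 θ).ne'
    congr 1
    field_simp
  have hKm : ∀ θ, AEStronglyMeasurable (K θ) μ := fun θ =>
    ((PI_cont (σ θ) a b 0).measurable.comp (hXm θ)).aestronglyMeasurable
  have hKi : ∀ θ, Integrable (K θ) μ := fun θ => by
    have := PI_mul_integrable (μ := μ) (σ θ) a b 0 (hXm θ) (integrable_const (1 : ℝ))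
    simpa using this
  have hKi' : ∀ θ, Integrable (K' θ) μ := fun θ => by
    apply Integrable.add
    · exact integrable_finsetSum _ fun j _ => PI_mul_integrable _ _ _ _ (hXm θ)
        ((((hWi j).comp_fst _).const_mul _).sub (((hBi j).comp_snd _).const_mul _))
    · exact integrable_finsetSum _ fun j _ => PI_mul_integrable _ _ _ _ (hXm θ)
        (integrable_const _)
  have hdiag : ∀ θ p, ∑ j, |PI (σ θ) a b (Pi.single j 1 + Pi.single j 1) (X θ p)| ≤
      C2 * Real.log d / v θ := by
    intro θ p
    rw [← hσsq]
    refine le_trans ?_ (key_two hd (hσ0 θ) hab (X θ p))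
    apply Finset.sum_le_sum
    intro i _
    exact Finset.single_le_sum
      (f := fun j => |PI (σ θ) a b (Pi.single j 1 + Pi.single i 1) (X θ p)|)
      (fun j _ => abs_nonneg _) (Finset.mem_univ i)
  have hdom : ∀ θ p, ‖K' θ p‖ ≤
      (∑ j, 1 / √t * (|W p.1 j| + |(B *ᵥ p.2) j|)) + C2 * Real.log d / t * c := by
    intro θ p
    simp only [hK', Real.norm_eq_abs]
    refine (abs_add_le _ _).trans (add_le_add ?_ ?_)
    · refine (Finset.abs_sum_le_sum_abs _ _).trans (Finset.sum_le_sum fun j _ => ?_)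
      rw [abs_mul]
      apply mul_le_mul
      · refine (PI_one_bdd (hσ0 θ) hab j _).trans ?_
        apply one_div_le_one_div_of_le (Real.sqrt_pos.2 ht)
        exact Real.sqrt_le_sqrt (hvt θ)
      · refine (abs_sub _ _).trans (add_le_add ?_ ?_)
        · rw [abs_mul]
          exact mul_le_of_le_one_left (abs_nonneg _) (Real.abs_cos_le_one θ)
        · rw [abs_mul]
          exact mul_le_of_le_one_left (abs_nonneg _) (Real.abs_sin_le_one θ)
      · positivity
      · positivity
    · rw [← Finset.sum_mul, abs_mul]
      apply mul_le_mul
      · refine (Finset.abs_sum_le_sum_abs _ _).trans ((hdiag θ p).trans ?_)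
        have := hvt θ
        gcongr
      · rw [abs_neg, abs_mul, abs_mul, abs_of_pos hc]
        have h1 := Real.abs_sin_le_one θ
        have h2 := Real.abs_cos_le_one θ
        have h3 : |Real.sin θ| * |Real.cos θ| ≤ 1 := mul_le_one₀ h1 (abs_nonneg _) h2
        nlinarith
      · positivity
      · positivity
  have hdomi : Integrable (fun p : Ω × (Fin d → ℝ) =>
      (∑ j, 1 / √t * (|W p.1 j| + |(B *ᵥ p.2) j|)) + C2 * Real.log d / t * c) μ := by
    apply Integrable.add _ (integrable_const _)
    exact integrable_finsetSum _ fun j _ =>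
      (((hWi j).comp_fst _).abs.add ((hBi j).comp_snd _).abs).const_mul _
  set Ψ : ℝ → ℝ := fun θ => ∫ p, K θ p ∂μ with hΨ
  have hΨd : ∀ θ, HasDerivAt Ψ (∫ p, K' θ p ∂μ) θ := fun θ =>
    (hasDerivAt_integral_of_dominated_loc_of_deriv_le (Filter.univ_mem)
      (Filter.Eventually.of_forall hKm) (hKi θ) (hKi' θ).aestronglyMeasurable
      (ae_of_all _ fun p θ _ => hdom θ p) hdomi (ae_of_all _ fun p θ _ => hKd θ p)).2
  set D := ∫ ω, g ω ∂P with hD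
  have hderiv : ∀ θ ∈ Set.Ioo (0 : ℝ) (π / 2), |∫ p, K' θ p ∂μ| ≤
      Real.sin θ * Real.cos θ * (C2 * Real.log d / v θ * D) := by
    intro θ hθ
    have hs : 0 < Real.sin θ := Real.sin_pos_of_pos_of_lt_pi hθ.1 (by linarith [hθ.2, Real.pi_pos])
    have hu : 0 < Real.cos θ := Real.cos_pos_of_mem_Ioo ⟨by linarith [hθ.1, Real.pi_pos], hθ.2⟩
    have hid := deriv_identity hW hWi h B c (σ θ) a b hs.ne' hu.ne'
    rw [← hμ] at hid
    have hid' : ∫ p, K' θ p ∂μ = _ := hid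
    rw [hid', abs_mul, abs_of_pos (mul_pos hs hu)]
    apply mul_le_mul_of_nonneg_left _ (mul_pos hs hu).le
    have hgi : ∫ p, C2 * Real.log d / v θ * g p.1 ∂μ = C2 * Real.log d / v θ * D := by
      rw [integral_const_mul, hμ, integral_fun_fst]
      simp [hD]
    rw [← hgi, ← Real.norm_eq_abs]
    apply norm_integral_le_of_norm_le ((hg.comp_fst _).const_mul _)
    refine ae_of_all _ fun p => ?_
    rw [Real.norm_eq_abs]
    calc _ ≤ ∑ i, ∑ j, |PI (σ θ) a b (Pi.single j 1 + Pi.single i 1) (X θ p)| * g p.1 := by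
          refine (Finset.abs_sum_le_sum_abs _ _).trans (Finset.sum_le_sum fun i _ => ?_)
          refine (Finset.abs_sum_le_sum_abs _ _).trans (Finset.sum_le_sum fun j _ => ?_)
          rw [abs_mul]
          apply mul_le_mul_of_nonneg_left _ (abs_nonneg _)
          rw [abs_sub_comm]
          exact hgb p.1 i j
      _ = (∑ i, ∑ j, |PI (σ θ) a b (Pi.single j 1 + Pi.single i 1) (X θ p)|) * g p.1 := by
          simp only [Finset.sum_mul]
      _ ≤ _ := by
          apply mul_le_mul_of_nonneg_right _ (hg0 _)
          rw [← hσsq]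
          exact key_two hd (hσ0 θ) hab _
  set κ := D * C2 * Real.log d / (2 * c) with hκ
  set G : ℝ → ℝ := fun θ => -(κ * Real.log (v θ)) with hG
  have hGd : ∀ θ, HasDerivAt G (Real.sin θ * Real.cos θ * (C2 * Real.log d / v θ * D)) θ := by
    intro θ
    have := (((hvd θ).log (hv0 θ).ne').const_mul κ).neg
    refine this.congr_deriv ?_
    have h1 := (hv0 θ).ne'
    rw [hκ]
    field_simp
  have hpi : (0 : ℝ) ≤ π / 2 := by positivity
  have m1 : MonotoneOn (fun θ => G θ - Ψ θ) (Set.Icc 0 (π / 2)) := by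
    apply monotoneOn_of_deriv_nonneg (convex_Icc _ _)
    · exact fun θ _ => ((hGd θ).sub (hΨd θ)).continuousAt.continuousWithinAt
    · exact fun θ _ => ((hGd θ).sub (hΨd θ)).differentiableAt.differentiableWithinAt
    · intro θ hθ
      rw [interior_Icc] at hθ
      have e : deriv (fun θ => G θ - Ψ θ) θ = _ := ((hGd θ).sub (hΨd θ)).deriv
      rw [e]
      linarith [(abs_le.1 (hderiv θ hθ)).2]
  have m2 : MonotoneOn (fun θ => G θ + Ψ θ) (Set.Icc 0 (π / 2)) := by
    apply monotoneOn_of_deriv_nonneg (convex_Icc _ _)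
    · exact fun θ _ => ((hGd θ).add (hΨd θ)).continuousAt.continuousWithinAt
    · exact fun θ _ => ((hGd θ).add (hΨd θ)).differentiableAt.differentiableWithinAt
    · intro θ hθ
      rw [interior_Icc] at hθ
      have e : deriv (fun θ => G θ + Ψ θ) θ = _ := ((hGd θ).add (hΨd θ)).deriv
      rw [e]
      linarith [(abs_le.1 (hderiv θ hθ)).1]
  have f1 := m1 (Set.left_mem_Icc.2 hpi) (Set.right_mem_Icc.2 hpi) hpi
  have f2 := m2 (Set.left_mem_Icc.2 hpi) (Set.right_mem_Icc.2 hpi) hpi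
  have E1 : Ψ (π / 2) = ∫ ω, PI (√t) a b 0 (W ω) ∂P := by
    simp only [hΨ, hK, hX, hσ, hv]
    simp only [Real.sin_pi_div_two, Real.cos_pi_div_two, one_smul, zero_smul, add_zero]
    have e0 : c * (0 : ℝ) ^ 2 + t = t := by ring
    rw [e0, hμ, integral_fun_fst (fun ω => PI (√t) a b 0 (W ω))]
    simp
  have E0 : Ψ 0 = ∫ n, PI (√(c + t)) a b 0 (B *ᵥ n) ∂(gam d) := by
    simp only [hΨ, hK, hX, hσ, hv]
    simp only [Real.sin_zero, Real.cos_zero, one_smul, zero_smul, zero_add]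
    have e0 : c * (1 : ℝ) ^ 2 + t = c + t := by ring
    rw [e0, hμ, integral_fun_snd (fun n => PI (√(c + t)) a b 0 (B *ᵥ n))]
    simp
  have G1 : G (π / 2) = -(κ * Real.log t) := by simp [hG, hv]
  have G0 : G 0 = -(κ * Real.log (c + t)) := by simp [hG, hv]
  simp only [G1, G0, E1, E0] at f1 f2
  rw [abs_le]
  constructor
  · linarith
  · linarith

end

end SKB
/-! ### Smoothing of rectangles -/

namespace SKB

/-- finite open rectangle -/
def rect {d : ℕ} (a b : Fin d → ℝ) : Set (Fin d → ℝ) := {x | ∀ k, a k < x k ∧ x k < b k}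

lemma rect_meas {d : ℕ} (a b : Fin d → ℝ) : MeasurableSet (rect a b) := by
  have : rect a b = Set.univ.pi fun k => Set.Ioo (a k) (b k) := by
    ext x; simp [rect]
  rw [this]
  exact MeasurableSet.univ_pi fun k => measurableSet_Ioo

lemma one_sub_sum_le {ι : Type*} (u : Finset ι) (p : ι → ℝ) (h0 : ∀ k, 0 ≤ p k)
    (h1 : ∀ k, p k ≤ 1) : 1 - ∑ k ∈ u, (1 - p k) ≤ ∏ k ∈ u, p k := by
  classical
  induction u using Finset.induction_on with
  | empty => simp
  | insert i s hi ih =>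
    rw [Finset.sum_insert hi, Finset.prod_insert hi]
    have h2 : ∏ k ∈ s, p k ≤ 1 := Finset.prod_le_one (fun k _ => h0 k) (fun k _ => h1 k)
    have := h1 i
    nlinarith

lemma smooth_up {d : ℕ} {σ : ℝ} (hσ : 0 < σ) {r : ℝ} (hr : 0 ≤ r) {a b : Fin d → ℝ}
    (hab : ∀ k, a k ≤ b k) (x : Fin d → ℝ) :
    (rect a b).indicator (fun _ => (1 : ℝ)) x ≤
      PI σ (fun k => a k - r * σ) (fun k => b k + r * σ) 0 x + 2 * d * Q r := by
  have hQ := Q_nonneg r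
  have hrs : 0 ≤ r * σ := by positivity
  have hab' : ∀ k, a k - r * σ ≤ b k + r * σ := fun k => by linarith [hab k]
  by_cases hx : x ∈ rect a b
  · rw [Set.indicator_of_mem hx, PI_zero]
    have h := one_sub_sum_le Finset.univ
      (fun k => pj σ (a k - r * σ) (b k + r * σ) (x k)) (fun k => pj_nonneg hσ (hab' k) _)
      (fun k => pj_le_one _ _ _ _)
    have h2 : ∑ k, (1 - pj σ (a k - r * σ) (b k + r * σ) (x k)) ≤ ∑ _k : Fin d, 2 * Q r := by
      apply Finset.sum_le_sum
      intro k _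
      obtain ⟨h3, h4⟩ := hx k
      unfold pj
      have h5 : Phi r ≤ Phi ((b k + r * σ - x k) / σ) := by
        apply Phi_mono
        rw [le_div_iff₀ hσ]; linarith
      have h6 : Phi ((a k - r * σ - x k) / σ) ≤ Phi (-r) := by
        apply Phi_mono
        rw [div_le_iff₀ hσ]; linarith
      rw [Phi_neg] at h6
      unfold Q
      linarith
    simp only [Finset.sum_const, Finset.card_univ, Fintype.card_fin, nsmul_eq_mul] at h2
    linarith
  · rw [Set.indicator_of_notMem hx]
    have := PI_zero_nonneg hσ hab' x
    positivity

lemma smooth_low {d : ℕ} {σ : ℝ} (hσ : 0 < σ) {r : ℝ} (hr : 0 ≤ r) {a b : Fin d → ℝ}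
    (hab : ∀ k, a k ≤ b k) (x : Fin d → ℝ) :
    PI σ (fun k => min (a k + r * σ) ((a k + b k) / 2)) (fun k => max (b k - r * σ)
      ((a k + b k) / 2)) 0 x ≤ (rect a b).indicator (fun _ => (1 : ℝ)) x + Q r := by
  have hQ := Q_nonneg r
  have hrs : 0 ≤ r * σ := by positivity
  have hab' : ∀ k, min (a k + r * σ) ((a k + b k) / 2) ≤ max (b k - r * σ) ((a k + b k) / 2) :=
    fun k => (min_le_right _ _).trans (le_max_right _ _)
  by_cases hx : x ∈ rect a b
  · rw [Set.indicator_of_mem hx]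
    have := PI_zero_le_one hσ hab' x
    linarith
  · rw [Set.indicator_of_notMem hx, zero_add, PI_zero]
    simp only [rect, Set.mem_ofPred_eq, not_forall] at hx
    obtain ⟨k, hk⟩ := hx
    have key : pj σ (min (a k + r * σ) ((a k + b k) / 2)) (max (b k - r * σ)
        ((a k + b k) / 2)) (x k) ≤ Q r := by
      rcases le_total (a k + r * σ) ((a k + b k) / 2) with hm | hm
      · have hm2 : (a k + b k) / 2 ≤ b k - r * σ := by linarith
        rw [min_eq_left hm, max_eq_left hm2]
        unfold pj Q
        by_cases hxa : a k < x k
        · have hxb : b k ≤ x k := by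
            by_contra h
            exact hk ⟨hxa, not_le.1 h⟩
          have h1 : Phi ((b k - r * σ - x k) / σ) ≤ Phi (-r) := by
            apply Phi_mono
            rw [div_le_iff₀ hσ]; linarith
          rw [Phi_neg] at h1
          have := Phi_nonneg ((a k + r * σ - x k) / σ)
          linarith
        · have h1 : Phi r ≤ Phi ((a k + r * σ - x k) / σ) := by
            apply Phi_mono
            rw [le_div_iff₀ hσ]; linarith
          have := Phi_le_one ((b k - r * σ - x k) / σ)
          linarith
      · have hm2 : b k - r * σ ≤ (a k + b k) / 2 := by linarith
        rw [min_eq_right hm, max_eq_right hm2]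
        unfold pj
        linarith
    rw [← Finset.prod_erase_mul _ _ (Finset.mem_univ k)]
    calc _ ≤ 1 * Q r := by
          apply mul_le_mul _ key (pj_nonneg hσ (hab' k) _) zero_le_one
          exact Finset.prod_le_one (fun j _ => pj_nonneg hσ (hab' j) _)
            (fun j _ => pj_le_one _ _ _ _)
      _ = _ := one_mul _

section
variable {d : ℕ} {Ω : Type} [MeasurableSpace Ω]

lemma PI_integrable {μ : Measure Ω} [IsProbabilityMeasure μ] (σ : ℝ) (a b : Fin d → ℝ)
    (m : Fin d → ℕ) {X : Ω → Fin d → ℝ} (hX : Measurable X) :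
    Integrable (fun ω => PI σ a b m (X ω)) μ := by
  simpa using PI_mul_integrable σ a b m hX (integrable_const (1 : ℝ))

lemma prob_eq {μ : Measure Ω} [IsProbabilityMeasure μ] {X : Ω → Fin d → ℝ} (hX : Measurable X)
    (a b : Fin d → ℝ) :
    (μ (X ⁻¹' rect a b)).toReal = ∫ ω, (rect a b).indicator (fun _ => (1 : ℝ)) (X ω) ∂μ := by
  have e : ∀ ω, (rect a b).indicator (fun _ => (1 : ℝ)) (X ω) =
      (X ⁻¹' rect a b).indicator (fun _ => (1 : ℝ)) ω := fun ω => rfl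
  simp only [e]
  rw [integral_indicator (hX (rect_meas a b))]
  simp [Measure.real]

lemma ind_integrable {μ : Measure Ω} [IsProbabilityMeasure μ] {X : Ω → Fin d → ℝ}
    (hX : Measurable X) (a b : Fin d → ℝ) :
    Integrable (fun ω => (rect a b).indicator (fun _ => (1 : ℝ)) (X ω)) μ := by
  have e : (fun ω => (rect a b).indicator (fun _ => (1 : ℝ)) (X ω)) =
      (X ⁻¹' rect a b).indicator (fun _ => (1 : ℝ)) := rfl
  rw [e]
  exact (integrable_const _).indicator (hX (rect_meas a b))

lemma prob_up {μ : Measure Ω} [IsProbabilityMeasure μ] {X : Ω → Fin d → ℝ} (hX : Measurable X)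
    {σ : ℝ} (hσ : 0 < σ) {r : ℝ} (hr : 0 ≤ r) {a b : Fin d → ℝ}
    (hab : ∀ k, a k ≤ b k) : (μ (X ⁻¹' rect a b)).toReal ≤
      ∫ ω, PI σ (fun k => a k - r * σ) (fun k => b k + r * σ) 0 (X ω) ∂μ + 2 * d * Q r := by
  rw [prob_eq hX]
  have i := PI_integrable (μ := μ) σ (fun k => a k - r * σ) (fun k => b k + r * σ) 0 hX
  have := integral_mono (ind_integrable hX a b) (i.add (integrable_const (2 * d * Q r)))
    (fun ω => smooth_up hσ hr hab (X ω))
  refine this.trans_eq ?_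
  have e := integral_add i (integrable_const (μ := μ) (2 * d * Q r))
  refine e.trans ?_
  simp

lemma prob_low {μ : Measure Ω} [IsProbabilityMeasure μ] {X : Ω → Fin d → ℝ} (hX : Measurable X)
    {σ : ℝ} (hσ : 0 < σ) {r : ℝ} (hr : 0 ≤ r) {a b : Fin d → ℝ}
    (hab : ∀ k, a k ≤ b k) :
    ∫ ω, PI σ (fun k => min (a k + r * σ) ((a k + b k) / 2)) (fun k => max (b k - r * σ)
      ((a k + b k) / 2)) 0 (X ω) ∂μ ≤ (μ (X ⁻¹' rect a b)).toReal + Q r := by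
  rw [prob_eq hX]
  have i := ind_integrable (μ := μ) hX a b
  have := integral_mono (PI_integrable (μ := μ) σ _ _ 0 hX) (i.add (integrable_const (Q r)))
    (fun ω => smooth_low hσ hr hab (X ω))
  refine this.trans_eq ?_
  have e := integral_add i (integrable_const (μ := μ) (Q r))
  refine e.trans ?_
  simp

/-- bound for finite rectangles -/
lemma rect_bound (hd : 3 ≤ d) {P : Measure Ω} [IsProbabilityMeasure P]
    {W : Ω → Fin d → ℝ} (hW : Measurable W) (hWi : ∀ j, Integrable (fun ω => W ω j) P)
    {τ : (Fin d → ℝ) → Matrix (Fin d) (Fin d) ℝ} (h : IsSteinKernel P W τ)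
    {S : Matrix (Fin d) (Fin d) ℝ} (hS : S.PosDef)
    (B : Matrix (Fin d) (Fin d) ℝ) {c : ℝ} (hc : 0 < c)
    (hSB : S = B * Bᵀ + c • (1 : Matrix (Fin d) (Fin d) ℝ))
    {g : Ω → ℝ} (hg : Integrable g P) (hgb : ∀ ω i j, |S i j - τ (W ω) i j| ≤ g ω)
    {t : ℝ} (ht : 0 < t) {r : ℝ} (hr : 0 ≤ r) {a b : Fin d → ℝ} (hab : ∀ k, a k ≤ b k) :
    |(P (W ⁻¹' rect a b)).toReal - (gaussianMeasure d S (rect a b)).toReal| ≤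
      (∫ ω, g ω ∂P) * C2 * Real.log d / (2 * c) * (Real.log (c + t) - Real.log t) +
      3 * d * Real.exp (-(r ^ 2 / 2)) +
      Real.exp 1 * C0 * Real.log d * (2 * r * (√t / √c)) := by
  have hL := one_le_log hd
  have hC0 := C0_pos
  obtain ⟨M, hM⟩ := exists_factor hS.posSemidef
  have hMdet : M.det ≠ 0 := by
    have := hS.det_pos
    rw [hM, Matrix.det_mul, Matrix.det_transpose] at this
    intro h0
    simp [h0] at this
  have hMm : Measurable fun n : Fin d → ℝ => M *ᵥ n := by
    have : Continuous fun n : Fin d → ℝ => M *ᵥ n := by fun_prop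
    exact this.measurable
  have hcB : Measurable fun n : Fin d → ℝ => B *ᵥ n := by
    have : Continuous fun n : Fin d → ℝ => B *ᵥ n := by fun_prop
    exact this.measurable
  have hZ : gaussianMeasure d S (rect a b) = gam d ((fun n => M *ᵥ n) ⁻¹' rect a b) := by
    rw [hM, gaussianMeasure_eq_map M hMdet, Measure.map_apply hMm (rect_meas a b)]
  rw [hZ]
  have hσ : 0 < √t := Real.sqrt_pos.2 ht
  have hrs : 0 ≤ r * √t := by positivity
  have hab1 : ∀ k, (fun k => a k - r * √t) k ≤ (fun k => b k + r * √t) k := fun k => by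
    have := hab k
    simp only
    linarith
  have hab2 : ∀ k, (fun k => min (a k + r * √t) ((a k + b k) / 2)) k ≤
      (fun k => max (b k - r * √t) ((a k + b k) / 2)) k :=
    fun k => (min_le_right _ _).trans (le_max_right _ _)
  have u1 := prob_up (μ := P) hW hσ hr hab
  have u2 := prob_up (μ := gam d) hMm hσ hr hab
  have l1 := prob_low (μ := P) hW hσ hr hab
  have l2 := prob_low (μ := gam d) hMm hσ hr hab
  have hgb' : ∀ ω i j, |(B * Bᵀ + c • (1 : Matrix (Fin d) (Fin d) ℝ)) i j - τ (W ω) i j| ≤ g ω := by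
    rw [← hSB]; exact hgb
  have hst : IsSteinKernel (gam d) (fun n => M *ᵥ n) (fun _ => S) := by
    have := gam_stein M
    rwa [← hM] at this
  have h0 : ∀ (n : Fin d → ℝ) i j, |(B * Bᵀ + c • (1 : Matrix (Fin d) (Fin d) ℝ)) i j -
      (fun _ => S : (Fin d → ℝ) → Matrix (Fin d) (Fin d) ℝ) ((fun n => M *ᵥ n) n) i j| ≤
      (fun _ => 0 : (Fin d → ℝ) → ℝ) n := by
    intro n i j
    rw [← hSB]; simp
  have c1 := compare hd hW hWi h B hc hg hgb' ht hab1
  have c2 := compare hd hW hWi h B hc hg hgb' ht hab2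
  have c3 := compare hd hMm (mulVec_coord_integrable M) hst B hc (integrable_const 0) h0 ht hab1
  have c4 := compare hd hMm (mulVec_coord_integrable M) hst B hc (integrable_const 0) h0 ht hab2
  have z : ∫ _n : Fin d → ℝ, (0 : ℝ) ∂(gam d) = 0 := by simp
  rw [z] at c3 c4
  simp only [zero_mul, zero_div] at c3 c4
  set E := (∫ ω, g ω ∂P) * C2 * Real.log d / (2 * c) * (Real.log (c + t) - Real.log t)
  have hct : 0 < √(c + t) := Real.sqrt_pos.2 (by positivity)
  have ac : ∫ n, PI (√(c + t)) (fun k => a k - r * √t) (fun k => b k + r * √t) 0 (B *ᵥ n) ∂(gam d) -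
      ∫ n, PI (√(c + t)) (fun k => min (a k + r * √t) ((a k + b k) / 2))
        (fun k => max (b k - r * √t) ((a k + b k) / 2)) 0 (B *ᵥ n) ∂(gam d) ≤
      Real.exp 1 * C0 * Real.log d * (2 * r * (√t / √c)) := by
    rw [← integral_sub (PI_integrable _ _ _ _ hcB) (PI_integrable _ _ _ _ hcB)]
    have hb : ∀ n, PI (√(c + t)) (fun k => a k - r * √t) (fun k => b k + r * √t) 0 (B *ᵥ n) -
        PI (√(c + t)) (fun k => min (a k + r * √t) ((a k + b k) / 2))
        (fun k => max (b k - r * √t) ((a k + b k) / 2)) 0 (B *ᵥ n) ≤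
        Real.exp 1 * C0 * Real.log d * (2 * r * (√t / √c)) := by
      intro n
      refine (anti_conc hd hct hab2 (η := 2 * (r * √t)) (fun k => ?_) (fun k => ?_) (fun k => ?_)
        (fun k => ?_) _).trans ?_
      · have := hab k
        simp only [le_min_iff]
        constructor <;> linarith
      · have := hab k
        simp only [max_le_iff]
        constructor <;> linarith
      · have := min_le_left (a k + r * √t) ((a k + b k) / 2)
        linarith
      · have := le_max_left (b k - r * √t) ((a k + b k) / 2)
        linarith
      · have e : 2 * r * (√t / √c) = 2 * (r * √t) / √c := by ring
        rw [e]
        have : √c ≤ √(c + t) := Real.sqrt_le_sqrt (by linarith)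
        have : 0 < √c := Real.sqrt_pos.2 hc
        gcongr
    have := integral_mono ((PI_integrable (μ := gam d) _ _ _ _ hcB).sub
      (PI_integrable _ _ _ _ hcB)) (integrable_const _) hb
    refine this.trans_eq ?_
    simp
  have hQ := Q_nonneg r
  have hQt := Q_tail hr
  have hd1 : (3 : ℝ) ≤ d := by exact_mod_cast hd
  have hq : 2 * d * Q r + Q r ≤ 3 * d * Real.exp (-(r ^ 2 / 2)) := by
    have : 3 * d * Q r ≤ 3 * d * Real.exp (-(r ^ 2 / 2)) := by gcongr
    nlinarith
  have hE : 0 ≤ E := (abs_nonneg _).trans c1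
  rw [abs_le] at c1 c2 c3 c4 ⊢
  constructor
  · linarith [c1.1, c1.2, c2.1, c2.2, c3.1, c3.2, c4.1, c4.2]
  · linarith [c1.1, c1.2, c2.1, c2.2, c3.1, c3.2, c4.1, c4.2]

/-- extension to all hyperrectangles -/
lemma hyper_of_rect {P Q' : Measure (Fin d → ℝ)} [IsFiniteMeasure P] [IsFiniteMeasure Q'] {K : ℝ}
    (hK0 : 0 ≤ K)
    (hK : ∀ a b : Fin d → ℝ, (∀ k, a k ≤ b k) →
      |(P (rect a b)).toReal - (Q' (rect a b)).toReal| ≤ K)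
    {A : Set (Fin d → ℝ)} (hA : IsHyperrectangle A) :
    |(P A).toReal - (Q' A).toReal| ≤ K := by
  obtain ⟨a, b, rfl⟩ := hA
  rcases Set.eq_empty_or_nonempty
    {x : Fin d → ℝ | ∀ j, a j < (x j : EReal) ∧ (x j : EReal) < b j} with he | ⟨x0, hx0⟩
  · rw [he]; simpa using hK0
  have ha : ∀ j, a j ≠ ⊤ := fun j h => by have := (hx0 j).1; simp [h] at this
  have hb : ∀ j, b j ≠ ⊥ := fun j h => by have := (hx0 j).2; simp [h] at this
  set α : ℕ → Fin d → ℝ := fun n j => if a j = ⊥ then x0 j - n - 1 else (a j).toReal with hα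
  set β : ℕ → Fin d → ℝ := fun n j => if b j = ⊤ then x0 j + n + 1 else (b j).toReal with hβ
  have hα0 : ∀ n j, α n j < x0 j := by
    intro n j
    simp only [hα]
    have hn : (0 : ℝ) ≤ n := Nat.cast_nonneg n
    split_ifs with h
    · linarith
    · have := (hx0 j).1
      rw [← EReal.coe_toReal (ha j) h] at this
      exact_mod_cast this
  have hβ0 : ∀ n j, x0 j < β n j := by
    intro n j
    simp only [hβ]
    have hn : (0 : ℝ) ≤ n := Nat.cast_nonneg n
    split_ifs with h
    · linarith
    · have := (hx0 j).2
      rw [← EReal.coe_toReal h (hb j)] at this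
      exact_mod_cast this
  have hmono : Monotone fun n => rect (α n) (β n) := by
    intro n m hnm x hx k
    have hnm' : (n : ℝ) ≤ m := by exact_mod_cast hnm
    obtain ⟨h1, h2⟩ := hx k
    have e1 : α m k ≤ α n k := by
      simp only [hα]
      split_ifs <;> linarith
    have e2 : β n k ≤ β m k := by
      simp only [hβ]
      split_ifs <;> linarith
    exact ⟨e1.trans_lt h1, h2.trans_le e2⟩
  have hU : (⋃ n, rect (α n) (β n)) =
      {x : Fin d → ℝ | ∀ j, a j < (x j : EReal) ∧ (x j : EReal) < b j} := by
    ext x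
    simp only [Set.mem_iUnion, Set.mem_ofPred_eq]
    constructor
    · rintro ⟨n, hn⟩ j
      obtain ⟨h1, h2⟩ := hn j
      constructor
      · by_cases h : a j = ⊥
        · rw [h]; exact EReal.bot_lt_coe _
        · simp only [hα, h, if_false] at h1
          rw [← EReal.coe_toReal (ha j) h]
          exact_mod_cast h1
      · by_cases h : b j = ⊤
        · rw [h]; exact EReal.coe_lt_top _
        · simp only [hβ, h, if_false] at h2
          rw [← EReal.coe_toReal h (hb j)]
          exact_mod_cast h2
    · intro hx
      obtain ⟨n, hn⟩ := exists_nat_gt (∑ j, |x j - x0 j|)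
      refine ⟨n, fun j => ?_⟩
      have hj : |x j - x0 j| ≤ ∑ j, |x j - x0 j| :=
        Finset.single_le_sum (f := fun j => |x j - x0 j|) (fun j _ => abs_nonneg _)
          (Finset.mem_univ j)
      have hj2 := abs_le.1 hj
      constructor
      · simp only [hα]
        split_ifs with h
        · linarith [hj2.1]
        · have := (hx j).1
          rw [← EReal.coe_toReal (ha j) h] at this
          exact_mod_cast this
      · simp only [hβ]
        split_ifs with h
        · linarith [hj2.2]
        · have := (hx j).2
          rw [← EReal.coe_toReal h (hb j)] at this
          exact_mod_cast this
  have t1 := (ENNReal.tendsto_toReal (measure_ne_top P _)).comp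
    (tendsto_measure_iUnion_atTop (μ := P) hmono)
  have t2 := (ENNReal.tendsto_toReal (measure_ne_top Q' _)).comp
    (tendsto_measure_iUnion_atTop (μ := Q') hmono)
  rw [hU] at t1 t2
  refine le_of_tendsto (t1.sub t2).abs (Filter.Eventually.of_forall fun n => ?_)
  exact hK _ _ fun k => ((hα0 n k).trans (hβ0 n k)).le

end

end SKB
/-! ### Choice of the parameters and conclusion -/

namespace SKB

/-- the absolute constant -/
def Cfin : ℝ := 5 / 2 * C2 + 3 + 4 * Real.exp 1 * C0

lemma Cfin_ge : 1 ≤ Cfin := by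
  have := C0_pos
  have := C2_pos
  have h : 0 ≤ 4 * Real.exp 1 * C0 := by positivity
  unfold Cfin
  linarith

/-- optimisation of the parameters -/
lemma choose_params {d : ℕ} (hd : 3 ≤ d) {c D x : ℝ} (hc : 0 < c)
    (hx : ∀ t : ℝ, 0 < t → ∀ r : ℝ, 0 ≤ r → x ≤
      D * C2 * Real.log d / (2 * c) * (Real.log (c + t) - Real.log t) +
      3 * d * Real.exp (-(r ^ 2 / 2)) +
      Real.exp 1 * C0 * Real.log d * (2 * r * (√t / √c)))
    {δ : ℝ} (hδ : 0 < δ) (hD : D ≤ δ * c) (hδL : δ * Real.log d < 1) :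
    x ≤ Cfin * δ * Real.log d * max (-Real.log δ) 1 := by
  have hL := one_le_log hd
  have hC0 := C0_pos
  have hC2 := C2_pos
  set L := Real.log d with hLdef
  have hd0 : (0 : ℝ) < d := by positivity
  have hδ1 : δ < 1 := by nlinarith
  set l := -Real.log δ with hl
  have hl0 : 0 < l := by
    have := Real.log_neg hδ hδ1
    linarith
  have hlδ : δ * l ≤ 1 := by
    have h1 := Real.log_le_sub_one_of_pos (inv_pos.2 hδ)
    rw [Real.log_inv] at h1
    have h2 : l ≤ δ⁻¹ := by linarith
    calc δ * l ≤ δ * δ⁻¹ := by gcongr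
      _ = 1 := mul_inv_cancel₀ hδ.ne'
  set m := max l 1 with hm
  have hm1 : 1 ≤ m := le_max_right _ _
  have hml : l ≤ m := le_max_left _ _
  set r := √(2 * (L + l)) with hr
  have hr0 : 0 ≤ r := Real.sqrt_nonneg _
  have hrsq : r ^ 2 = 2 * (L + l) := Real.sq_sqrt (by positivity)
  have h := hx (c * δ ^ 4) (by positivity) r hr0
  refine h.trans ?_
  have e1 : Real.exp (-(r ^ 2 / 2)) = δ / d := by
    rw [hrsq]
    have : -(2 * (L + l) / 2) = Real.log δ - L := by rw [hl]; ring
    rw [this, Real.exp_sub, Real.exp_log hδ, hLdef, Real.exp_log hd0]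
  have e2 : √(c * δ ^ 4) / √c = δ ^ 2 := by
    rw [Real.sqrt_mul hc.le]
    have : √(δ ^ 4) = δ ^ 2 := by
      rw [show δ ^ 4 = (δ ^ 2) ^ 2 by ring]
      exact Real.sqrt_sq (by positivity)
    rw [this]
    have := (Real.sqrt_pos.2 hc).ne'
    field_simp
  have e3 : Real.log (c + c * δ ^ 4) - Real.log (c * δ ^ 4) ≤ 1 + 4 * l := by
    rw [show c + c * δ ^ 4 = c * (1 + δ ^ 4) by ring, Real.log_mul hc.ne' (by positivity),
      Real.log_mul hc.ne' (by positivity), Real.log_pow]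
    have h1 := Real.log_le_sub_one_of_pos (show (0 : ℝ) < 1 + δ ^ 4 by positivity)
    have h2 : δ ^ 4 ≤ 1 := pow_le_one₀ hδ.le hδ1.le
    push_cast
    linarith
  have e4 : 0 ≤ Real.log (c + c * δ ^ 4) - Real.log (c * δ ^ 4) := by
    have : Real.log (c * δ ^ 4) ≤ Real.log (c + c * δ ^ 4) :=
      Real.log_le_log (by positivity) (by linarith)
    linarith
  have e5 : r * δ ≤ 2 := by
    apply (pow_le_pow_iff_left₀ (by positivity) (by norm_num) two_ne_zero).1
    rw [mul_pow, hrsq]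
    have h1 : L * δ ^ 2 ≤ 1 := by nlinarith
    have h2 : l * δ ^ 2 ≤ 1 := by nlinarith
    nlinarith
  rw [e1, e2]
  have t1 : D * C2 * L / (2 * c) * (Real.log (c + c * δ ^ 4) - Real.log (c * δ ^ 4)) ≤
      5 / 2 * C2 * (δ * L * m) := by
    have h1 : D * C2 * L / (2 * c) ≤ δ * C2 * L / 2 := by
      rw [div_le_div_iff₀ (by positivity) (by norm_num)]
      have : 0 ≤ C2 * L := by positivity
      nlinarith
    calc _ ≤ δ * C2 * L / 2 * (1 + 4 * l) := by
          apply mul_le_mul h1 e3 e4 (by positivity)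
      _ ≤ δ * C2 * L / 2 * (5 * m) := by gcongr; linarith
      _ = _ := by ring
  have hδLm : δ ≤ δ * L * m := by
    have : 1 ≤ L * m := by nlinarith
    calc δ = δ * 1 := by ring
      _ ≤ δ * (L * m) := by gcongr
      _ = _ := by ring
  have t2 : 3 * d * (δ / d) ≤ 3 * (δ * L * m) := by
    have : 3 * d * (δ / d) = 3 * δ := by field_simp
    rw [this]; linarith
  have t3 : Real.exp 1 * C0 * L * (2 * r * δ ^ 2) ≤ 4 * Real.exp 1 * C0 * (δ * L * m) := by
    calc _ = 2 * (Real.exp 1 * C0 * L * δ) * (r * δ) := by ring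
      _ ≤ 2 * (Real.exp 1 * C0 * L * δ) * (2 * m) := 
          mul_le_mul_of_nonneg_left (by linarith : r * δ ≤ 2 * m) (by positivity)
      _ = _ := by ring
  have : Cfin * δ * L * m = 5 / 2 * C2 * (δ * L * m) + 3 * (δ * L * m) +
      4 * Real.exp 1 * C0 * (δ * L * m) := by unfold Cfin; ring
  rw [this]
  linarith

lemma sup_props {d : ℕ} {Ω : Type} [MeasurableSpace Ω] {P : Measure Ω}
    [IsProbabilityMeasure P] {W : Ω → Fin d → ℝ} (hW : Measurable W)
    {τ : (Fin d → ℝ) → Matrix (Fin d) (Fin d) ℝ} (h : IsSteinKernel P W τ)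
    (S : Matrix (Fin d) (Fin d) ℝ) :
    Integrable (fun ω => ⨆ j, ⨆ k, |S j k - τ (W ω) j k|) P ∧
      ∀ ω i j, |S i j - τ (W ω) i j| ≤ ⨆ j, ⨆ k, |S j k - τ (W ω) j k| := by
  have hb : ∀ ω i j, |S i j - τ (W ω) i j| ≤ ⨆ j, ⨆ k, |S j k - τ (W ω) j k| := by
    intro ω i j
    refine (le_ciSup (f := fun k => |S i k - τ (W ω) i k|) (Set.finite_range _).bddAbove j).trans ?_
    exact le_ciSup (f := fun i => ⨆ k, |S i k - τ (W ω) i k|) (Set.finite_range _).bddAbove i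
  refine ⟨?_, hb⟩
  have hm : Measurable fun ω => ⨆ j, ⨆ k, |S j k - τ (W ω) j k| := by
    apply Measurable.iSup
    intro j
    apply Measurable.iSup
    intro k
    have : Measurable fun ω => S j k - τ (W ω) j k := ((h.1 j k).comp hW).const_sub _
    exact this.abs
  have hi : Integrable (fun ω => ∑ j, ∑ k, |S j k - τ (W ω) j k|) P :=
    integrable_finsetSum _ fun j _ => integrable_finsetSum _ fun k _ =>
      ((integrable_const (S j k)).sub (h.2.1 j k)).abs
  refine hi.mono hm.aestronglyMeasurable (ae_of_all _ fun ω => ?_)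
  rw [Real.norm_eq_abs, Real.norm_eq_abs,
    abs_of_nonneg (Real.iSup_nonneg fun j => Real.iSup_nonneg fun k => abs_nonneg _),
    abs_of_nonneg (Finset.sum_nonneg fun j _ => Finset.sum_nonneg fun k _ => abs_nonneg _)]
  apply Real.iSup_le _ (Finset.sum_nonneg fun j _ => Finset.sum_nonneg fun k _ => abs_nonneg _)
  intro j
  apply Real.iSup_le _ (Finset.sum_nonneg fun j _ => Finset.sum_nonneg fun k _ => abs_nonneg _)
  intro k
  refine (Finset.single_le_sum (f := fun k => |S j k - τ (W ω) j k|) (fun k _ => abs_nonneg _)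
    (Finset.mem_univ k)).trans ?_
  exact Finset.single_le_sum (f := fun j => ∑ k, |S j k - τ (W ω) j k|)
    (fun j _ => Finset.sum_nonneg fun k _ => abs_nonneg _) (Finset.mem_univ j)

lemma gaussian_prob {d : ℕ} {S : Matrix (Fin d) (Fin d) ℝ} (hS : S.PosDef) :
    IsProbabilityMeasure (gaussianMeasure d S) := by
  obtain ⟨M, hM⟩ := exists_factor hS.posSemidef
  have hMdet : M.det ≠ 0 := by
    have := hS.det_pos
    rw [hM, Matrix.det_mul, Matrix.det_transpose] at this
    intro h0
    simp [h0] at this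
  have hMm : Measurable fun n : Fin d → ℝ => M *ᵥ n := by
    have : Continuous fun n : Fin d → ℝ => M *ᵥ n := by fun_prop
    exact this.measurable
  rw [hM, gaussianMeasure_eq_map M hMdet]
  exact Measure.isProbabilityMeasure_map hMm.aemeasurable

/-- if the bound holds for all small `δ` then the quantity vanishes -/
lemma zero_case {L x : ℝ} (hL : 1 ≤ L)
    (hx : ∀ δ : ℝ, 0 < δ → δ * L < 1 → x ≤ Cfin * δ * L * max (-Real.log δ) 1) : x ≤ 0 := by
  by_contra! h
  have hC := Cfin_ge
  set s := min (1 / (2 * L)) (x / (4 * Cfin * L)) with hs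
  have hs0 : 0 < s := by
    rw [hs]; apply lt_min <;> positivity
  have h1 : s * (2 * L) ≤ 1 := by
    have := min_le_left (1 / (2 * L)) (x / (4 * Cfin * L))
    rw [← hs, le_div_iff₀ (by positivity)] at this
    exact this
  have h2 : s * (4 * Cfin * L) ≤ x := by
    have := min_le_right (1 / (2 * L)) (x / (4 * Cfin * L))
    rw [← hs, le_div_iff₀ (by positivity)] at this
    exact this
  have hs1 : s < 1 := by nlinarith
  have h3 := hx (s ^ 2) (by positivity) (by nlinarith)
  have h4 : s * max (-Real.log (s ^ 2)) 1 ≤ 2 := by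
    rw [Real.log_pow]
    have h5 := Real.log_le_sub_one_of_pos (inv_pos.2 hs0)
    rw [Real.log_inv] at h5
    have h6 : max (-((2 : ℕ) * Real.log s)) 1 ≤ 2 * s⁻¹ := by
      apply max_le
      · push_cast; linarith
      · have := one_le_inv₀ hs0 |>.2 hs1.le
        linarith
    calc _ ≤ s * (2 * s⁻¹) := by gcongr
      _ = 2 := by field_simp
  have h7 : Cfin * s ^ 2 * L * max (-Real.log (s ^ 2)) 1 ≤ Cfin * L * s * 2 := by
    calc _ = Cfin * L * s * (s * max (-Real.log (s ^ 2)) 1) := by ring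
      _ ≤ _ := by gcongr
  linarith

end SKB

/-- **Theorem 1 (Error bound using Stein kernels).** -/
theorem stein_kernel_bound :
    ∃ C : ℝ, 0 < C ∧
      ∀ (d : ℕ), 3 ≤ d →
      ∀ (Ω : Type) (_ : MeasurableSpace Ω) (P : Measure Ω) (_ : IsProbabilityMeasure P)
        (W : Ω → Fin d → ℝ), Measurable W →
        (∀ j, Integrable (fun ω => W ω j) P) → (∀ j, ∫ ω, W ω j ∂P = 0) →
      ∀ τ : (Fin d → ℝ) → Matrix (Fin d) (Fin d) ℝ, IsSteinKernel P W τ →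
      ∀ S : Matrix (Fin d) (Fin d) ℝ, S.PosDef →
      ∀ σbar σlow σs : ℝ, 0 < σbar → 0 < σlow → 0 < σs →
        IsGreatest (Set.range fun j => S j j) (σbar ^ 2) →
        IsLeast (Set.range fun j => S j j) (σlow ^ 2) →
        IsSmallestEigenvalueSq S σs →
      ∀ Δ : ℝ, Δ = ∫ ω, ⨆ j, ⨆ k, |S j k - τ (W ω) j k| ∂P →
      ∀ A : Set (Fin d → ℝ), IsHyperrectangle A →
        |(P (W ⁻¹' A)).toReal - (gaussianMeasure d S A).toReal| ≤
          C * (Δ / σs ^ 2) * Real.log d *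
            (|Real.log (σlow * Δ / (σbar * σs ^ 2))| ⊔ 1) := by
  refine ⟨SKB.Cfin, by linarith [SKB.Cfin_ge], ?_⟩
  intro d hd Ω _ P _ W hW hWi _ τ hτ S hS σbar σlow σs hbar hlow hs hmax hmin heig Δ hΔ A hA
  have hL := SKB.one_le_log hd
  have hC := SKB.Cfin_ge
  have hc : 0 < σs ^ 2 := by positivity
  set c := σs ^ 2 with hcdef
  set L := Real.log d with hLdef
  obtain ⟨B, hB⟩ := SKB.exists_factor (SKB.sub_posSemidef hS heig)
  have hSB : S = B * Bᵀ + c • (1 : Matrix (Fin d) (Fin d) ℝ) := by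
    rw [← hB, hcdef]; simp
  obtain ⟨hgi, hgb⟩ := SKB.sup_props hW hτ S
  have hgauss := SKB.gaussian_prob hS
  have hPW : IsProbabilityMeasure (P.map W) := Measure.isProbabilityMeasure_map hW.aemeasurable
  have hΔ0 : 0 ≤ Δ := by
    rw [hΔ]
    exact integral_nonneg fun ω =>
      Real.iSup_nonneg fun j => Real.iSup_nonneg fun k => abs_nonneg _
  have hAm : MeasurableSet A := by
    obtain ⟨a, b, rfl⟩ := hA
    have hm : ∀ j, Measurable fun x : Fin d → ℝ => ((x j : ℝ) : EReal) := fun j =>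
      measurable_coe_real_ereal.comp (measurable_pi_apply j)
    have e : {x : Fin d → ℝ | ∀ j, a j < (x j : EReal) ∧ (x j : EReal) < b j} =
        ⋂ j, {x : Fin d → ℝ | a j < (x j : EReal) ∧ (x j : EReal) < b j} := by
      ext x; simp
    rw [e]
    refine MeasurableSet.iInter fun j => ?_
    exact (measurableSet_lt measurable_const (hm j)).inter
      (measurableSet_lt (hm j) measurable_const)
  have hbound : ∀ t : ℝ, 0 < t → ∀ r : ℝ, 0 ≤ r →
      |(P (W ⁻¹' A)).toReal - (gaussianMeasure d S A).toReal| ≤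
      Δ * SKB.C2 * Real.log d / (2 * c) * (Real.log (c + t) - Real.log t) +
      3 * d * Real.exp (-(r ^ 2 / 2)) +
      Real.exp 1 * SKB.C0 * Real.log d * (2 * r * (√t / √c)) := by
    intro t ht r hr
    have hb : ∀ a b : Fin d → ℝ, (∀ k, a k ≤ b k) →
        |(P (W ⁻¹' SKB.rect a b)).toReal - (gaussianMeasure d S (SKB.rect a b)).toReal| ≤
        Δ * SKB.C2 * Real.log d / (2 * c) * (Real.log (c + t) - Real.log t) +
        3 * d * Real.exp (-(r ^ 2 / 2)) +
        Real.exp 1 * SKB.C0 * Real.log d * (2 * r * (√t / √c)) := by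
      intro a b hab
      rw [hΔ]
      exact SKB.rect_bound hd hW hWi hτ hS B hc hSB hgi hgb ht hr hab
    have h0 := (abs_nonneg _).trans (hb 0 0 fun k => le_rfl)
    rw [← Measure.map_apply hW hAm]
    apply SKB.hyper_of_rect h0 _ hA
    intro a b hab
    rw [Measure.map_apply hW (SKB.rect_meas a b)]
    exact hb a b hab
  have hpar : ∀ δ : ℝ, 0 < δ → Δ ≤ δ * c → δ * L < 1 →
      |(P (W ⁻¹' A)).toReal - (gaussianMeasure d S A).toReal| ≤
      SKB.Cfin * δ * L * max (-Real.log δ) 1 := fun δ h1 h2 h3 =>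
    SKB.choose_params hd hc hbound h1 h2 h3
  rcases hΔ0.eq_or_lt with h0 | hpos
  · rw [← h0]
    simp only [zero_div, mul_zero, zero_mul]
    apply SKB.zero_case hL
    intro δ h1 h2
    exact hpar δ h1 (by rw [← h0]; positivity) h2
  · have hδ : 0 < Δ / c := by positivity
    rcases lt_or_ge (Δ / c * L) 1 with hlt | hge
    · refine (hpar (Δ / c) hδ (by field_simp; exact le_rfl) hlt).trans ?_
      have hle : σlow ≤ σbar := by
        obtain ⟨j, hj⟩ := hmin.1
        have := hmax.2 ⟨j, rfl⟩
        simp only at hj this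
        rw [hj] at this
        exact (pow_le_pow_iff_left₀ hlow.le hbar.le two_ne_zero).1 this
      have hx : σlow * Δ / (σbar * c) ≤ Δ / c := by
        rw [div_le_div_iff₀ (by positivity) hc]
        have : 0 < Δ * c := by positivity
        nlinarith
      have hx0 : 0 < σlow * Δ / (σbar * c) := by positivity
      have hlog := Real.log_le_log hx0 hx
      apply mul_le_mul_of_nonneg_left _ (by positivity)
      apply max_le_max _ le_rfl
      exact (neg_le_neg hlog).trans (neg_le_abs _)
    · have hp1 : (P (W ⁻¹' A)).toReal ≤ 1 := by
        have := measureReal_le_one (μ := P) (s := W ⁻¹' A)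
        exact this
      have hp2 : (gaussianMeasure d S A).toReal ≤ 1 := by
        have := measureReal_le_one (μ := gaussianMeasure d S) (s := A)
        exact this
      have hp3 : 0 ≤ (P (W ⁻¹' A)).toReal := ENNReal.toReal_nonneg
      have hp4 : 0 ≤ (gaussianMeasure d S A).toReal := ENNReal.toReal_nonneg
      have h1 : |(P (W ⁻¹' A)).toReal - (gaussianMeasure d S A).toReal| ≤ 1 := by
        rw [abs_le]; constructor <;> linarith
      refine h1.trans ?_
      have h2 : (1 : ℝ) ≤ |Real.log (σlow * Δ / (σbar * c))| ⊔ 1 := le_sup_right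
      have h3 : 1 ≤ SKB.Cfin * (Δ / c) * L := by
        rw [mul_assoc]; nlinarith
      nlinarith
end
end

section
/- Let d ≥ 3, let T be any ℝ^d-valued random variable, and let Z ~ N(0,Σ) where Σ_{jj} ≥ 1 for all 1 ≤ j ≤ d. Then there is an absolute constant C > 0 such that sup_{A∈𝓡} |P(T ∈ A) − P(Z ∈ A)| ≤ C (log d)^{1/3} · 𝒲₂(T, Z)^{2/3}. -/
open MeasureTheory ProbabilityTheory Real Matrix

noncomputable section

/-- `G` is a centered Gaussian distribution on `ℝ^d`: every linear functional pushes it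
forward to a (possibly degenerate) centered Gaussian distribution on `ℝ`. -/
def IsCenteredGaussianMeasure {d : ℕ} (G : Measure (Fin d → ℝ)) : Prop :=
  IsProbabilityMeasure G ∧
    ∀ t : Fin d → ℝ, ∃ v : NNReal,
      G.map (fun x => ∑ j, t j * x j) = gaussianReal 0 v

/-- The `L²` transportation (2-Wasserstein) distance between two measures on `ℝ^d`,
with respect to the Euclidean norm, valued in `ℝ≥0∞`. -/
def wasserstein2 {d : ℕ} (μ ν : Measure (Fin d → ℝ)) : ENNReal :=
  (⨅ γ : {γ : Measure ((Fin d → ℝ) × (Fin d → ℝ)) //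
      γ.map Prod.fst = μ ∧ γ.map Prod.snd = ν},
    ∫⁻ p : (Fin d → ℝ) × (Fin d → ℝ), ENNReal.ofReal (∑ j, (p.1 j - p.2 j) ^ 2) ∂γ.1) ^ ((1 : ℝ) / 2)

lemma mill_aux {B x : ℝ} (hB : 1 ≤ B) (hx : x ≤ B) :
    gaussianPDF 0 1 x ≤ ENNReal.ofReal (Real.exp (3/2) * B) * gaussianReal 0 1 (Set.Ici x) := by
  have hB0 : 0 < B := by linarith
  have h1 : gaussianPDF 0 1 x * ENNReal.ofReal (Real.exp (-(3/2))) * ENNReal.ofReal (1/B)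
      ≤ gaussianReal 0 1 (Set.Ici x) := by
    calc gaussianPDF 0 1 x * ENNReal.ofReal (Real.exp (-(3/2))) * ENNReal.ofReal (1/B)
        = ∫⁻ _ in Set.Icc x (x + 1/B), gaussianPDF 0 1 x * ENNReal.ofReal (Real.exp (-(3/2))) := by
          rw [setLIntegral_const, Real.volume_Icc]; congr 2; ring
      _ ≤ ∫⁻ y in Set.Icc x (x + 1/B), gaussianPDF 0 1 y := by
          refine setLIntegral_mono (measurable_gaussianPDF _ _) fun y hy => ?_
          rw [gaussianPDF_def]
          simp only
          rw [← ENNReal.ofReal_mul (gaussianPDFReal_nonneg _ _ _)]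
          apply ENNReal.ofReal_le_ofReal
          simp only [gaussianPDFReal_def]
          rw [mul_assoc, ← Real.exp_add]
          gcongr
          obtain ⟨s, rfl⟩ : ∃ s, y = x + s := ⟨y - x, by ring⟩
          have hs0 : 0 ≤ s := by linarith [hy.1]
          have hs1 : s ≤ 1/B := by linarith [hy.2]
          have h2 : B * s ≤ 1 := by rw [le_div_iff₀ hB0] at hs1; linarith
          have h3 : x * s ≤ 1 := (mul_le_mul_of_nonneg_right hx hs0).trans h2
          have h4 : s ≤ 1 := by nlinarith
          simp only [NNReal.coe_one]
          nlinarith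
      _ = gaussianReal 0 1 (Set.Icc x (x + 1/B)) := (gaussianReal_apply 0 one_ne_zero _).symm
      _ ≤ _ := measure_mono Set.Icc_subset_Ici_self
  calc gaussianPDF 0 1 x = ENNReal.ofReal (Real.exp (3/2) * B) *
        (gaussianPDF 0 1 x * ENNReal.ofReal (Real.exp (-(3/2))) * ENNReal.ofReal (1/B)) := by
        rw [mul_assoc, ← ENNReal.ofReal_mul (by positivity), mul_left_comm,
          ← ENNReal.ofReal_mul (by positivity)]
        have : Real.exp (3/2) * B * (Real.exp (-(3/2)) * (1/B)) = 1 := by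
          rw [Real.exp_neg]; field_simp
        rw [this]; simp
    _ ≤ _ := by gcongr

lemma upper_aux {B b ε : ℝ} (hB : 1 ≤ B) (hb : b + ε ≤ B) {U : Set ℝ}
    (hU : IsUpperSet U) (hUm : MeasurableSet U) :
    gaussianReal 0 1 (Set.Ico b (b+ε) ∩ U) ≤
      ENNReal.ofReal (Real.exp (3/2) * B * ε) * gaussianReal 0 1 (Set.Ici b ∩ U) := by
  have hB0 : 0 < B := by linarith
  rw [gaussianReal_apply 0 one_ne_zero (Set.Ico b (b+ε) ∩ U)]
  calc ∫⁻ x in Set.Ico b (b+ε) ∩ U, gaussianPDF 0 1 x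
      ≤ ∫⁻ x in Set.Ico b (b+ε) ∩ U,
        ENNReal.ofReal (Real.exp (3/2) * B) * gaussianReal 0 1 (Set.Ici b ∩ U) := by
        refine setLIntegral_mono' (measurableSet_Ico.inter hUm) fun x hx => ?_
        refine (mill_aux hB (hx.1.2.le.trans hb)).trans ?_
        gcongr
        intro y hy
        exact ⟨hx.1.1.trans hy, hU hy hx.2⟩
    _ = ENNReal.ofReal (Real.exp (3/2) * B) * gaussianReal 0 1 (Set.Ici b ∩ U) *
          volume (Set.Ico b (b+ε) ∩ U) := setLIntegral_const _ _
    _ ≤ ENNReal.ofReal (Real.exp (3/2) * B) * gaussianReal 0 1 (Set.Ici b ∩ U) *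
          ENNReal.ofReal ε := by
        gcongr
        refine (measure_mono Set.inter_subset_left).trans ?_
        rw [Real.volume_Ico]; simp
    _ = _ := by
        rw [ENNReal.ofReal_mul (show 0 ≤ Real.exp (3/2) * B by positivity)]; ring

lemma tail_aux {D b ε : ℝ} (hD : 0 ≤ D) (hb : D ≤ b) :
    gaussianReal 0 1 (Set.Ico b (b+ε)) ≤ ENNReal.ofReal (Real.exp (-(D^2/2)) * ε) := by
  rw [gaussianReal_apply 0 one_ne_zero (Set.Ico b (b+ε))]
  calc ∫⁻ x in Set.Ico b (b+ε), gaussianPDF 0 1 x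
      ≤ ∫⁻ x in Set.Ico b (b+ε), ENNReal.ofReal (Real.exp (-(D^2/2))) := by
        refine setLIntegral_mono' measurableSet_Ico fun x hx => ?_
        rw [gaussianPDF_def]
        apply ENNReal.ofReal_le_ofReal
        simp only [gaussianPDFReal_def]
        have h1 : (√(2 * π * ((1:NNReal):ℝ)))⁻¹ ≤ 1 := by
          apply inv_le_one_of_one_le₀
          rw [Real.one_le_sqrt]
          have := Real.pi_gt_three
          simp; linarith
        have h2 : rexp (-(x - 0) ^ 2 / (2 * ((1:NNReal):ℝ))) ≤ Real.exp (-(D^2/2)) := by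
          gcongr
          have := hx.1
          simp
          nlinarith
        calc _ ≤ 1 * rexp (-(x - 0) ^ 2 / (2 * ((1:NNReal):ℝ))) := by gcongr
          _ ≤ _ := by simpa using h2
    _ = _ := by
        rw [setLIntegral_const, Real.volume_Ico, ENNReal.ofReal_mul (by positivity)]; simp

lemma indep_aux {Ω : Type*} [MeasurableSpace Ω] {μ : Measure Ω} [IsProbabilityMeasure μ]
    {E : Type*} [MeasurableSpace E] {X : Ω → ℝ} {W : Ω → E} (hX : AEMeasurable X μ)
    (hW : AEMeasurable W μ) (hlaw : μ.map X = gaussianReal 0 1) (hind : IndepFun X W μ)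
    {B b ε : ℝ} (hB : 1 ≤ B) (hb : b + ε ≤ B) {S : Set (ℝ × E)} (hS : MeasurableSet S)
    (hup : ∀ w, IsUpperSet {x | (x, w) ∈ S}) :
    μ {ω | X ω ∈ Set.Ico b (b+ε) ∧ (X ω, W ω) ∈ S} ≤
      ENNReal.ofReal (Real.exp (3/2) * B * ε) * μ {ω | X ω ∈ Set.Ici b ∧ (X ω, W ω) ∈ S} := by
  have hprod := (indepFun_iff_map_prod_eq_prod_map_map hX hW).1 hind
  have key : ∀ I : Set ℝ, MeasurableSet I → μ {ω | X ω ∈ I ∧ (X ω, W ω) ∈ S} =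
      ∫⁻ w, gaussianReal 0 1 (I ∩ {x | (x, w) ∈ S}) ∂(μ.map W) := by
    intro I hI
    have hm : MeasurableSet (Prod.fst ⁻¹' I ∩ S) := (measurable_fst hI).inter hS
    have : {ω | X ω ∈ I ∧ (X ω, W ω) ∈ S} = (fun ω => (X ω, W ω)) ⁻¹' (Prod.fst ⁻¹' I ∩ S) := rfl
    rw [this, ← Measure.map_apply_of_aemeasurable (hX.prodMk hW) hm, hprod, hlaw]
    have : IsProbabilityMeasure (μ.map W) := Measure.isProbabilityMeasure_map hW
    rw [Measure.prod_apply_symm hm]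
    rfl
  rw [key _ measurableSet_Ico, key _ measurableSet_Ici]
  rw [← lintegral_const_mul' _ _ ENNReal.ofReal_ne_top]
  refine lintegral_mono fun w => ?_
  exact upper_aux hB hb (hup w) (measurable_prodMk_right hS)

lemma nazarov_unit {ι : Type*} [Fintype ι] [LinearOrder ι] {Ω : Type*} [MeasurableSpace Ω]
    {μ : Measure Ω} {Y : ι → Ω → ℝ} (hY : HasGaussianLaw (fun ω i => Y i ω) μ)
    (hm : ∀ i, Measurable (Y i))
    (hlaw : ∀ i, μ.map (Y i) = gaussianReal 0 1) (b : ι → ℝ) {ε B : ℝ} (hε0 : 0 ≤ ε) (hε : ε ≤ 1)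
    (hB : 1 ≤ B) (hcard : Fintype.card ι * Real.exp (-((B-1)^2/2)) ≤ 1) :
    μ ({ω | ∀ i, Y i ω < b i + ε} \ {ω | ∀ i, Y i ω < b i}) ≤
      ENNReal.ofReal ((Real.exp (3/2) * B + 1) * ε) := by
  have : IsProbabilityMeasure μ := hY.isProbabilityMeasure
  let A : ι → Set Ω := fun j =>
    {ω | ∀ k, (k < j → Y k ω - b k < Y j ω - b j) ∧ Y k ω - b k ≤ Y j ω - b j}
  have hAm : ∀ j, MeasurableSet (A j) := by
    intro j
    have : A j = ⋂ k, ({ω | k < j → Y k ω - b k < Y j ω - b j} ∩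
        {ω | Y k ω - b k ≤ Y j ω - b j}) := by
      ext ω; simp [A]
    rw [this]
    refine MeasurableSet.iInter fun k => ?_
    refine MeasurableSet.inter ?_
      (measurableSet_le ((hm k).sub_const _) ((hm j).sub_const _))
    by_cases h : k < j
    · simp only [h, true_imp_iff]
      exact measurableSet_lt ((hm k).sub_const _) ((hm j).sub_const _)
    · simp [h]
  have hdisj : Pairwise (Function.onFun Disjoint A) := by
    intro i j hij
    rw [Function.onFun, Set.disjoint_left]
    intro ω hi hj
    rcases lt_or_gt_of_ne hij with h | h
    · exact absurd ((hj i).1 h) (not_lt.2 (hi j).2)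
    · exact absurd ((hi j).1 h) (not_lt.2 (hj i).2)
  have hsumA : ∑ j, μ (A j) ≤ 1 := by
    rw [← tsum_fintype (L := .unconditional _), ← measure_iUnion hdisj hAm]
    exact prob_le_one
  have hsub : ({ω | ∀ i, Y i ω < b i + ε} \ {ω | ∀ i, Y i ω < b i}) ⊆
      ⋃ j, {ω | Y j ω ∈ Set.Ico (b j) (b j + ε) ∧ ω ∈ A j} := by
    rintro ω ⟨h1, h2⟩
    simp only [Set.mem_ofPred_eq, not_forall, not_lt] at h1 h2
    obtain ⟨i, hi⟩ := h2
    have : Nonempty ι := ⟨i⟩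
    let M : Finset ι := Finset.univ.filter fun j => ∀ k, Y k ω - b k ≤ Y j ω - b j
    have hM : M.Nonempty := by
      obtain ⟨j, hj⟩ := Finite.exists_max (fun k => Y k ω - b k)
      exact ⟨j, by simp [M]; intro k; linarith [hj k]⟩
    have hmem := M.min'_mem hM
    set j := M.min' hM with hjdef
    have hj : ∀ k, Y k ω - b k ≤ Y j ω - b j := (Finset.mem_filter.1 hmem).2
    refine Set.mem_iUnion.2 ⟨j, ⟨⟨by linarith [hj i], h1 j⟩, fun k => ⟨fun hk => ?_, hj k⟩⟩⟩
    by_contra hcon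
    have : k ∈ M := Finset.mem_filter.2 ⟨Finset.mem_univ _, fun l => (hj l).trans (not_lt.1 hcon)⟩
    exact absurd (M.min'_le k this) (not_le.2 hk)
  have hEj : ∀ j, μ {ω | Y j ω ∈ Set.Ico (b j) (b j + ε) ∧ ω ∈ A j} ≤
      ENNReal.ofReal (Real.exp (3/2) * B * ε) * μ (A j) +
        ENNReal.ofReal (Real.exp (-((B-1)^2/2)) * ε) := by
    intro j
    rcases le_total (B-1) (b j) with hb | hb
    · refine le_add_left ?_
      refine le_trans (measure_mono (t := Y j ⁻¹' Set.Ico (b j) (b j + ε)) fun ω h => h.1) ?_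
      rw [← Measure.map_apply (hm j) measurableSet_Ico, hlaw j]
      exact tail_aux (by linarith) hb
    · refine le_add_right ?_
      have hL2 : ∀ k, MemLp (Y k) 2 μ := fun k => (hY.eval k).memLp_two
      have hvar : ∀ k, Var[Y k; μ] = 1 := by
        intro k
        have := variance_id_gaussianReal (μ := 0) (v := 1)
        rw [← hlaw k, variance_map aemeasurable_id (hm k).aemeasurable] at this
        simpa using this
      let c : ι → ℝ := fun k => cov[Y k, Y j; μ]
      have hc : ∀ k, c k ≤ 1 := by
        intro k
        have h := variance_sub (hL2 k) (hL2 j)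
        have h0 := variance_nonneg (Y k - Y j) μ
        rw [hvar, hvar] at h
        simp only [c]; linarith
      let W : ι → Ω → ℝ := fun k ω => Y k ω - c k * Y j ω
      have hWm : ∀ k, Measurable (W k) := fun k => (hm k).sub ((hm j).const_mul _)
      have hjoint : HasGaussianLaw (fun ω => (fun _ : Unit => Y j ω, fun k => W k ω)) μ := by
        let L : (ι → ℝ) →L[ℝ] ((Unit → ℝ) × (ι → ℝ)) :=
          ContinuousLinearMap.prod (ContinuousLinearMap.pi fun _ => .proj j)
            (ContinuousLinearMap.pi fun k =>
              ContinuousLinearMap.proj (R := ℝ) (φ := fun _ : ι => ℝ) k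
                - c k • ContinuousLinearMap.proj (R := ℝ) (φ := fun _ : ι => ℝ) j)
        exact hY.map_fun L
      have hind0 := hjoint.indepFun_of_covariance_eval (X := fun _ : Unit => Y j) (Y := W) (by
        intro _ k
        have : cov[Y j, fun ω => Y k ω - c k * Y j ω; μ] = 0 := by
          rw [covariance_fun_sub_right (hL2 j) (hL2 k) ((hL2 j).const_mul _),
            covariance_const_mul_right, covariance_self (hm j).aemeasurable, hvar,
            covariance_comm]
          simp [c]
        exact this)
      have hind : IndepFun (Y j) (fun ω k => W k ω) μ :=
        hind0.comp (φ := fun f : Unit → ℝ => f ()) (ψ := id) (measurable_pi_apply _) measurable_id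
      let S : Set (ℝ × (ι → ℝ)) := {p | ∀ k,
        (k < j → p.2 k + c k * p.1 - b k < p.1 - b j) ∧ p.2 k + c k * p.1 - b k ≤ p.1 - b j}
      have hS : MeasurableSet S := by
        have : S = ⋂ k, ({p | k < j → p.2 k + c k * p.1 - b k < p.1 - b j} ∩
            {p | p.2 k + c k * p.1 - b k ≤ p.1 - b j}) := by
          ext ω; simp [S]
        rw [this]
        refine MeasurableSet.iInter fun k => ?_
        have m1 : Measurable fun p : ℝ × (ι → ℝ) => p.2 k + c k * p.1 - b k := by fun_prop
        have m2 : Measurable fun p : ℝ × (ι → ℝ) => p.1 - b j := by fun_prop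
        refine MeasurableSet.inter ?_ (measurableSet_le m1 m2)
        by_cases h : k < j
        · simp only [h, true_imp_iff]
          exact measurableSet_lt m1 m2
        · simp [h]
      have hAS : ∀ ω, ω ∈ A j ↔ (Y j ω, fun k => W k ω) ∈ S := by
        intro ω
        simp [A, S, W]
      have hup : ∀ w, IsUpperSet {x | (x, w) ∈ S} := by
        intro w x y hxy hx k
        have h1 := (hx k).1
        have h2 := (hx k).2
        have h3 := hc k
        simp only at h1 h2 ⊢
        refine ⟨fun hk => ?_, ?_⟩
        · have := h1 hk
          nlinarith
        · nlinarith
      have := indep_aux (hm j).aemeasurable (measurable_pi_lambda _ hWm).aemeasurable (hlaw j) hind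
        hB (b := b j) (ε := ε) (by linarith) hS hup
      refine (measure_mono fun ω h => ?_).trans (this.trans ?_)
      · exact ⟨h.1, (hAS ω).1 h.2⟩
      · gcongr
        exact fun ω h => (hAS ω).2 h.2
  calc _ ≤ μ (⋃ j, {ω | Y j ω ∈ Set.Ico (b j) (b j + ε) ∧ ω ∈ A j}) := measure_mono hsub
    _ ≤ ∑ j, μ {ω | Y j ω ∈ Set.Ico (b j) (b j + ε) ∧ ω ∈ A j} := measure_iUnion_fintype_le _ _
    _ ≤ ∑ j, (ENNReal.ofReal (Real.exp (3/2) * B * ε) * μ (A j) +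
        ENNReal.ofReal (Real.exp (-((B-1)^2/2)) * ε)) := Finset.sum_le_sum fun j _ => hEj j
    _ = ENNReal.ofReal (Real.exp (3/2) * B * ε) * ∑ j, μ (A j) +
        ENNReal.ofReal (Fintype.card ι * (Real.exp (-((B-1)^2/2)) * ε)) := by
        rw [Finset.sum_add_distrib, ← Finset.mul_sum, Finset.sum_const, nsmul_eq_mul,
          ENNReal.ofReal_mul (p := (Fintype.card ι : ℝ)) (by positivity)]
        simp
    _ ≤ ENNReal.ofReal (Real.exp (3/2) * B * ε) * 1 + ENNReal.ofReal (1 * ε) := by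
        rw [← mul_assoc]
        gcongr
    _ = _ := by
        rw [mul_one, ← ENNReal.ofReal_add (by positivity) (by positivity)]
        congr 1; ring

lemma nazarov {ι : Type*} [Fintype ι] [LinearOrder ι] {Ω : Type*} [MeasurableSpace Ω]
    {μ : Measure Ω} {Y : ι → Ω → ℝ} (hY : HasGaussianLaw (fun ω i => Y i ω) μ)
    (hm : ∀ i, Measurable (Y i))
    (hlaw : ∀ i, ∃ v : NNReal, 1 ≤ v ∧ μ.map (Y i) = gaussianReal 0 v)
    (b : ι → ℝ) {ε B : ℝ} (hε0 : 0 ≤ ε) (hε : ε ≤ 1)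
    (hB : 1 ≤ B) (hcard : Fintype.card ι * Real.exp (-((B-1)^2/2)) ≤ 1) :
    μ ({ω | ∀ i, Y i ω < b i + ε} \ {ω | ∀ i, Y i ω < b i}) ≤
      ENNReal.ofReal ((Real.exp (3/2) * B + 1) * ε) := by
  choose v hv1 hv using hlaw
  let s : ι → ℝ := fun i => √(v i)
  have hs : ∀ i, 1 ≤ s i := fun i => Real.one_le_sqrt.2 (by exact_mod_cast hv1 i)
  have hs0 : ∀ i, 0 < s i := fun i => by linarith [hs i]
  have hY' : HasGaussianLaw (fun ω i => Y i ω / s i) μ := by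
    let L : (ι → ℝ) →L[ℝ] (ι → ℝ) := ContinuousLinearMap.pi fun k =>
      (s k)⁻¹ • ContinuousLinearMap.proj (R := ℝ) (φ := fun _ : ι => ℝ) k
    have := hY.map_fun L
    have he : (fun ω i => Y i ω / s i) = fun ω => L (fun i => Y i ω) := by
      ext ω i
      simp [L, div_eq_inv_mul]
    rw [he]; exact this
  have hlaw' : ∀ i, μ.map (fun ω => Y i ω / s i) = gaussianReal 0 1 := by
    intro i
    have : (fun ω => Y i ω / s i) = (fun x => x / s i) ∘ (Y i) := rfl
    rw [this, ← Measure.map_map (by fun_prop) (hm i), hv i, gaussianReal_map_div_const]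
    have h1 : v i ≠ 0 := by
      intro h; have := hv1 i; simp [h] at this
    congr 1
    · simp
    · ext
      simp [s]
      exact h1
  refine le_trans (measure_mono ?_) (nazarov_unit hY' (fun i => (hm i).div_const _) hlaw'
    (fun i => b i / s i) hε0 hε hB hcard)
  rintro ω ⟨h1, h2⟩
  simp only [Set.mem_ofPred_eq] at h1 h2
  refine ⟨fun i => ?_, fun h => h2 fun i => ?_⟩
  · rw [div_add' _ _ _ (hs0 i).ne']
    refine div_lt_div_of_pos_right ((h1 i).trans_le ?_) (hs0 i)
    nlinarith [hs i]
  · have := h i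
    exact (div_lt_div_iff_of_pos_right (hs0 i)).1 this

lemma isGaussian_of_centered {d : ℕ} {G : Measure (Fin d → ℝ)} (hG : IsCenteredGaussianMeasure G) :
    IsGaussian G := by
  refine isGaussian_of_map_eq_gaussianReal fun L => ?_
  obtain ⟨v, hv⟩ := hG.2 (fun j => L (Pi.single j 1))
  refine ⟨0, v, ?_⟩
  rw [← hv]
  congr 1
  ext x
  conv_lhs => rw [pi_eq_sum_univ' x]
  simp [map_sum, mul_comm]

lemma coord_law {d : ℕ} {G : Measure (Fin d → ℝ)} (hG : IsCenteredGaussianMeasure G)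
    (hvar : ∀ j, 1 ≤ ∫ x, (x j) ^ 2 ∂G) (j : Fin d) (s : ℝ) (hs : s = 1 ∨ s = -1) :
    ∃ v : NNReal, 1 ≤ v ∧ G.map (fun x => s * x j) = gaussianReal 0 v := by
  obtain ⟨v, hv⟩ := hG.2 (Pi.single j s)
  have he : (fun x : Fin d → ℝ => ∑ k, (Pi.single j s : Fin d → ℝ) k * x k) = fun x => s * x j := by
    ext x
    rw [Finset.sum_eq_single j]
    · simp
    · intro k _ hk; simp [hk]
    · simp
  rw [he] at hv
  refine ⟨v, ?_, hv⟩
  have h1 : ∫ x, x ^ 2 ∂(gaussianReal 0 v) = v := by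
    have := variance_id_gaussianReal (μ := 0) (v := v)
    rw [variance_of_integral_eq_zero aemeasurable_id (by simp)] at this
    simpa using this
  rw [← hv, integral_map (Measurable.aemeasurable (by fun_prop)) (by fun_prop)] at h1
  have h2 : ∀ x : Fin d → ℝ, (s * x j) ^ 2 = (x j) ^ 2 := by
    intro x; rcases hs with rfl | rfl <;> ring
  simp only [h2] at h1
  have := hvar j
  rw [h1] at this
  exact_mod_cast this

lemma markov_aux {d : ℕ} (γ : Measure ((Fin d → ℝ) × (Fin d → ℝ))) {ε : ℝ} (hε : 0 < ε) :
    γ {p | ∃ j, ε ≤ |p.1 j - p.2 j|} ≤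
      (∫⁻ p, ENNReal.ofReal (∑ j, (p.1 j - p.2 j) ^ 2) ∂γ) / ENNReal.ofReal (ε ^ 2) := by
  refine le_trans (measure_mono ?_) (meas_ge_le_lintegral_div (by fun_prop)
    (by simp; positivity) ENNReal.ofReal_ne_top)
  rintro p ⟨j, hj⟩
  refine ENNReal.ofReal_le_ofReal ?_
  calc ε ^ 2 ≤ |p.1 j - p.2 j| ^ 2 := by gcongr
    _ = (p.1 j - p.2 j) ^ 2 := sq_abs _
    _ ≤ _ := Finset.single_le_sum (f := fun j => (p.1 j - p.2 j) ^ 2)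
        (fun _ _ => sq_nonneg _) (Finset.mem_univ j)

lemma core_bound {d : ℕ} {G μ : Measure (Fin d → ℝ)}
    (hG : IsCenteredGaussianMeasure G) (hvar : ∀ j, 1 ≤ ∫ x, (x j) ^ 2 ∂G)
    {ι : Type} [Fintype ι] (f : ι → Fin d) (s : ι → ℝ)
    (hs : ∀ i, s i = 1 ∨ s i = -1) (β : ι → ℝ)
    {γ : Measure ((Fin d → ℝ) × (Fin d → ℝ))} (h1 : γ.map Prod.fst = μ) (h2 : γ.map Prod.snd = G)
    {ε B : ℝ} (hε0 : 0 < ε) (hε : ε ≤ 1)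
    (hB : 1 ≤ B) (hcard : Fintype.card ι * Real.exp (-((B-1)^2/2)) ≤ 1) :
    μ {x | ∀ i, s i * x (f i) < β i} ≤ G {x | ∀ i, s i * x (f i) < β i} +
      (ENNReal.ofReal ((Real.exp (3/2) * B + 1) * ε) +
      (∫⁻ p, ENNReal.ofReal (∑ j, (p.1 j - p.2 j) ^ 2) ∂γ) / ENNReal.ofReal (ε ^ 2)) ∧
    G {x | ∀ i, s i * x (f i) < β i} ≤ μ {x | ∀ i, s i * x (f i) < β i} +
      (ENNReal.ofReal ((Real.exp (3/2) * B + 1) * ε) +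
      (∫⁻ p, ENNReal.ofReal (∑ j, (p.1 j - p.2 j) ^ 2) ∂γ) / ENNReal.ofReal (ε ^ 2)) := by
  have := isGaussian_of_centered hG
  let _ : LinearOrder ι := LinearOrder.lift' (Fintype.equivFin ι) (Fintype.equivFin ι).injective
  have hY : HasGaussianLaw (fun (x : Fin d → ℝ) i => s i * x (f i)) G := by
    let L : (Fin d → ℝ) →L[ℝ] (ι → ℝ) := ContinuousLinearMap.pi fun k =>
      (s k) • ContinuousLinearMap.proj (R := ℝ) (φ := fun _ : Fin d => ℝ) (f k)
    have := (IsGaussian.hasGaussianLaw_id (μ := G)).map_fun L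
    exact this
  have hn : ∀ b : ι → ℝ, _ := fun b => nazarov (Y := fun i (x : Fin d → ℝ) => s i * x (f i)) hY
    (fun i => by fun_prop)
    (fun i => coord_law hG hvar (f i) (s i) (hs i)) b hε0.le hε hB hcard
  have hmS : ∀ b : ι → ℝ, MeasurableSet {x : Fin d → ℝ | ∀ i, s i * x (f i) < b i} := by
    intro b
    have : {x : Fin d → ℝ | ∀ i, s i * x (f i) < b i} =
      ⋂ i, {x : Fin d → ℝ | s i * x (f i) < b i} := by ext; simp
    rw [this]
    exact MeasurableSet.iInter fun i => measurableSet_lt (by fun_prop) (by fun_prop)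
  have hstep : ∀ b : ι → ℝ, G {x | ∀ i, s i * x (f i) < b i + ε} ≤
      G {x | ∀ i, s i * x (f i) < b i} + ENNReal.ofReal ((Real.exp (3/2) * B + 1) * ε) := by
    intro b
    refine (measure_le_inter_add_sdiff G _ {x | ∀ i, s i * x (f i) < b i}).trans ?_
    refine add_le_add (measure_mono Set.inter_subset_right) (hn b)
  have hclose : ∀ p : (Fin d → ℝ) × (Fin d → ℝ), (¬ ∃ j, ε ≤ |p.1 j - p.2 j|) →
      ∀ i, s i * p.1 (f i) < s i * p.2 (f i) + ε ∧ s i * p.2 (f i) < s i * p.1 (f i) + ε := by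
    intro p hp i
    push Not at hp
    have := abs_lt.1 (hp (f i))
    rcases hs i with h | h <;> rw [h] <;> constructor <;> linarith [this.1, this.2]
  have hM := markov_aux γ hε0
  constructor
  · calc μ {x | ∀ i, s i * x (f i) < β i}
        = γ {p | ∀ i, s i * p.1 (f i) < β i} := by
          rw [← h1, Measure.map_apply measurable_fst (hmS β)]; rfl
      _ ≤ γ ({p | ∀ i, s i * p.2 (f i) < β i + ε} ∪ {p | ∃ j, ε ≤ |p.1 j - p.2 j|}) := by
          refine measure_mono fun p hp => ?_
          by_cases h : ∃ j, ε ≤ |p.1 j - p.2 j|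
          · exact Or.inr h
          · refine Or.inl fun i => ?_
            have := (hclose p h i).2
            have := hp i
            linarith
      _ ≤ γ {p | ∀ i, s i * p.2 (f i) < β i + ε} + γ {p | ∃ j, ε ≤ |p.1 j - p.2 j|} :=
          measure_union_le _ _
      _ = G {x | ∀ i, s i * x (f i) < β i + ε} + γ {p | ∃ j, ε ≤ |p.1 j - p.2 j|} := by
          rw [← h2, Measure.map_apply measurable_snd (hmS (fun i => β i + ε))]; rfl
      _ ≤ _ := by
          rw [← add_assoc]
          exact add_le_add (hstep β) hM
  · calc G {x | ∀ i, s i * x (f i) < β i}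
        = G {x | ∀ i, s i * x (f i) < (β i - ε) + ε} := by simp
      _ ≤ G {x | ∀ i, s i * x (f i) < β i - ε} +
            ENNReal.ofReal ((Real.exp (3/2) * B + 1) * ε) := hstep _
      _ = γ {p | ∀ i, s i * p.2 (f i) < β i - ε} +
            ENNReal.ofReal ((Real.exp (3/2) * B + 1) * ε) := by
          conv_lhs => rw [← h2, Measure.map_apply measurable_snd (hmS (fun i => β i - ε))]
          rfl
      _ ≤ (γ {p | ∀ i, s i * p.1 (f i) < β i} + γ {p | ∃ j, ε ≤ |p.1 j - p.2 j|}) +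
            ENNReal.ofReal ((Real.exp (3/2) * B + 1) * ε) := by
          gcongr
          refine le_trans (measure_mono fun p hp => ?_) (measure_union_le _ _)
          by_cases h : ∃ j, ε ≤ |p.1 j - p.2 j|
          · exact Or.inr h
          · refine Or.inl fun i => ?_
            have := (hclose p h i).1
            have := hp i
            linarith
      _ = (μ {x | ∀ i, s i * x (f i) < β i} + γ {p | ∃ j, ε ≤ |p.1 j - p.2 j|}) +
            ENNReal.ofReal ((Real.exp (3/2) * B + 1) * ε) := by
          rw [← h1, Measure.map_apply measurable_fst (hmS β)]; rfl
      _ ≤ _ := by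
          rw [add_assoc, add_comm (γ _)]
          gcongr

/-- The representation of a rectangle by finitely many half-space constraints. -/
lemma rect_repr {d : ℕ} {A : Set (Fin d → ℝ)} (hA : IsHyperrectangle A) :
    A = ∅ ∨ ∃ (ι : Type) (_ : Fintype ι) (f : ι → Fin d) (s : ι → ℝ) (β : ι → ℝ),
      (∀ i, s i = 1 ∨ s i = -1) ∧ Fintype.card ι ≤ 2 * d ∧
      A = {x | ∀ i, s i * x (f i) < β i} := by
  classical
  obtain ⟨a, b, rfl⟩ := hA
  by_cases hdeg : ∃ j, a j = ⊤ ∨ b j = ⊥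
  · left
    obtain ⟨j, hj⟩ := hdeg
    ext x
    simp only [Set.mem_ofPred_eq, Set.mem_empty_iff_false, iff_false]
    intro h
    rcases hj with hj | hj
    · have := (h j).1; simp [hj] at this
    · have := (h j).2; simp [hj] at this
  right
  push Not at hdeg
  refine ⟨{p : Fin d × Bool // if p.2 then b p.1 ≠ ⊤ else a p.1 ≠ ⊥}, inferInstance,
    fun p => p.1.1, fun p => if p.1.2 then 1 else -1,
    fun p => if p.1.2 then (b p.1.1).toReal else -(a p.1.1).toReal, ?_, ?_, ?_⟩
  · intro i; by_cases h : i.1.2 <;> simp [h]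
  · refine (Fintype.card_subtype_le _).trans ?_
    simp [mul_comm]
  · ext x
    simp only [Set.mem_ofPred_eq]
    have hb : ∀ j, b j ≠ ⊤ → ((x j : EReal) < b j ↔ x j < (b j).toReal) := by
      intro j hj
      conv_lhs => rw [← EReal.coe_toReal hj (hdeg j).2]
      exact EReal.coe_lt_coe_iff
    have ha : ∀ j, a j ≠ ⊥ → (a j < (x j : EReal) ↔ (a j).toReal < x j) := by
      intro j hj
      conv_lhs => rw [← EReal.coe_toReal (hdeg j).1 hj]
      exact EReal.coe_lt_coe_iff
    constructor
    · rintro h ⟨⟨j, t⟩, hp⟩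
      cases t
      · simp at hp ⊢
        exact (ha j hp).1 (h j).1
      · simp at hp ⊢
        exact (hb j hp).1 (h j).2
    · intro h j
      constructor
      · by_cases hj : a j = ⊥
        · rw [hj]; exact EReal.bot_lt_coe _
        · have := h ⟨(j, false), by simpa using hj⟩
          simp at this
          exact (ha j hj).2 this
      · by_cases hj : b j = ⊤
        · rw [hj]; exact EReal.coe_lt_top _
        · have := h ⟨(j, true), by simpa using hj⟩
          simp at this
          exact (hb j hj).2 this

lemma real_bound {d : ℕ} (hd : 3 ≤ d) {G μ : Measure (Fin d → ℝ)} [IsProbabilityMeasure μ]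
    (hG : IsCenteredGaussianMeasure G) (hvar : ∀ j, 1 ≤ ∫ x, (x j) ^ 2 ∂G)
    {A : Set (Fin d → ℝ)} (hA : IsHyperrectangle A)
    {γ : Measure ((Fin d → ℝ) × (Fin d → ℝ))} (h1 : γ.map Prod.fst = μ) (h2 : γ.map Prod.snd = G)
    {v : ℝ} (hv : 0 < v)
    (hI : ∫⁻ p, ENNReal.ofReal (∑ j, (p.1 j - p.2 j) ^ 2) ∂γ ≤ ENNReal.ofReal v) :
    |(μ A).toReal - (G A).toReal| ≤
      (3 * Real.exp (3/2) + 2) * (Real.log d) ^ ((1:ℝ)/3) * v ^ ((1:ℝ)/3) := by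
  have := hG.1
  have hd3 : (3:ℝ) ≤ d := by exact_mod_cast hd
  have hd0 : (0:ℝ) < d := by linarith
  set Lg := Real.log d with hLg
  have hL1 : 1 ≤ Lg := by
    rw [hLg, Real.le_log_iff_exp_le hd0]
    linarith [Real.exp_one_lt_three]
  set l := Lg ^ ((1:ℝ)/6) with hl
  set u := v ^ ((1:ℝ)/3) with hu
  have hl1 : 1 ≤ l := Real.one_le_rpow hL1 (by norm_num)
  have hu0 : 0 < u := by positivity
  have hl2 : Lg ^ ((1:ℝ)/3) = l ^ 2 := by
    rw [hl, ← Real.rpow_natCast, ← Real.rpow_mul (by linarith)]; norm_num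
  have hl6 : Lg = l ^ 6 := by
    rw [hl, ← Real.rpow_natCast, ← Real.rpow_mul (by linarith)]; norm_num
  have hu3 : v = u ^ 3 := by
    rw [hu, ← Real.rpow_natCast, ← Real.rpow_mul hv.le]; norm_num
  rw [hl2]
  have he : 0 < Real.exp (3/2) := Real.exp_pos _
  have hl0 : 0 < l := by linarith
  rcases rect_repr hA with rfl | ⟨ι, _, f, s, β, hs, hcard, hAeq⟩
  · simp; positivity
  have hdiff : |(μ A).toReal - (G A).toReal| ≤ 1 := by
    have a1 : (μ A).toReal ≤ 1 := measureReal_le_one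
    have a2 : (G A).toReal ≤ 1 := measureReal_le_one
    have a3 : 0 ≤ (μ A).toReal := ENNReal.toReal_nonneg
    have a4 : 0 ≤ (G A).toReal := ENNReal.toReal_nonneg
    rw [abs_le]; constructor <;> linarith
  rcases lt_or_ge l u with hul | hul
  · refine hdiff.trans ?_
    have h3 : 1 ≤ l ^ 2 := one_le_pow₀ hl1
    have h4 : 1 ≤ l ^ 2 * u := by nlinarith
    nlinarith
  have hB : (1:ℝ) ≤ 1 + 2 * l ^ 3 := by have := pow_pos hl0 3; linarith
  have hc : Fintype.card ι * Real.exp (-((1 + 2 * l ^ 3 - 1)^2/2)) ≤ 1 := by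
    have e1 : -((1 + 2 * l ^ 3 - 1)^2/2) = -(Lg + Lg) := by rw [hl6]; ring
    rw [e1, Real.exp_neg, Real.exp_add, hLg, Real.exp_log hd0]
    have : (Fintype.card ι : ℝ) ≤ 2 * d := by exact_mod_cast hcard
    rw [← div_eq_mul_inv, div_le_one (by positivity)]
    nlinarith
  have hε0 : 0 < u / l := by positivity
  have hε1 : u / l ≤ 1 := (div_le_one hl0).2 hul
  obtain ⟨c1, c2⟩ := core_bound (μ := μ) hG hvar f s hs β h1 h2 hε0 hε1 hB hc
  rw [← hAeq] at c1 c2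
  have hQ : ENNReal.ofReal ((Real.exp (3/2) * (1 + 2 * l ^ 3) + 1) * (u / l)) +
      (∫⁻ p, ENNReal.ofReal (∑ j, (p.1 j - p.2 j) ^ 2) ∂γ) / ENNReal.ofReal ((u / l) ^ 2) ≤
      ENNReal.ofReal ((3 * Real.exp (3/2) + 2) * l ^ 2 * u) := by
    calc _ ≤ ENNReal.ofReal ((Real.exp (3/2) * (1 + 2 * l ^ 3) + 1) * (u / l)) +
        ENNReal.ofReal v / ENNReal.ofReal ((u / l) ^ 2) := by gcongr
      _ = ENNReal.ofReal ((Real.exp (3/2) * (1 + 2 * l ^ 3) + 1) * (u / l) + v / (u/l)^2) := by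
        rw [← ENNReal.ofReal_div_of_pos (by positivity),
          ← ENNReal.ofReal_add (by positivity) (by positivity)]
      _ ≤ _ := by
        apply ENNReal.ofReal_le_ofReal
        have e1 : v / (u/l)^2 = l ^ 2 * u := by rw [hu3]; field_simp
        have h3 : 1 ≤ l ^ 3 := one_le_pow₀ hl1
        have e2 : (Real.exp (3/2) * (1 + 2 * l ^ 3) + 1) * (u / l) ≤
            ((3 * Real.exp (3/2) + 1) * l ^ 3) * (u / l) := by
          gcongr
          nlinarith
        have e3 : ((3 * Real.exp (3/2) + 1) * l ^ 3) * (u / l) =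
            (3 * Real.exp (3/2) + 1) * l ^ 2 * u := by field_simp
        rw [e1]
        nlinarith
  have hR0 : 0 ≤ (3 * Real.exp (3/2) + 2) * l ^ 2 * u := by positivity
  have hconv : ∀ p q : ENNReal, p ≠ ⊤ → q ≠ ⊤ →
      p ≤ q + ENNReal.ofReal ((3 * Real.exp (3/2) + 2) * l ^ 2 * u) →
      p.toReal ≤ q.toReal + (3 * Real.exp (3/2) + 2) * l ^ 2 * u := by
    intro p q hp hq h
    have := ENNReal.toReal_mono (by simp [hq]) h
    rwa [ENNReal.toReal_add hq ENNReal.ofReal_ne_top, ENNReal.toReal_ofReal hR0] at this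
  have r1 := hconv _ _ (measure_ne_top μ A) (measure_ne_top G A) (c1.trans (by gcongr))
  have r2 := hconv _ _ (measure_ne_top G A) (measure_ne_top μ A) (c2.trans (by gcongr))
  rw [abs_le]; constructor <;> linarith

/-- **Proposition 2 (from transport distance to rectangle distance).** -/
theorem rectangle_distance_le_wasserstein :
    ∃ C : ℝ, 0 < C ∧
      ∀ (d : ℕ), 3 ≤ d →
      ∀ (Ω : Type) (_ : MeasurableSpace Ω) (P : Measure Ω) (_ : IsProbabilityMeasure P)
        (T : Ω → Fin d → ℝ), Measurable T →
      ∀ G : Measure (Fin d → ℝ), IsCenteredGaussianMeasure G →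
        (∀ j, 1 ≤ ∫ x, (x j) ^ 2 ∂G) →
      ∀ A : Set (Fin d → ℝ), IsHyperrectangle A →
        ENNReal.ofReal |(P (T ⁻¹' A)).toReal - (G A).toReal| ≤
          ENNReal.ofReal (C * (Real.log d) ^ ((1 : ℝ) / 3)) *
            (wasserstein2 (P.map T) G) ^ ((2 : ℝ) / 3) := by

  refine ⟨3 * Real.exp (3/2) + 2, by positivity, ?_⟩
  intro d hd Ω _ P _ T hT G hG hvar A hA
  have hmA : MeasurableSet A := by
    rcases rect_repr hA with rfl | ⟨ι, _, f, s, β, -, -, rfl⟩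
    · exact MeasurableSet.empty
    · have : {x : Fin d → ℝ | ∀ i, s i * x (f i) < β i} =
        ⋂ i, {x : Fin d → ℝ | s i * x (f i) < β i} := by ext; simp
      rw [this]
      exact MeasurableSet.iInter fun i => measurableSet_lt (by fun_prop) (by fun_prop)
  rw [← Measure.map_apply hT hmA]
  have : IsProbabilityMeasure (P.map T) := Measure.isProbabilityMeasure_map hT.aemeasurable
  set μ := P.map T
  have hd3 : (3:ℝ) ≤ d := by exact_mod_cast hd
  have hlog : 0 < Real.log d := Real.log_pos (by linarith)
  unfold wasserstein2
  set V : ENNReal := ⨅ γ : {γ : Measure ((Fin d → ℝ) × (Fin d → ℝ)) //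
      γ.map Prod.fst = μ ∧ γ.map Prod.snd = G},
    ∫⁻ p : (Fin d → ℝ) × (Fin d → ℝ), ENNReal.ofReal (∑ j, (p.1 j - p.2 j) ^ 2) ∂γ.1 with hV
  rw [← ENNReal.rpow_mul, show (1:ℝ)/2 * (2/3) = 1/3 by norm_num]
  by_cases hVtop : V = ⊤
  · rw [hVtop, ENNReal.top_rpow_of_pos (by norm_num), ENNReal.mul_top]
    · exact le_top
    · simp only [ne_eq, ENNReal.ofReal_eq_zero, not_le]
      positivity
  have hmain : ∀ w : ℝ, V.toReal < w → |(μ A).toReal - (G A).toReal| ≤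
      (3 * Real.exp (3/2) + 2) * (Real.log d) ^ ((1:ℝ)/3) * w ^ ((1:ℝ)/3) := by
    intro w hw
    have hw0 : 0 < w := ENNReal.toReal_nonneg.trans_lt hw
    have hlt : V < ENNReal.ofReal w := (ENNReal.lt_ofReal_iff_toReal_lt hVtop).2 hw
    obtain ⟨γ, hγ⟩ := iInf_lt_iff.1 hlt
    exact real_bound hd hG hvar hA γ.2.1 γ.2.2 hw0 hγ.le
  have hlim : |(μ A).toReal - (G A).toReal| ≤
      (3 * Real.exp (3/2) + 2) * (Real.log d) ^ ((1:ℝ)/3) * V.toReal ^ ((1:ℝ)/3) := by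
    have hcont : Continuous fun w : ℝ =>
        (3 * Real.exp (3/2) + 2) * (Real.log d) ^ ((1:ℝ)/3) * w ^ ((1:ℝ)/3) :=
      continuous_const.mul (Real.continuous_rpow_const (by norm_num))
    refine ge_of_tendsto ((hcont.tendsto V.toReal).mono_left
      (nhdsWithin_le_nhds (s := Set.Ioi V.toReal))) ?_
    filter_upwards [self_mem_nhdsWithin] with w hw
    exact hmain w hw
  refine (ENNReal.ofReal_le_ofReal hlim).trans ?_
  rw [ENNReal.ofReal_mul (by positivity),
    ← ENNReal.ofReal_rpow_of_nonneg ENNReal.toReal_nonneg (by norm_num),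
    ENNReal.ofReal_toReal hVtop]
end
end

section
/- Let d ≥ 3 and let Y be a centered Gaussian vector in ℝ^d such that min_{1≤j≤d} E Y_j² ≥ σ̲² for some σ̲ > 0. Then for every y ∈ ℝ^d and ε > 0, P(Y_j ≤ y_j + ε for all 1 ≤ j ≤ d) − P(Y_j ≤ y_j for all 1 ≤ j ≤ d) ≤ (ε/σ̲)(√(2 log d) + 2). -/
open MeasureTheory ProbabilityTheory Real

noncomputable section

lemma aux_pdf (m t : ℝ) : gaussianPDFReal m 1 t = (√(2 * π))⁻¹ * rexp (-(t - m) ^ 2 / 2) := by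
  simp [gaussianPDFReal]

lemma aux_inv_le : (√(2 * π))⁻¹ ≤ 1 := by
  apply inv_le_one_of_one_le₀
  rw [Real.one_le_sqrt]
  nlinarith [Real.pi_gt_three]

lemma aux_pdf_le_one (m t : ℝ) : gaussianPDFReal m 1 t ≤ 1 := by
  rw [aux_pdf]
  have h1 : rexp (-(t - m) ^ 2 / 2) ≤ 1 := by
    rw [Real.exp_le_one_iff]; nlinarith [sq_nonneg (t - m)]
  exact mul_le_one₀ aux_inv_le (Real.exp_pos _).le h1

lemma aux_hasDeriv (m t : ℝ) :
    HasDerivAt (gaussianPDFReal m 1) (-(t - m) * gaussianPDFReal m 1 t) t := by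
  have h : gaussianPDFReal m 1 = fun t => (√(2 * π))⁻¹ * rexp (-(t - m) ^ 2 / 2) := by
    funext t; exact aux_pdf m t
  rw [h]
  have h1 : HasDerivAt (fun t : ℝ => -(t - m) ^ 2 / 2) (-(t - m)) t := by
    have := ((((hasDerivAt_id t).sub_const m).pow 2).neg).div_const 2
    refine this.congr_deriv ?_
    simp only [id]
    norm_num
    ring
  refine (h1.exp.const_mul ((√(2 * π))⁻¹)).congr_deriv ?_
  ring

lemma aux_tail_real (m t c : ℝ) (hc : 0 ≤ c) (htc : t - m ≤ c) :
    gaussianPDFReal m 1 t / (c + 1) ≤ ∫ x in Set.Ioi t, gaussianPDFReal m 1 x := by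
  have key : ∀ n : ℕ, gaussianPDFReal m 1 t / (c + 1) - 1 / ((n : ℝ) + 1) ≤
      ∫ x in Set.Ioi t, gaussianPDFReal m 1 x := by
    intro n
    have hD : ∀ x, t ≤ x → 0 < x - t + c + 1 := fun x hx => by linarith
    have hder : ∀ x, t ≤ x → HasDerivAt (fun x => -(gaussianPDFReal m 1 x / (x - t + c + 1)))
        (-(((-(x - m) * gaussianPDFReal m 1 x) * (x - t + c + 1) - gaussianPDFReal m 1 x * 1) /
          (x - t + c + 1) ^ 2)) x := by
      intro x hx
      have h2 : HasDerivAt (fun x : ℝ => x - t + c + 1) 1 x :=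
        (((hasDerivAt_id x).sub_const t).add_const c).add_const 1
      exact ((aux_hasDeriv m x).div h2 (hD x hx).ne').neg
    have h1 := intervalIntegral.sub_le_integral_of_hasDeriv_right_of_le
      (a := t) (b := t + n) (φ := gaussianPDFReal m 1) (by simp)
      (fun x hx => (hder x hx.1).continuousAt.continuousWithinAt)
      (fun x hx => (hder x hx.1.le).hasDerivWithinAt)
      (integrable_gaussianPDFReal m 1).integrableOn
      (by
        intro x hx
        have hp := gaussianPDFReal_nonneg m 1 x
        have hd := hD x hx.1.le
        rw [← neg_div, div_le_iff₀ (by positivity)]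
        have hx1 := hx.1
        have : (x - m) * (x - t + c + 1) + 1 ≤ (x - t + c + 1) ^ 2 := by
          nlinarith
        nlinarith)
    have h2 : ∫ y in t..(t + n), gaussianPDFReal m 1 y ≤ ∫ x in Set.Ioi t, gaussianPDFReal m 1 x := by
      rw [intervalIntegral.integral_of_le (by simp)]
      exact setIntegral_mono_set (integrable_gaussianPDFReal m 1).integrableOn
        (Filter.Eventually.of_forall fun x => gaussianPDFReal_nonneg m 1 x)
        (Filter.Eventually.of_forall fun x hx => hx.1)
    have h3 : gaussianPDFReal m 1 (t + n) / (t + n - t + c + 1) ≤ 1 / ((n : ℝ) + 1) := by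
      gcongr
      · exact aux_pdf_le_one _ _
      · linarith
    have h4 : t - t + c + 1 = c + 1 := by ring
    rw [h4] at h1
    linarith
  have hl := (tendsto_const_nhds (x := gaussianPDFReal m 1 t / (c + 1))).sub
    (tendsto_one_div_add_atTop_nhds_zero_nat (𝕜 := ℝ))
  rw [sub_zero] at hl
  exact le_of_tendsto' hl key

lemma aux_tail (m t c : ℝ) (hc : 0 ≤ c) (htc : t - m ≤ c) :
    gaussianPDF m 1 t ≤ ENNReal.ofReal (c + 1) * gaussianReal m 1 (Set.Ioi t) := by
  rw [gaussianReal_apply_eq_integral m one_ne_zero, ← ENNReal.ofReal_mul (by linarith), gaussianPDF]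
  apply ENNReal.ofReal_le_ofReal
  have := aux_tail_real m t c hc htc
  rwa [div_le_iff₀' (by linarith)] at this

lemma aux_pdf_far (d : ℕ) (hd : 3 ≤ d) (m t : ℝ) (ht : √(2 * Real.log d) < t - m) :
    gaussianPDF m 1 t ≤ ENNReal.ofReal (1 / d) := by
  apply ENNReal.ofReal_le_ofReal
  rw [aux_pdf]
  have hd0 : (0 : ℝ) < d := by positivity
  have h0 : 0 ≤ √(2 * Real.log d) := Real.sqrt_nonneg _
  have h1 : 2 * Real.log d ≤ (t - m) ^ 2 := by
    have h : 0 ≤ 2 * Real.log d := by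
      have := Real.log_nonneg (x := d) (by exact_mod_cast (by omega : 1 ≤ d))
      linarith
    nlinarith [Real.sq_sqrt h]
  have h2 : rexp (-(t - m) ^ 2 / 2) ≤ 1 / d := by
    rw [one_div, ← Real.exp_log hd0, ← Real.exp_neg, Real.exp_le_exp]
    linarith
  calc _ ≤ 1 * (1 / (d : ℝ)) := by gcongr; exact aux_inv_le
    _ = 1 / d := by ring

open scoped ENNReal in
lemma aux_decomp {d : ℕ} {Ω : Type} [MeasurableSpace Ω] {P : Measure Ω} [IsProbabilityMeasure P]
    {X : Ω → Fin d → ℝ} (hXm : Measurable X) (hX : HasGaussianLaw X P) (m : Fin d → ℝ)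
    (hm : ∀ j, P.map (fun ω => X ω j) = gaussianReal (m j) 1) (j : Fin d) :
    ∃ g : ℝ → ℝ≥0∞, Monotone g ∧ (∀ t, g t ≤ 1) ∧ ∀ B : Set ℝ, MeasurableSet B →
      P {ω | X ω j ∈ B ∧ ∀ i, (i < j → X ω i < X ω j) ∧ X ω i ≤ X ω j} =
        ∫⁻ t in B, g t ∂(gaussianReal (m j) 1) := by
  have hXj : ∀ i, Measurable (fun ω => X ω i) := fun i => (measurable_pi_apply i).comp hXm
  have hL2 : ∀ i, MemLp (fun ω => X ω i) 2 P := fun i =>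
    (hX.map (ContinuousLinearMap.proj (R := ℝ) i)).memLp_two
  have hvar : ∀ i, Var[fun ω => X ω i; P] = 1 := by
    intro i
    have h := variance_id_gaussianReal (μ := m i) (v := 1)
    rw [← hm i, variance_id_map (hXj i).aemeasurable] at h
    simpa using h
  set ρ : Fin d → ℝ := fun i => cov[fun ω => X ω i, fun ω => X ω j; P] with hρ
  have hρ1 : ∀ i, ρ i ≤ 1 := by
    intro i
    have h1 := variance_fun_sub (hL2 i) (hL2 j)
    have h2 := variance_nonneg (fun ω => X ω i - X ω j) P
    rw [h1, hvar, hvar] at h2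
    simp only [hρ]
    linarith
  let V : Fin d → Ω → ℝ := fun i ω => X ω i - ρ i * X ω j
  have hVm : Measurable (fun ω i => V i ω) := by
    apply measurable_pi_lambda
    intro i
    exact (hXj i).sub ((hXj j).const_mul _)
  have hcov : ∀ (_ : Unit) i, cov[fun ω => X ω j, V i; P] = 0 := by
    intro _ i
    simp only [V]
    rw [covariance_fun_sub_right (hL2 j) (hL2 i) ((hL2 j).const_mul _),
      covariance_const_mul_right, covariance_self (hXj j).aemeasurable, hvar,
      covariance_comm]
    simp [hρ]
  have hjoint : HasGaussianLaw (fun ω => ((fun (_ : Unit) => X ω j), fun i => V i ω)) P := by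
    let L : (Fin d → ℝ) →L[ℝ] (Unit → ℝ) × (Fin d → ℝ) :=
      (ContinuousLinearMap.pi fun _ => ContinuousLinearMap.proj (R := ℝ) j).prod
      (ContinuousLinearMap.pi fun i => ContinuousLinearMap.proj (R := ℝ) i -
        ρ i • ContinuousLinearMap.proj (R := ℝ) j)
    exact hX.map_fun L
  have hind0 := HasGaussianLaw.indepFun_of_covariance_eval
    (X := fun (_ : Unit) ω => X ω j) (Y := V) hjoint hcov
  have hind : IndepFun (fun ω => X ω j) (fun ω i => V i ω) P :=
    hind0.comp (φ := fun f : Unit → ℝ => f ()) (ψ := id) (measurable_pi_apply _) measurable_id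
  have hprod := (indepFun_iff_map_prod_eq_prod_map_map (hXj j).aemeasurable hVm.aemeasurable).1 hind
  rw [hm j] at hprod
  set ν : Measure (Fin d → ℝ) := P.map (fun ω i => V i ω) with hν
  have hνp : IsProbabilityMeasure ν := Measure.isProbabilityMeasure_map hVm.aemeasurable
  let S : Set (ℝ × (Fin d → ℝ)) :=
    {p | ∀ i, (i < j → p.2 i < (1 - ρ i) * p.1) ∧ p.2 i ≤ (1 - ρ i) * p.1}
  have hS : MeasurableSet S := by
    have : S = ⋂ i, ({p | i < j → p.2 i < (1 - ρ i) * p.1} ∩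
        {p | p.2 i ≤ (1 - ρ i) * p.1}) := by
      ext p; simp [S]
    rw [this]
    refine MeasurableSet.iInter fun i => MeasurableSet.inter ?_ ?_
    · by_cases h : i < j
      · simp only [h, forall_const]
        exact measurableSet_lt (by fun_prop) (by fun_prop)
      · simp [h]
    · exact measurableSet_le (by fun_prop) (by fun_prop)
  refine ⟨fun t => ν (Prod.mk t ⁻¹' S), ?_, fun t => prob_le_one, ?_⟩
  · intro s t hst
    apply measure_mono
    intro v hv i
    have hle : (1 - ρ i) * s ≤ (1 - ρ i) * t :=
      mul_le_mul_of_nonneg_left hst (by linarith [hρ1 i])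
    exact ⟨fun h => ((hv i).1 h).trans_le hle, (hv i).2.trans hle⟩
  · intro B hB
    have hBS : MeasurableSet (B ×ˢ Set.univ ∩ S) := (hB.prod MeasurableSet.univ).inter hS
    have h1 : {ω | X ω j ∈ B ∧ ∀ i, (i < j → X ω i < X ω j) ∧ X ω i ≤ X ω j} =
        (fun ω => (X ω j, fun i => V i ω)) ⁻¹' (B ×ˢ Set.univ ∩ S) := by
      ext ω
      simp only [V, S, Set.mem_ofPred_eq, Set.mem_preimage, Set.mem_inter_iff, Set.mem_prod,
        Set.mem_univ, and_true]
      refine and_congr_right fun _ => forall_congr' fun i => and_congr (imp_congr_right fun _ => ?_) ?_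
      · constructor <;> intro h <;> linarith
      · constructor <;> intro h <;> linarith
    rw [h1, ← Measure.map_apply ((hXj j).prodMk hVm) hBS, hprod, Measure.prod_apply hBS,
      ← lintegral_indicator hB]
    congr 1
    funext t
    by_cases ht : t ∈ B
    · rw [Set.indicator_of_mem ht]
      congr 1
      ext v; simp [ht]
    · rw [Set.indicator_of_notMem ht]
      convert measure_empty (μ := ν)
      ext v; simp [ht]

lemma aux_core {d : ℕ} (hd : 3 ≤ d) {Ω : Type} [MeasurableSpace Ω] {P : Measure Ω}
    [IsProbabilityMeasure P]
    {X : Ω → Fin d → ℝ} (hXm : Measurable X) (hX : HasGaussianLaw X P) (m : Fin d → ℝ)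
    (hm : ∀ j, P.map (fun ω => X ω j) = gaussianReal (m j) 1) (ε : ℝ) :
    P {ω | (∀ j, X ω j ≤ ε) ∧ ¬ ∀ j, X ω j ≤ 0} ≤
      ENNReal.ofReal (√(2 * Real.log d) + 2) * ENNReal.ofReal ε := by
  choose g hgm hg1 hg using aux_decomp hXm hX m hm
  have hXj : ∀ i, Measurable (fun ω => X ω i) := fun i => (measurable_pi_apply i).comp hXm
  set c := √(2 * Real.log d) with hc
  have hc0 : 0 ≤ c := Real.sqrt_nonneg _
  have hcover : {ω | (∀ j, X ω j ≤ ε) ∧ ¬ ∀ j, X ω j ≤ 0} ⊆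
      ⋃ j, {ω | X ω j ∈ Set.Ioc 0 ε ∧ ∀ i, (i < j → X ω i < X ω j) ∧ X ω i ≤ X ω j} := by
    rintro ω ⟨h1, h2⟩
    push Not at h2
    obtain ⟨k, hk⟩ := h2
    have hne : Nonempty (Fin d) := ⟨k⟩
    obtain ⟨j0, hj0⟩ := Finite.exists_max (X ω)
    let T : Finset (Fin d) := Finset.univ.filter fun j => ∀ i, X ω i ≤ X ω j
    have hT : T.Nonempty := ⟨j0, by simpa [T] using hj0⟩
    have hmem : ∀ i, X ω i ≤ X ω (T.min' hT) := by
      have := T.min'_mem hT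
      simpa [T] using this
    refine Set.mem_iUnion.2 ⟨T.min' hT, ⟨hk.trans_le (hmem k), h1 _⟩, fun i => ⟨fun hi => ?_, hmem i⟩⟩
    by_contra hcon
    push Not at hcon
    have hiT : i ∈ T := by
      simp only [T, Finset.mem_filter, Finset.mem_univ, true_and]
      exact fun l => (hmem l).trans hcon
    exact absurd (T.min'_le i hiT) (not_le.2 hi)
  have hpt : ∀ t, ∑ j, gaussianPDF (m j) 1 t * g j t ≤ ENNReal.ofReal (c + 2) := by
    intro t
    let A : Fin d → Set Ω := fun j =>
      {ω | X ω j ∈ Set.Ioi t ∧ ∀ i, (i < j → X ω i < X ω j) ∧ X ω i ≤ X ω j}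
    have hAm : ∀ j, MeasurableSet (A j) := by
      intro j
      have : A j = {ω | t < X ω j} ∩ ⋂ i, ({ω | i < j → X ω i < X ω j} ∩ {ω | X ω i ≤ X ω j}) := by
        ext ω; simp [A]
      rw [this]
      refine (measurableSet_lt measurable_const (hXj j)).inter
        (MeasurableSet.iInter fun i => MeasurableSet.inter ?_ (measurableSet_le (hXj i) (hXj j)))
      by_cases h : i < j
      · simp only [h, forall_const]
        exact measurableSet_lt (hXj i) (hXj j)
      · simp [h]
    have hdisj : Pairwise (Function.onFun Disjoint A) := by
      intro j k hjk
      rw [Function.onFun, Set.disjoint_left]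
      rintro ω ⟨_, h1⟩ ⟨_, h2⟩
      rcases lt_or_gt_of_ne hjk with h | h
      · exact absurd ((h2 j).1 h) (not_lt.2 (h1 k).2)
      · exact absurd ((h1 k).1 h) (not_lt.2 (h2 j).2)
    have hsum : ∑ j, P (A j) ≤ 1 := by
      rw [← tsum_fintype (L := .unconditional _), ← measure_iUnion hdisj hAm]
      exact prob_le_one
    have hterm : ∀ j, gaussianPDF (m j) 1 t * g j t ≤
        ENNReal.ofReal (c + 1) * P (A j) + ENNReal.ofReal (1 / d) := by
      intro j
      by_cases htc : t - m j ≤ c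
      · refine le_trans ?_ le_self_add
        have h1 : gaussianReal (m j) 1 (Set.Ioi t) * g j t ≤ P (A j) := by
          rw [show P (A j) = _ from hg j (Set.Ioi t) measurableSet_Ioi, mul_comm,
            ← setLIntegral_const]
          exact setLIntegral_mono' measurableSet_Ioi fun s hs => hgm j (le_of_lt hs)
        calc _ ≤ (ENNReal.ofReal (c + 1) * gaussianReal (m j) 1 (Set.Ioi t)) * g j t := by
              gcongr; exact aux_tail _ _ _ hc0 htc
          _ ≤ _ := by rw [mul_assoc]; gcongr
      · refine le_trans ?_ le_add_self
        calc _ ≤ ENNReal.ofReal (1 / d) * 1 := by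
              gcongr
              · exact aux_pdf_far d hd _ _ (not_le.1 htc)
              · exact hg1 j t
          _ = _ := mul_one _
    have hd0 : (d : ℝ) ≠ 0 := by positivity
    calc _ ≤ ∑ j, (ENNReal.ofReal (c + 1) * P (A j) + ENNReal.ofReal (1 / d)) :=
          Finset.sum_le_sum fun j _ => hterm j
      _ = ENNReal.ofReal (c + 1) * ∑ j, P (A j) + ENNReal.ofReal 1 := by
          rw [Finset.sum_add_distrib, ← Finset.mul_sum, Finset.sum_const, Finset.card_univ,
            Fintype.card_fin, ← ENNReal.ofReal_nsmul, nsmul_eq_mul, mul_one_div_cancel hd0]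
      _ ≤ ENNReal.ofReal (c + 1) * 1 + ENNReal.ofReal 1 := by gcongr
      _ = ENNReal.ofReal (c + 2) := by
          rw [mul_one, ← ENNReal.ofReal_add (by linarith) (by norm_num)]
          congr 1; ring
  calc _ ≤ ∑ j, P {ω | X ω j ∈ Set.Ioc 0 ε ∧ ∀ i, (i < j → X ω i < X ω j) ∧ X ω i ≤ X ω j} :=
        (measure_mono hcover).trans (measure_iUnion_fintype_le _ _)
    _ = ∑ j, ∫⁻ t in Set.Ioc 0 ε, gaussianPDF (m j) 1 t * g j t := by
        refine Finset.sum_congr rfl fun j _ => ?_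
        rw [hg j _ measurableSet_Ioc, gaussianReal_of_var_ne_zero _ one_ne_zero,
          setLIntegral_withDensity_eq_setLIntegral_mul _ (measurable_gaussianPDF _ _)
            (hgm j).measurable measurableSet_Ioc]
        rfl
    _ = ∫⁻ t in Set.Ioc 0 ε, ∑ j, gaussianPDF (m j) 1 t * g j t := by
        rw [lintegral_finsetSum]
        exact fun j _ => (measurable_gaussianPDF _ _).mul (hgm j).measurable
    _ ≤ ∫⁻ t in Set.Ioc 0 ε, ENNReal.ofReal (c + 2) := lintegral_mono fun t => hpt t
    _ = _ := by rw [setLIntegral_const, Real.volume_Ioc, sub_zero]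


/-- **Lemma 1 (Gaussian anti-concentration inequality).** -/
theorem gaussian_anti_concentration
    (d : ℕ) (hd : 3 ≤ d)
    (Ω : Type) (mΩ : MeasurableSpace Ω) (P : Measure Ω) (hP : IsProbabilityMeasure P)
    (Y : Ω → Fin d → ℝ) (hYm : Measurable Y)
    -- `Y` is a centered Gaussian vector
    (hgauss : ∀ t : Fin d → ℝ, ∃ v : NNReal,
      Measure.map (fun ω => ∑ j, t j * Y ω j) P = gaussianReal 0 v)
    (σlow : ℝ) (hσ : 0 < σlow)
    (hvar : ∀ j, σlow ^ 2 ≤ ∫ ω, (Y ω j) ^ 2 ∂P)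
    (y : Fin d → ℝ) (ε : ℝ) (hε : 0 < ε) :
    (P {ω | ∀ j, Y ω j ≤ y j + ε}).toReal - (P {ω | ∀ j, Y ω j ≤ y j}).toReal ≤
      ε / σlow * (Real.sqrt (2 * Real.log d) + 2) := by
  have hYj : ∀ i, Measurable (fun ω => Y ω i) := fun i => (measurable_pi_apply i).comp hYm
  have hlaw : ∀ j, ∃ v : NNReal, P.map (fun ω => Y ω j) = gaussianReal 0 v := by
    intro j
    obtain ⟨v, hv⟩ := hgauss (Pi.single j 1)
    refine ⟨v, ?_⟩
    rw [← hv]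
    congr 1
    funext ω
    simp [Pi.single_apply]
  choose v hv using hlaw
  have hv2 : ∀ j, σlow ^ 2 ≤ v j := by
    intro j
    have h1 : ∫ ω, (Y ω j) ^ 2 ∂P = v j := by
      have h := variance_id_gaussianReal (μ := 0) (v := v j)
      rw [variance_of_integral_eq_zero aemeasurable_id (by simp), ← hv j,
        integral_map (hYj j).aemeasurable (by fun_prop)] at h
      simpa using h
    rw [← h1]; exact hvar j
  have hs : ∀ j, σlow ≤ √(v j : ℝ) := fun j => Real.le_sqrt_of_sq_le (hv2 j)
  have hs0 : ∀ j, 0 < √(v j : ℝ) := fun j => hσ.trans_le (hs j)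
  let X : Ω → Fin d → ℝ := fun ω j => Y ω j / √(v j : ℝ) - y j / √(v j : ℝ)
  have hXm : Measurable X :=
    measurable_pi_lambda _ fun j => ((hYj j).div_const _).sub_const _
  have hY : HasGaussianLaw Y P := by
    refine ⟨isGaussian_of_map_eq_gaussianReal fun L => ?_⟩
    obtain ⟨w, hw⟩ := hgauss (fun j => L (Pi.single j 1))
    refine ⟨0, w, ?_⟩
    rw [Measure.map_map L.continuous.measurable hYm, ← hw]
    congr 1
    funext ω
    have : Y ω = ∑ j, Y ω j • (Pi.single j 1 : Fin d → ℝ) := by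
      ext i; simp [Finset.sum_apply, Pi.single_apply]
    rw [Function.comp_apply]
    conv_lhs => rw [this]
    rw [map_sum]
    simp [mul_comm]
  have hX : HasGaussianLaw X P := by
    let L : (Fin d → ℝ) →L[ℝ] (Fin d → ℝ) := ContinuousLinearMap.pi fun j =>
      (√(v j : ℝ))⁻¹ • ContinuousLinearMap.proj (R := ℝ) j
    have hLY := hY.map_fun L
    have := hLY.isGaussian_map
    refine ⟨?_⟩
    have h2 : X = (fun x => x - fun j => y j / √(v j : ℝ)) ∘ (fun ω => L (Y ω)) := by
      funext ω j
      simp [X, L, div_eq_inv_mul]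
    rw [h2, ← Measure.map_map (by fun_prop) (by fun_prop)]
    infer_instance
  have hm : ∀ j, P.map (fun ω => X ω j) = gaussianReal (-(y j / √(v j : ℝ))) 1 := by
    intro j
    have h1 : HasLaw (fun ω => Y ω j) (gaussianReal 0 (v j)) P := ⟨(hYj j).aemeasurable, hv j⟩
    have h2 := (gaussianReal_sub_const (gaussianReal_div_const h1 (√(v j : ℝ)))
      (y j / √(v j : ℝ))).map_eq
    convert h2 using 2
    · simp
    · have hvj : v j ≠ 0 := by
        intro h
        have := hs0 j
        simp [h] at this
      ext
      simp [Real.sq_sqrt, hvj]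
  have hcore := aux_core hd hXm hX _ hm (ε / σlow)
  have hsub : {ω | ∀ j, Y ω j ≤ y j + ε} \ {ω | ∀ j, Y ω j ≤ y j} ⊆
      {ω | (∀ j, X ω j ≤ ε / σlow) ∧ ¬ ∀ j, X ω j ≤ 0} := by
    rintro ω ⟨h1, h2⟩
    refine ⟨fun j => ?_, fun h => h2 fun j => ?_⟩
    · have := h1 j
      calc X ω j = (Y ω j - y j) / √(v j : ℝ) := by simp only [X]; ring
        _ ≤ ε / √(v j : ℝ) := by
            have := hs0 j
            gcongr; linarith
        _ ≤ ε / σlow := by gcongr; exact hs j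
    · have h3 : (Y ω j - y j) / √(v j : ℝ) ≤ 0 := by
        have := h j
        simp only [X] at this
        rwa [sub_div]
      rw [div_le_iff₀ (hs0 j)] at h3
      linarith
  have h1 : P {ω | ∀ j, Y ω j ≤ y j + ε} ≤ P {ω | ∀ j, Y ω j ≤ y j} +
      ENNReal.ofReal (√(2 * Real.log d) + 2) * ENNReal.ofReal (ε / σlow) := by
    calc _ ≤ P ({ω | ∀ j, Y ω j ≤ y j} ∪
          ({ω | ∀ j, Y ω j ≤ y j + ε} \ {ω | ∀ j, Y ω j ≤ y j})) := by
          apply measure_mono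
          rw [Set.union_sdiff_self]
          exact Set.subset_union_right
      _ ≤ _ := (measure_union_le _ _).trans (by gcongr; exact (measure_mono hsub).trans hcore)
  rw [← ENNReal.ofReal_mul (by positivity)] at h1
  have h2 := ENNReal.toReal_mono (by finiteness) h1
  rw [ENNReal.toReal_add (by finiteness) (by finiteness),
    ENNReal.toReal_ofReal (by positivity)] at h2
  linarith
end
end
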